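/- arXiv:1908.11777 — 5 statements merged into one kernel-verified Lean document; each statement's English description precedes it below -/
import Mathlib

section
/- Let n ≥ 2 be an integer, let ξ ∈ ℝ^{n+1} have ℚ-linearly independent coordinates, let S ⊆ ℤ^{n+1} satisfy lim_{X→∞} 𝓛_ξ(X;S) = 0, and let (x_i)_{i≥0} be a sequence of minimal points for ξ with respect to S. For each i ≥ 0 set X_i = ‖x_i‖ and L_i = L_ξ(x_i). Then there is a constant c > 0 depending only on ξ (independent of the choice of index i_0) such that: for every index i_0 ≥ 0 and every t = 1,…,n−1 there exists a largest integer i_t ≥ i_0 with dim span_ℝ(x_{i_0}, x_{i_0+1}, …, x_{i_t}) = t+1; these indices satisfy i_0 < i_1 < ⋯ < i_{n−1} and X_{i_1} ⋯ X_{i_{n−1}} ≤ c · L_{i_0} X_{i_0+1} ⋯ L_{i_{n−1}} X_{i_{n−1}+1}. -/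
open Filter

/-- Euclidean norm of an integer point of `ℤ^{n+1}`. -/
noncomputable def inorm {n : ℕ} (x : Fin (n + 1) → ℤ) : ℝ :=
  Real.sqrt (∑ k, ((x k : ℝ)) ^ 2)

/-- `L_ξ(x) = max_{1 ≤ k ≤ n} |ξ₀ x_k − ξ_k x₀|` (the term `k = 0` vanishes, so the
maximum over all `k` agrees with the maximum over `1 ≤ k ≤ n` when `n ≥ 1`). -/
noncomputable def Lxi {n : ℕ} (ξ : Fin (n + 1) → ℝ) (x : Fin (n + 1) → ℤ) : ℝ :=
  Finset.univ.sup' Finset.univ_nonempty fun k => |ξ 0 * (x k : ℝ) - ξ k * (x 0 : ℝ)|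

/-- `𝓛_ξ(X; S) = min { L_ξ(x) : x ∈ S, 0 < ‖x‖ ≤ X }`, with the convention `min ∅ = ∞`. -/
noncomputable def calL {n : ℕ} (ξ : Fin (n + 1) → ℝ) (S : Set (Fin (n + 1) → ℤ)) (X : ℝ) :
    ENNReal :=
  sInf { l | ∃ x ∈ S, x ≠ 0 ∧ inorm x ≤ X ∧ l = ENNReal.ofReal (Lxi ξ x) }

/-- `x` is a sequence of minimal points for `ξ` with respect to `S`. -/
def IsMinimalSeq {n : ℕ} (ξ : Fin (n + 1) → ℝ) (S : Set (Fin (n + 1) → ℤ))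
    (x : ℕ → Fin (n + 1) → ℤ) : Prop :=
  (∀ i, x i ∈ S ∧ x i ≠ 0) ∧
  (StrictMono fun i => inorm (x i)) ∧
  (StrictAnti fun i => Lxi ξ (x i)) ∧
  ∀ i, ∀ z ∈ S, z ≠ 0 → inorm z < inorm (x (i + 1)) → Lxi ξ (x i) ≤ Lxi ξ z

/-- The real vector associated with an integer point. -/
def rvec {n : ℕ} (x : Fin (n + 1) → ℤ) : Fin (n + 1) → ℝ := fun k => (x k : ℝ)

/-- `𝒱[i,j] = span_ℝ(x_i, x_{i+1}, …, x_j)`. -/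
def Vspan {n : ℕ} (x : ℕ → Fin (n + 1) → ℤ) (i j : ℕ) : Submodule ℝ (Fin (n + 1) → ℝ) :=
  Submodule.span ℝ ((fun m => rvec (x m)) '' Set.Icc i j)

lemma kc_gs {m : ℕ} (f : Fin m → Fin m → ℝ) :
    ∃ g : Fin m → Fin m → ℝ, (∀ i, ∑ k, (g i k) ^ 2 = 1) ∧
      (∀ i j, j < i → ∑ k, g i k * f j k = 0) ∧
      |(Matrix.of f).det| = |∏ i, ∑ k, g i k * f i k| := by
  let f' : Fin m → EuclideanSpace ℝ (Fin m) := fun i => WithLp.toLp 2 (f i)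
  have hfr : Module.finrank ℝ (EuclideanSpace ℝ (Fin m)) = Fintype.card (Fin m) := by simp
  let G := InnerProductSpace.gramSchmidtOrthonormalBasis hfr f'
  have hin : ∀ i j, inner ℝ (G i) (f' j) = ∑ k, G i k * f j k := by
    intro i j
    simp only [PiLp.inner_apply, f']
    exact Finset.sum_congr rfl fun k _ => by simp [mul_comm]
  refine ⟨fun i k => G i k, ?_, ?_, ?_⟩
  · intro i
    have h1 : ‖G i‖ = 1 := G.orthonormal.1 i
    have h2 := EuclideanSpace.real_norm_sq_eq (G i)
    rw [h1] at h2
    simpa using h2.symm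
  · intro i j hij
    rw [← hin]
    exact InnerProductSpace.gramSchmidtOrthonormalBasis_inv_triangular hfr f' hij
  · simp_rw [← hin]
    rw [← InnerProductSpace.gramSchmidtOrthonormalBasis_det hfr f']
    let b := EuclideanSpace.basisFun (Fin m) ℝ
    have h1 : |G.toBasis.det b| = 1 := by
      have := G.det_to_matrix_orthonormalBasis b
      rwa [Real.norm_eq_abs] at this
    have h2 : G.toBasis.det f' = G.toBasis.det b * b.toBasis.det f' := by
      rw [Module.Basis.det_apply, Module.Basis.det_apply, Module.Basis.det_apply, ← Matrix.det_mul]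
      congr 1
      have := Module.Basis.toMatrix_mul_toMatrix G.toBasis b.toBasis f'
      rw [← this]
      simp
    have h3 : b.toBasis.det f' = (Matrix.of f).det := by
      rw [Module.Basis.det_apply, ← Matrix.det_transpose]
      congr 1
    change _ = |G.toBasis.det f'|
    rw [h2, abs_mul, h1, h3, one_mul]

lemma kc_inorm_sq {n : ℕ} (x : Fin (n + 1) → ℤ) : inorm x ^ 2 = ∑ k, ((x k : ℝ)) ^ 2 :=
  Real.sq_sqrt (Finset.sum_nonneg fun _ _ => sq_nonneg _)

lemma kc_inorm_nonneg {n : ℕ} (x : Fin (n + 1) → ℤ) : 0 ≤ inorm x := Real.sqrt_nonneg _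

lemma kc_coord_le {n : ℕ} (x : Fin (n + 1) → ℤ) (k : Fin (n + 1)) : |(x k : ℝ)| ≤ inorm x := by
  refine abs_le_of_sq_le_sq ?_ (kc_inorm_nonneg x)
  rw [kc_inorm_sq]
  exact Finset.single_le_sum (f := fun k => ((x k : ℝ)) ^ 2) (fun _ _ => sq_nonneg _)
    (Finset.mem_univ k)

lemma kc_inorm_pos {n : ℕ} (x : Fin (n + 1) → ℤ) (hx : x ≠ 0) : 0 < inorm x := by
  obtain ⟨k, hk⟩ := Function.ne_iff.1 hx
  have : (0 : ℝ) < |(x k : ℝ)| := abs_pos.2 (by exact_mod_cast hk)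
  exact this.trans_le (kc_coord_le x k)

lemma kc_L_ge {n : ℕ} (ξ : Fin (n + 1) → ℝ) (x : Fin (n + 1) → ℤ) (k : Fin (n + 1)) :
    |ξ 0 * (x k : ℝ) - ξ k * (x 0 : ℝ)| ≤ Lxi ξ x :=
  Finset.le_sup' (fun k => |ξ 0 * (x k : ℝ) - ξ k * (x 0 : ℝ)|) (Finset.mem_univ k)

lemma kc_L_nonneg {n : ℕ} (ξ : Fin (n + 1) → ℝ) (x : Fin (n + 1) → ℤ) : 0 ≤ Lxi ξ x :=
  (abs_nonneg _).trans (kc_L_ge ξ x 0)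

/-- Bound for the `2 × 2` minors of a pair of points. -/
lemma kc_minor {n : ℕ} (ξ : Fin (n + 1) → ℝ) (h0 : ξ 0 ≠ 0) :
    ∃ B : ℝ, 0 < B ∧ ∀ y z : Fin (n + 1) → ℤ, inorm y ≤ inorm z → Lxi ξ z ≤ Lxi ξ y →
      ∀ j k, |(y k : ℝ) * z j - z k * y j| ≤ B * (Lxi ξ y * inorm z) := by
  let M : ℝ := ∑ k, |ξ k|
  have hM : ∀ k, |ξ k| ≤ M := fun k =>
    Finset.single_le_sum (f := fun k => |ξ k|) (fun _ _ => abs_nonneg _) (Finset.mem_univ k)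
  have hξ0 : 0 < |ξ 0| := abs_pos.2 h0
  have hM0 : 0 < M := hξ0.trans_le (hM 0)
  refine ⟨4 * M / |ξ 0| ^ 2, by positivity, ?_⟩
  intro y z hn hL j k
  have hid : ξ 0 ^ 2 * ((y k : ℝ) * z j - z k * y j) =
      ξ 0 * ((ξ 0 * y k - ξ k * y 0) * z j) - ξ 0 * ((ξ 0 * y j - ξ j * y 0) * z k)
      + (ξ k * ((ξ 0 * z j - ξ j * z 0) * y 0) - ξ j * ((ξ 0 * z k - ξ k * z 0) * y 0)) := by ring
  have hLy := kc_L_nonneg ξ y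
  have hLz := kc_L_nonneg ξ z
  have hy := kc_inorm_nonneg y
  have hz := kc_inorm_nonneg z
  have key : ∀ (k l j : Fin (n + 1)), |ξ k * ((ξ 0 * y l - ξ l * y 0) * z j)| ≤
      M * (Lxi ξ y * inorm z) := by
    intro k l j
    rw [abs_mul, abs_mul]
    exact mul_le_mul (hM k) (mul_le_mul (kc_L_ge ξ y l) (kc_coord_le z j) (abs_nonneg _) hLy)
      (by positivity) hM0.le
  have key2 : ∀ (k l : Fin (n + 1)), |ξ k * ((ξ 0 * z l - ξ l * z 0) * y 0)| ≤
      M * (Lxi ξ y * inorm z) := by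
    intro k l
    rw [abs_mul, abs_mul]
    exact mul_le_mul (hM k) (mul_le_mul ((kc_L_ge ξ z l).trans hL) ((kc_coord_le y 0).trans hn)
      (abs_nonneg _) hLy) (by positivity) hM0.le
  have h : |ξ 0| ^ 2 * |(y k : ℝ) * z j - z k * y j| ≤ 4 * (M * (Lxi ξ y * inorm z)) := by
    rw [← abs_pow, ← abs_mul, hid]
    have a1 := abs_le.1 (key 0 k j)
    have a2 := abs_le.1 (key 0 j k)
    have a3 := abs_le.1 (key2 k j)
    have a4 := abs_le.1 (key2 j k)
    rw [abs_le]
    constructor <;> linarith [a1.1, a1.2, a2.1, a2.2, a3.1, a3.2, a4.1, a4.2]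
  have hp : 0 < |ξ 0| ^ 2 := by positivity
  calc _ ≤ 4 * (M * (Lxi ξ y * inorm z)) / |ξ 0| ^ 2 := by
        rw [le_div_iff₀ hp]; linarith
    _ = _ := by ring

lemma kc_inner_bound {n : ℕ} (g : Fin (n + 1) → ℝ) (hg : ∑ k, g k ^ 2 = 1)
    (y z : Fin (n + 1) → ℤ) (hy : y ≠ 0) (hgy : ∑ k, g k * (y k : ℝ) = 0) (D : ℝ)
    (hD : ∀ j k, |(y k : ℝ) * z j - z k * y j| ≤ D) :
    |∑ k, g k * (z k : ℝ)| * inorm y ≤ ((n : ℝ) + 1) ^ 2 * D := by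
  have hp := kc_inorm_pos y hy
  have hg1 : ∀ k, |g k| ≤ 1 := by
    intro k
    rw [← sq_le_one_iff_abs_le_one, ← hg]
    exact Finset.single_le_sum (f := fun k => g k ^ 2) (fun _ _ => sq_nonneg _) (Finset.mem_univ k)
  have hid : (∑ k, g k * (z k : ℝ)) * inorm y ^ 2 =
      ∑ j, ∑ k, g j * (y k * ((y k : ℝ) * z j - z k * y j)) := by
    have e : ∀ j, ∑ k, g j * (y k * ((y k : ℝ) * z j - z k * y j)) =
        g j * z j * inorm y ^ 2 - (g j * y j) * ∑ k, (y k : ℝ) * z k := by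
      intro j
      rw [kc_inorm_sq, Finset.mul_sum, Finset.mul_sum, ← Finset.sum_sub_distrib]
      exact Finset.sum_congr rfl fun k _ => by ring
    rw [Finset.sum_congr rfl fun j _ => e j, Finset.sum_sub_distrib, ← Finset.sum_mul,
      ← Finset.sum_mul, hgy]
    ring
  have hb : |∑ k, g k * (z k : ℝ)| * inorm y ^ 2 ≤ ((n : ℝ) + 1) ^ 2 * (inorm y * D) := by
    rw [← abs_of_pos (pow_pos hp 2), ← abs_mul, hid]
    calc _ ≤ ∑ j : Fin (n + 1), ∑ k : Fin (n + 1), inorm y * D := by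
          refine (Finset.abs_sum_le_sum_abs _ _).trans (Finset.sum_le_sum fun j _ => ?_)
          refine (Finset.abs_sum_le_sum_abs _ _).trans (Finset.sum_le_sum fun k _ => ?_)
          rw [abs_mul, abs_mul]
          calc _ ≤ 1 * (|(y k : ℝ)| * |(y k : ℝ) * z j - z k * y j|) :=
                mul_le_mul_of_nonneg_right (hg1 j) (by positivity)
            _ ≤ _ := by
                rw [one_mul]
                exact mul_le_mul (kc_coord_le y k) (hD j k) (abs_nonneg _) hp.le
      _ = _ := by simp; ring
  nlinarith [hb]

lemma kc_norm_ge {n : ℕ} (x : ℕ → Fin (n + 1) → ℤ) (hm : StrictMono fun i => inorm (x i)) (j : ℕ) :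
    (j : ℝ) ≤ inorm (x j) ^ 2 := by
  have e : ∀ j, inorm (x j) ^ 2 = ((∑ k, (x j k) ^ 2 : ℤ) : ℝ) := by
    intro j; rw [kc_inorm_sq]; push_cast; rfl
  induction j with
  | zero => simpa using sq_nonneg _
  | succ j ih =>
    have h : inorm (x j) ^ 2 < inorm (x (j + 1)) ^ 2 :=
      pow_lt_pow_left₀ (hm (Nat.lt_succ_self j)) (kc_inorm_nonneg _) two_ne_zero
    rw [e] at ih h ⊢
    rw [e] at h
    have h1 : (j : ℤ) ≤ ∑ k, (x j k) ^ 2 := by exact_mod_cast ih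
    have h2 : ∑ k, (x j k) ^ 2 < ∑ k, (x (j + 1) k) ^ 2 := by exact_mod_cast h
    have h3 : ((j + 1 : ℕ) : ℤ) ≤ ∑ k, (x (j + 1) k) ^ 2 := by push_cast; omega
    exact_mod_cast h3

lemma kc_L_small {n : ℕ} (ξ : Fin (n + 1) → ℝ) (S : Set (Fin (n + 1) → ℤ))
    (x : ℕ → Fin (n + 1) → ℤ) (hS : Filter.Tendsto (calL ξ S) Filter.atTop (nhds 0))
    (hx : IsMinimalSeq ξ S x) (ε : ℝ) (hε : 0 < ε) : ∃ J, ∀ j, J ≤ j → Lxi ξ (x j) < ε := by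
  have h := hS.eventually (gt_mem_nhds (show (0 : ENNReal) < ENNReal.ofReal ε by simpa using hε))
  obtain ⟨X, hX⟩ := h.exists
  obtain ⟨l, ⟨z, hzS, hz0, -, rfl⟩, hlt⟩ := sInf_lt_iff.1 hX
  have hz : Lxi ξ z < ε := (ENNReal.ofReal_lt_ofReal_iff hε).1 hlt
  obtain ⟨J, hJ⟩ := exists_nat_gt (inorm z ^ 2)
  refine ⟨J, fun j hj => ?_⟩
  have h1 : inorm z < inorm (x (j + 1)) := by
    refine lt_of_pow_lt_pow_left₀ 2 (kc_inorm_nonneg _) ?_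
    have := kc_norm_ge x hx.2.1 (j + 1)
    have h3 : (J : ℝ) ≤ ((j + 1 : ℕ) : ℝ) := by exact_mod_cast (by omega)
    linarith
  exact (hx.2.2.2 j z hzS hz0 h1).trans_lt hz

/-- Some initial span starting at `i₀` is the full space. -/
lemma kc_full {n : ℕ} (ξ : Fin (n + 1) → ℝ) (hξ : LinearIndependent ℚ ξ)
    (S : Set (Fin (n + 1) → ℤ))
    (x : ℕ → Fin (n + 1) → ℤ) (hS : Filter.Tendsto (calL ξ S) Filter.atTop (nhds 0))
    (hx : IsMinimalSeq ξ S x) (i₀ : ℕ) : ∃ N, ∀ m, N ≤ m → Vspan x i₀ m = ⊤ := by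
  have hmono : Monotone (Vspan x i₀) := fun a b hab =>
    Submodule.span_mono (Set.image_mono (Set.Icc_subset_Icc_right hab))
  obtain ⟨N, hN⟩ := (monotone_stabilizes_iff_noetherian (R := ℝ) (M := Fin (n + 1) → ℝ)).2
    inferInstance ⟨Vspan x i₀, hmono⟩
  have hN' : ∀ m, N ≤ m → Vspan x i₀ N = Vspan x i₀ m := hN
  suffices h : Vspan x i₀ N = ⊤ from ⟨N, fun m hm => by rw [← hN' m hm, h]⟩
  have hmem : ∀ j, i₀ ≤ j → rvec (x j) ∈ Vspan x i₀ N := by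
    intro j hj
    rcases le_total N j with h | h
    · rw [hN' j h]; exact Submodule.subset_span ⟨j, ⟨hj, le_rfl⟩, rfl⟩
    · exact Submodule.subset_span ⟨j, ⟨hj, h⟩, rfl⟩
  let W : Submodule ℚ (Fin (n + 1) → ℚ) :=
    Submodule.span ℚ ((fun j k => (x j k : ℚ)) '' Set.Ici i₀)
  by_cases hW : W = ⊤
  · let φ : (Fin (n + 1) → ℚ) →ₗ[ℚ] (Fin (n + 1) → ℝ) :=
      { toFun := fun v k => (v k : ℝ)
        map_add' := fun u v => by ext k; simp
        map_smul' := fun c v => by ext k; simp [Rat.smul_def] }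
    have hle : W ≤ ((Vspan x i₀ N).restrictScalars ℚ).comap φ := by
      refine Submodule.span_le.2 ?_
      rintro _ ⟨j, hj, rfl⟩
      have : φ (fun k => (x j k : ℚ)) = rvec (x j) := by
        ext k; simp [φ, rvec]
      change φ (fun k => (x j k : ℚ)) ∈ Vspan x i₀ N
      rw [this]; exact hmem j hj
    rw [eq_top_iff]
    intro v _
    have hv : v = ∑ k, v k • (Pi.single k (1 : ℝ) : Fin (n + 1) → ℝ) := by
      ext j; simp [Finset.sum_apply, Pi.single_apply]
    rw [hv]
    refine Submodule.sum_mem _ fun k _ => Submodule.smul_mem _ _ ?_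
    have h1 : (Pi.single k (1 : ℚ) : Fin (n + 1) → ℚ) ∈ W := by rw [hW]; trivial
    have h2 : φ (Pi.single k (1 : ℚ)) ∈ Vspan x i₀ N := hle h1
    have h3 : φ (Pi.single k (1 : ℚ)) = Pi.single k (1 : ℝ) := by
      ext j
      by_cases h : j = k
      · subst h; simp [φ]
      · simp [φ, h]
    rwa [h3] at h2
  · exfalso
    obtain ⟨f, hf0, hf⟩ := W.exists_le_ker_of_lt_top (lt_top_iff_ne_top.2 hW)
    let a : Fin (n + 1) → ℚ := fun k => f (Pi.single k 1)
    have hfa : ∀ v, f v = ∑ k, a k * v k := by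
      intro v
      have hv : v = ∑ k, v k • (Pi.single k (1 : ℚ) : Fin (n + 1) → ℚ) := by
        ext j; simp [Finset.sum_apply, Pi.single_apply]
      conv_lhs => rw [hv]
      rw [map_sum]
      exact Finset.sum_congr rfl fun k _ => by simp [a, mul_comm]
    have ha0 : ∃ k, a k ≠ 0 := by
      by_contra! h
      exact hf0 (LinearMap.ext fun v => by simp [hfa, h])
    have hs : ∑ k, (a k : ℝ) * ξ k ≠ 0 := by
      intro h
      obtain ⟨k, hk⟩ := ha0
      refine hk (Fintype.linearIndependent_iff.1 hξ a ?_ k)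
      simpa [Rat.smul_def] using h
    have hax : ∀ j, i₀ ≤ j → ∑ k, (a k : ℝ) * x j k = 0 := by
      intro j hj
      have h1 : (fun k => (x j k : ℚ)) ∈ W := Submodule.subset_span ⟨j, hj, rfl⟩
      have h2 : f (fun k => (x j k : ℚ)) = 0 := hf h1
      rw [hfa] at h2
      exact_mod_cast h2
    have h0 : ξ 0 ≠ 0 := hξ.ne_zero 0
    set s := ∑ k, (a k : ℝ) * ξ k
    set A := ∑ k, |(a k : ℝ)|
    have hA : 0 ≤ A := Finset.sum_nonneg fun _ _ => abs_nonneg _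
    have hsp : 0 < |s| := abs_pos.2 hs
    have h0p : 0 < |ξ 0| := abs_pos.2 h0
    obtain ⟨J, hJ⟩ := kc_L_small ξ S x hS hx (min (|s| / (A + 1)) |ξ 0|) (by positivity)
    let j := max J i₀
    have hLj := hJ j (le_max_left _ _)
    have hb : |s| * |(x j 0 : ℝ)| ≤ A * Lxi ξ (x j) := by
      have e : s * x j 0 = - ∑ k, (a k : ℝ) * (ξ 0 * x j k - ξ k * x j 0) := by
        have : ∑ k, (a k : ℝ) * (ξ 0 * x j k - ξ k * x j 0) =
            ξ 0 * ∑ k, (a k : ℝ) * x j k - s * x j 0 := by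
          rw [Finset.mul_sum, Finset.sum_mul, ← Finset.sum_sub_distrib]
          exact Finset.sum_congr rfl fun k _ => by ring
        rw [this, hax j (le_max_right _ _)]; ring
      rw [← abs_mul, e, abs_neg, Finset.sum_mul]
      refine (Finset.abs_sum_le_sum_abs _ _).trans (Finset.sum_le_sum fun k _ => ?_)
      rw [abs_mul]
      exact mul_le_mul_of_nonneg_left (kc_L_ge ξ _ k) (abs_nonneg _)
    have hx0 : x j 0 = 0 := by
      by_contra h
      have h1 : (1 : ℝ) ≤ |(x j 0 : ℝ)| := by exact_mod_cast Int.one_le_abs h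
      have h2 : Lxi ξ (x j) * (A + 1) < |s| := by
        rw [← lt_div_iff₀ (by positivity)]
        exact hLj.trans_le (min_le_left _ _)
      have h3 := kc_L_nonneg ξ (x j)
      nlinarith
    obtain ⟨k, hk⟩ := Function.ne_iff.1 (hx.1 j).2
    have h1 : (1 : ℝ) ≤ |(x j k : ℝ)| := by exact_mod_cast Int.one_le_abs hk
    have h2 := kc_L_ge ξ (x j) k
    rw [hx0] at h2
    simp only [Int.cast_zero, mul_zero, sub_zero, abs_mul] at h2
    have h3 := hLj.trans_le (min_le_right _ _)
    nlinarith

lemma kc_next {n : ℕ} (ξ : Fin (n + 1) → ℝ) (S : Set (Fin (n + 1) → ℤ))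
    (x : ℕ → Fin (n + 1) → ℤ) (hx : IsMinimalSeq ξ S x) (i : ℕ) :
    rvec (x (i + 1)) ∉ Submodule.span ℝ {rvec (x i)} := by
  intro h
  obtain ⟨l, hl⟩ := Submodule.mem_span_singleton.1 h
  have hk : ∀ k, (x (i + 1) k : ℝ) = l * x i k := fun k => (congrFun hl k).symm
  have h1 : inorm (x i) < inorm (x (i + 1)) := hx.2.1 (Nat.lt_succ_self i)
  have h2 : Lxi ξ (x (i + 1)) < Lxi ξ (x i) := hx.2.2.1 (Nat.lt_succ_self i)
  have hpos := kc_inorm_pos _ (hx.1 i).2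
  have h3 : inorm (x (i + 1)) ^ 2 = l ^ 2 * inorm (x i) ^ 2 := by
    rw [kc_inorm_sq, kc_inorm_sq, Finset.mul_sum]
    exact Finset.sum_congr rfl fun k _ => by rw [hk]; ring
  have h4 : 1 ≤ |l| := by
    by_contra! h
    have : l ^ 2 < 1 := (sq_lt_one_iff_abs_lt_one l).2 h
    nlinarith [pow_lt_pow_left₀ h1 hpos.le two_ne_zero, sq_nonneg (inorm (x i))]
  have h5 : Lxi ξ (x i) ≤ Lxi ξ (x (i + 1)) := by
    refine Finset.sup'_le _ _ fun k _ => le_trans ?_ (kc_L_ge ξ _ k)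
    have : ξ 0 * (x (i + 1) k : ℝ) - ξ k * x (i + 1) 0 = l * (ξ 0 * x i k - ξ k * x i 0) := by
      rw [hk, hk]; ring
    rw [this, abs_mul]
    nlinarith [abs_nonneg (ξ 0 * (x i k : ℝ) - ξ k * x i 0)]
  linarith

lemma kc_mono {n : ℕ} (x : ℕ → Fin (n + 1) → ℤ) (i₀ : ℕ) : Monotone (Vspan x i₀) := fun _ _ hab =>
  Submodule.span_mono (Set.image_mono (Set.Icc_subset_Icc_right hab))

lemma kc_idx {n : ℕ} (ξ : Fin (n + 1) → ℝ) (hξ : LinearIndependent ℚ ξ)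
    (S : Set (Fin (n + 1) → ℤ)) (hn : 0 < n)
    (x : ℕ → Fin (n + 1) → ℤ) (hS : Filter.Tendsto (calL ξ S) Filter.atTop (nhds 0))
    (hx : IsMinimalSeq ξ S x) (i₀ : ℕ) : ∃ idx : ℕ → ℕ, idx 0 = i₀ ∧
      (∀ t, t ≤ n → i₀ ≤ idx t ∧ Module.finrank ℝ (Vspan x i₀ (idx t)) = t + 1) ∧
      (∀ t, t < n → ∀ j, Module.finrank ℝ (Vspan x i₀ j) ≤ t + 1 → j ≤ idx t) := by
  obtain ⟨N₀, hN₀⟩ := kc_full ξ hξ S x hS hx i₀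
  let N := max N₀ i₀
  let r : ℕ → ℕ := fun j => Module.finrank ℝ (Vspan x i₀ j)
  have hrN : ∀ j, N ≤ j → r j = n + 1 := by
    intro j hj
    simp only [r]
    rw [hN₀ j ((le_max_left _ _).trans hj)]
    simp
  have hV0 : Vspan x i₀ i₀ = Submodule.span ℝ {rvec (x i₀)} := by simp [Vspan]
  have hr0 : r i₀ = 1 := by
    simp only [r]
    rw [hV0]
    refine finrank_span_singleton ?_
    intro h
    exact (hx.1 i₀).2 (funext fun k => Int.cast_injective (α := ℝ) (by
      simpa [rvec] using congrFun h k))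
  have hrmono : Monotone r := fun a b hab => Submodule.finrank_mono (kc_mono x i₀ hab)
  have hr1 : 2 ≤ r (i₀ + 1) := by
    have : Vspan x i₀ i₀ < Vspan x i₀ (i₀ + 1) := by
      refine lt_of_le_of_ne (kc_mono x i₀ (Nat.le_succ _)) fun h => ?_
      apply kc_next ξ S x hx i₀
      rw [← hV0, h]
      exact Submodule.subset_span ⟨i₀ + 1, ⟨by omega, le_rfl⟩, rfl⟩
    have := Submodule.finrank_lt_finrank_of_lt this
    simp only [r] at hr0 ⊢
    omega
  have hstep : ∀ j, r (j + 1) ≤ r j + 1 := by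
    intro j
    have hle : Vspan x i₀ (j + 1) ≤ Vspan x i₀ j ⊔ Submodule.span ℝ {rvec (x (j + 1))} := by
      refine Submodule.span_le.2 ?_
      rintro _ ⟨m, ⟨h1, h2⟩, rfl⟩
      rcases Nat.lt_or_ge m (j + 1) with h | h
      · exact Submodule.mem_sup_left (Submodule.subset_span ⟨m, ⟨h1, by omega⟩, rfl⟩)
      · have : m = j + 1 := by omega
        subst this
        exact Submodule.mem_sup_right (Submodule.subset_span rfl)
    have h1 := Submodule.finrank_mono hle
    have h2 := Submodule.finrank_add_le_finrank_add_finrank (Vspan x i₀ j)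
      (Submodule.span ℝ {rvec (x (j + 1))})
    have h3 := finrank_span_le_card (R := ℝ) ({rvec (x (j + 1))} : Set (Fin (n + 1) → ℝ))
    simp at h3
    simp only [r]
    omega
  let idx : ℕ → ℕ := fun t => Nat.findGreatest (fun j => r j ≤ t + 1) N
  have hspec : ∀ t, r (idx t) ≤ t + 1 := fun t =>
    Nat.findGreatest_spec (P := fun j => r j ≤ t + 1) (le_max_right N₀ i₀) (by simp [hr0])
  have hge : ∀ t, i₀ ≤ idx t := fun t =>
    Nat.le_findGreatest (P := fun j => r j ≤ t + 1) (le_max_right N₀ i₀) (by simp [hr0])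
  have hmax : ∀ t, t < n → ∀ j, r j ≤ t + 1 → j ≤ idx t := by
    intro t ht j hj
    refine Nat.le_findGreatest ?_ hj
    by_contra! h
    have := hrN j h.le
    omega
  refine ⟨idx, ?_, ?_, hmax⟩
  · refine le_antisymm ?_ (hge 0)
    by_contra! h
    have h1 : r (i₀ + 1) ≤ r (idx 0) := hrmono h
    have := hspec 0
    omega
  · intro t ht
    refine ⟨hge t, ?_⟩
    rcases Nat.lt_or_ge t n with h | h
    · have h1 : ¬ r (idx t + 1) ≤ t + 1 := fun h1 => by have := hmax t h _ h1; omega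
      have h2 := hstep (idx t)
      have h3 := hspec t
      change r (idx t) = t + 1
      omega
    · have : t = n := by omega
      subst this
      have h1 : N ≤ idx t := Nat.le_findGreatest (P := fun j => r j ≤ t + 1) le_rfl
        (by rw [hrN N le_rfl])
      exact hrN _ h1

/-- The frame `x_{i₀}, x_{i_0+1}, x_{i_1+1}, …`. -/
def kcF {n : ℕ} (x : ℕ → Fin (n + 1) → ℤ) (idx : ℕ → ℕ) : ℕ → Fin (n + 1) → ℤ
  | 0 => x (idx 0)
  | t + 1 => x (idx t + 1)

lemma kc_frame {n : ℕ} (x : ℕ → Fin (n + 1) → ℤ) (i₀ : ℕ) (idx : ℕ → ℕ) (h0 : idx 0 = i₀)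
    (h1 : ∀ t, t ≤ n → i₀ ≤ idx t ∧ Module.finrank ℝ (Vspan x i₀ (idx t)) = t + 1)
    (h2 : ∀ t, t < n → ∀ j, Module.finrank ℝ (Vspan x i₀ j) ≤ t + 1 → j ≤ idx t) (t : ℕ)
    (ht : t ≤ n) :
    Submodule.span ℝ ((fun s => rvec (kcF x idx s)) '' Set.Iic t) = Vspan x i₀ (idx t) := by
  induction t with
  | zero =>
    have hI : Set.Iic 0 = ({0} : Set ℕ) := by ext s; simp
    rw [hI, Set.image_singleton, h0]
    simp only [Vspan, Set.Icc_self, Set.image_singleton]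
    change Submodule.span ℝ {rvec (x (idx 0))} = _
    rw [h0]
  | succ t ih =>
    have ih := ih (by omega)
    have hlt : idx t < idx (t + 1) := by
      by_contra! h
      have := Submodule.finrank_mono (kc_mono x i₀ h)
      rw [(h1 t (by omega)).2, (h1 _ ht).2] at this
      omega
    refine Submodule.eq_of_le_of_finrank_le ?_ ?_
    · refine Submodule.span_le.2 ?_
      rintro _ ⟨s, hs, rfl⟩
      rcases Nat.lt_or_ge s (t + 1) with h | h
      · refine kc_mono x i₀ hlt.le ?_
        rw [← ih]
        exact Submodule.subset_span ⟨s, Nat.lt_succ_iff.1 h, rfl⟩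
      · have : s = t + 1 := le_antisymm hs h
        subst this
        exact Submodule.subset_span ⟨idx t + 1, ⟨by have := (h1 t (by omega)).1; omega, hlt⟩, rfl⟩
    · rw [(h1 _ ht).2]
      have hlt2 : Submodule.span ℝ ((fun s => rvec (kcF x idx s)) '' Set.Iic t) <
          Submodule.span ℝ ((fun s => rvec (kcF x idx s)) '' Set.Iic (t + 1)) := by
        refine lt_of_le_of_ne (Submodule.span_mono (Set.image_mono
          (Set.Iic_subset_Iic.2 (Nat.le_succ t)))) fun h => ?_
        have hm : rvec (x (idx t + 1)) ∈ Vspan x i₀ (idx t) := by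
          rw [← ih, h]
          exact Submodule.subset_span ⟨t + 1, le_refl (t + 1), rfl⟩
        have hle : Vspan x i₀ (idx t + 1) ≤ Vspan x i₀ (idx t) := by
          refine Submodule.span_le.2 ?_
          rintro _ ⟨m, ⟨h3, h4⟩, rfl⟩
          rcases Nat.lt_or_ge m (idx t + 1) with h | h
          · exact Submodule.subset_span ⟨m, ⟨h3, by omega⟩, rfl⟩
          · have : m = idx t + 1 := by omega
            subst this
            exact hm
        have h5 := Submodule.finrank_mono hle
        rw [(h1 t (by omega)).2] at h5
        have := h2 t (by omega) _ h5
        omega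
      have := Submodule.finrank_lt_finrank_of_lt hlt2
      rw [ih, (h1 t (by omega)).2] at this
      omega

lemma kc_det {n : ℕ} (F : ℕ → Fin (n + 1) → ℤ)
    (hF : Submodule.span ℝ ((fun s => rvec (F s)) '' Set.Iic n) = ⊤) :
    1 ≤ |(Matrix.of (fun i : Fin (n + 1) => rvec (F i))).det| := by
  have hli : LinearIndependent ℝ (fun i : Fin (n + 1) => rvec (F i)) := by
    refine linearIndependent_of_top_le_span_of_card_eq_finrank ?_ (by simp)
    rw [← hF]
    refine Submodule.span_mono ?_
    rintro _ ⟨s, hs, rfl⟩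
    exact ⟨⟨s, Nat.lt_succ_iff.2 hs⟩, rfl⟩
  have hne : (Matrix.of (fun i : Fin (n + 1) => rvec (F i))).det ≠ 0 := by
    have : LinearIndependent ℝ (Matrix.of (fun i : Fin (n + 1) => rvec (F i))).row := hli
    rw [Matrix.linearIndependent_rows_iff_isUnit, Matrix.isUnit_iff_isUnit_det] at this
    exact this.ne_zero
  have hc : (Matrix.of (fun i : Fin (n + 1) => rvec (F i))).det =
      (((Matrix.of (fun i : Fin (n + 1) => F i)).det : ℤ) : ℝ) := by
    change _ = Int.castRingHom ℝ _
    rw [RingHom.map_det]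
    congr 1
  rw [hc] at hne ⊢
  exact_mod_cast Int.one_le_abs (by exact_mod_cast hne)


/-- Theorem 3.1 (key construction): for every `i₀` the largest indices
`i₀ < i₁ < ⋯ < i_{n−1}` with `dim span(x_{i₀}, …, x_{i_t}) = t+1` exist, and
`X_{i_1} ⋯ X_{i_{n−1}} ≤ c · L_{i_0} X_{i_0+1} ⋯ L_{i_{n−1}} X_{i_{n−1}+1}`
for a constant `c > 0` depending only on `ξ`. -/
theorem key_construction (n : ℕ) (hn : 2 ≤ n) (ξ : Fin (n + 1) → ℝ)
    (hξ : LinearIndependent ℚ ξ) :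
    ∃ c : ℝ, 0 < c ∧
      ∀ (S : Set (Fin (n + 1) → ℤ)) (x : ℕ → Fin (n + 1) → ℤ),
        Filter.Tendsto (calL ξ S) Filter.atTop (nhds 0) →
        IsMinimalSeq ξ S x →
        ∀ i₀ : ℕ, ∃ idx : ℕ → ℕ, idx 0 = i₀ ∧
          (∀ t : ℕ, 1 ≤ t → t ≤ n - 1 →
            i₀ ≤ idx t ∧
            Module.finrank ℝ ↥(Vspan x i₀ (idx t)) = t + 1 ∧
            ∀ j : ℕ, i₀ ≤ j → Module.finrank ℝ ↥(Vspan x i₀ j) = t + 1 → j ≤ idx t) ∧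
          (∀ t : ℕ, t + 1 ≤ n - 1 → idx t < idx (t + 1)) ∧
          ∏ t ∈ Finset.Icc 1 (n - 1), inorm (x (idx t)) ≤
            c * ∏ t ∈ Finset.range n, (Lxi ξ (x (idx t)) * inorm (x (idx t + 1))) := by
  have h0 : ξ 0 ≠ 0 := hξ.ne_zero 0
  obtain ⟨B, hB, hmin⟩ := kc_minor ξ h0
  let K : ℝ := ((n : ℝ) + 1) ^ 2 * B
  have hK : 0 < K := by positivity
  refine ⟨K ^ n, by positivity, ?_⟩
  intro S x hS hx i₀
  obtain ⟨idx, hi0, hi1, hi2⟩ := kc_idx ξ hξ S (by omega) x hS hx i₀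
  refine ⟨idx, hi0, ?_, ?_, ?_⟩
  · intro t ht1 ht2
    exact ⟨(hi1 t (by omega)).1, (hi1 t (by omega)).2,
      fun j _ hj => hi2 t (by omega) j hj.le⟩
  · intro t ht
    by_contra! h
    have := Submodule.finrank_mono (kc_mono x i₀ h)
    rw [(hi1 t (by omega)).2, (hi1 _ (by omega)).2] at this
    omega
  have hframe := kc_frame x i₀ idx hi0 hi1 hi2
  have htop : Submodule.span ℝ ((fun s => rvec (kcF x idx s)) '' Set.Iic n) = ⊤ := by
    rw [hframe n le_rfl]
    refine Submodule.eq_top_of_finrank_eq ?_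
    rw [(hi1 n le_rfl).2]; simp
  have hdet := kc_det (kcF x idx) htop
  obtain ⟨g, hg1, hg2, hg3⟩ := kc_gs (fun i : Fin (n + 1) => rvec (kcF x idx i))
  rw [hg3, Finset.abs_prod, Fin.prod_univ_succ] at hdet
  have hpos : ∀ t, 0 < inorm (x (idx t)) := fun t => kc_inorm_pos _ (hx.1 _).2
  have hfirst : |∑ k, g 0 k * rvec (kcF x idx (0 : Fin (n + 1))) k| ≤ inorm (x (idx 0)) := by
    refine abs_le_of_sq_le_sq ?_ (hpos 0).le
    have := Finset.sum_mul_sq_le_sq_mul_sq Finset.univ (g 0)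
      (rvec (kcF x idx (0 : Fin (n + 1))))
    rw [hg1 0, one_mul] at this
    rw [kc_inorm_sq]
    exact this
  have hsucc : ∀ t : Fin n, |∑ k, g t.succ k * rvec (kcF x idx t.succ) k| *
      inorm (x (idx t)) ≤ K * (Lxi ξ (x (idx t)) * inorm (x (idx t + 1))) := by
    intro t
    have hort : ∑ k, g t.succ k * (x (idx t) k : ℝ) = 0 := by
      let φ : (Fin (n + 1) → ℝ) →ₗ[ℝ] ℝ :=
        { toFun := fun v => ∑ k, g t.succ k * v k
          map_add' := fun u v => by simp [mul_add, Finset.sum_add_distrib]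
          map_smul' := fun c v => by
            simp only [Pi.smul_apply, smul_eq_mul, RingHom.id_apply, Finset.mul_sum]
            exact Finset.sum_congr rfl fun k _ => by ring }
      have hle : Submodule.span ℝ ((fun s => rvec (kcF x idx s)) '' Set.Iic (t : ℕ)) ≤
          LinearMap.ker φ := by
        refine Submodule.span_le.2 ?_
        rintro _ ⟨s, hs, rfl⟩
        have hs' : s ≤ (t : ℕ) := hs
        have htn := t.2
        exact hg2 t.succ ⟨s, by omega⟩ (by rw [Fin.lt_def]; simp; omega)
      rw [hframe t t.2.le] at hle
      have hm : rvec (x (idx t)) ∈ Vspan x i₀ (idx t) :=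
        Submodule.subset_span ⟨idx t, ⟨(hi1 t t.2.le).1, le_rfl⟩, rfl⟩
      exact hle hm
    have hD := hmin (x (idx t)) (x (idx t + 1)) (hx.2.1 (Nat.lt_succ_self _)).le
      (hx.2.2.1 (Nat.lt_succ_self _)).le
    have := kc_inner_bound (g t.succ) (hg1 _) (x (idx t)) (x (idx t + 1)) (hx.1 _).2 hort _ hD
    calc _ ≤ _ := this
      _ = _ := by simp only [K]; ring
  have hprod := Finset.prod_le_prod (s := Finset.univ) (fun (t : Fin n) _ =>
    mul_nonneg (abs_nonneg _) (hpos t).le) (fun t _ => hsucc t)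
  rw [Finset.prod_mul_distrib, Finset.prod_mul_distrib, Finset.prod_const, Finset.card_univ,
    Fintype.card_fin, Finset.prod_range (fun t => inorm (x (idx t))) |>.symm,
    Finset.prod_range (fun t => Lxi ξ (x (idx t)) * inorm (x (idx t + 1))) |>.symm] at hprod
  have hsplit : ∏ t ∈ Finset.range n, inorm (x (idx t)) =
      inorm (x (idx 0)) * ∏ t ∈ Finset.Icc 1 (n - 1), inorm (x (idx t)) := by
    obtain ⟨m, rfl⟩ : ∃ m, n = m + 1 := ⟨n - 1, by omega⟩
    rw [Finset.prod_range_succ', mul_comm, Nat.add_sub_cancel]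
    congr 1
    rw [Finset.range_eq_Ico, Finset.prod_Ico_add' (fun t => inorm (x (idx t))) 0 m 1]
    rfl
  rw [hsplit] at hprod
  refine le_trans ?_ hprod
  have hQ : 0 ≤ ∏ t ∈ Finset.Icc 1 (n - 1), inorm (x (idx t)) :=
    Finset.prod_nonneg fun t _ => (hpos t).le
  have hP : 0 ≤ ∏ t : Fin n, |∑ k, g t.succ k * rvec (kcF x idx t.succ) k| :=
    Finset.prod_nonneg fun t _ => abs_nonneg _
  have h1 : 1 ≤ inorm (x (idx 0)) * ∏ t : Fin n, |∑ k, g t.succ k * rvec (kcF x idx t.succ) k| :=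
    hdet.trans (mul_le_mul_of_nonneg_right hfirst hP)
  calc _ = 1 * ∏ t ∈ Finset.Icc 1 (n - 1), inorm (x (idx t)) := (one_mul _).symm
    _ ≤ _ := mul_le_mul_of_nonneg_right h1 hQ
    _ = _ := by ring
end

section
/- Let n ≥ 2 be an integer, let θ be a real algebraic number of degree n, and let ξ ∈ ℝ ∖ ℚ(θ). Then the point ξ⃗ = (1, θ, θ², …, θ^{n−1}, ξ) ∈ ℝ^{n+1} satisfies λ̂(ξ⃗) ≤ λ_n, where λ_n is the unique positive real solution of x + (n−1)x² + ⋯ + (n−1)^{n−1}xⁿ = 1. -/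
open Filter

/-- The uniform exponent `λ̂(ξ; S) = sup { λ ≥ 0 : limsup_{X→∞} X^λ 𝓛_ξ(X;S) < ∞ }`. -/
noncomputable def lamHat {n : ℕ} (ξ : Fin (n + 1) → ℝ) (S : Set (Fin (n + 1) → ℤ)) : ENNReal :=
  sSup { l | ∃ t : ℝ, 0 ≤ t ∧ l = ENNReal.ofReal t ∧
    Filter.limsup (fun X : ℝ => ENNReal.ofReal (X ^ t) * calL ξ S X) Filter.atTop < ⊤ }

/-- The point `ξ⃗ = (1, θ, θ², …, θ^{n−1}, ξ) ∈ ℝ^{n+1}`. -/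
noncomputable def xivec (n : ℕ) (θ ξ : ℝ) : Fin (n + 1) → ℝ :=
  fun k => if (k : ℕ) < n then θ ^ (k : ℕ) else ξ


lemma aux_det_bound {N : ℕ} (M : Matrix (Fin N) (Fin N) ℝ) (b : Fin N → ℝ)
    (hb : ∀ i j, |M i j| ≤ b i) : |M.det| ≤ (N.factorial : ℝ) * ∏ i, b i := by
  rw [Matrix.det_apply]
  refine (Finset.abs_sum_le_sum_abs _ _).trans ?_
  have h : ∀ σ : Equiv.Perm (Fin N), |Equiv.Perm.sign σ • ∏ i, M (σ i) i| ≤ ∏ i, b i := by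
    intro σ
    have h1 : |Equiv.Perm.sign σ • ∏ i, M (σ i) i| = |∏ i, M (σ i) i| := by
      rcases Int.units_eq_one_or (Equiv.Perm.sign σ) with h | h <;> simp [h]
    rw [h1, Finset.abs_prod, ← Equiv.prod_comp σ b]
    exact Finset.prod_le_prod (fun _ _ => abs_nonneg _) (fun i _ => hb _ _)
  refine (Finset.sum_le_sum (fun σ _ => h σ)).trans ?_
  simp [Finset.card_univ, Fintype.card_perm]

lemma aux_le_Lxi {n : ℕ} (v : Fin (n + 1) → ℝ) (hv : v 0 = 1) (x : Fin (n + 1) → ℤ)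
    (k : Fin (n + 1)) : |(x k : ℝ) - v k * x 0| ≤ Lxi v x := by
  have := Finset.le_sup' (fun k => |v 0 * (x k : ℝ) - v k * (x 0 : ℝ)|) (Finset.mem_univ k)
  simp only [hv, one_mul] at this
  simpa only [Lxi, hv, one_mul] using this

lemma aux_xivec_zero (n : ℕ) (hn : 2 ≤ n) (θ ξ : ℝ) : xivec n θ ξ 0 = 1 := by
  have : 0 < n := by omega
  simp [xivec, this]

/-- `1, θ, …, θ^{n-1}, ξ` are linearly independent over `ℚ`. -/
lemma aux_indep (n : ℕ) (θ : ℝ) (hθ : IsAlgebraic ℚ θ)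
    (hdeg : (minpoly ℚ θ).natDegree = n)
    (ξ : ℝ) (hξ : ξ ∉ IntermediateField.adjoin ℚ ({θ} : Set ℝ))
    (a : Fin (n + 1) → ℚ) (h : ∑ j, (a j : ℝ) * xivec n θ ξ j = 0) : a = 0 := by
  rw [Fin.sum_univ_castSucc] at h
  simp only [xivec, Fin.val_castSucc, Fin.is_lt, if_true, Fin.val_last, lt_irrefl, if_false] at h
  set p : Polynomial ℚ := ∑ j : Fin n, Polynomial.monomial (j : ℕ) (a j.castSucc) with hp
  have hpe : Polynomial.aeval θ p = ∑ j : Fin n, (a j.castSucc : ℝ) * θ ^ (j : ℕ) := by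
    simp [hp, map_sum, Polynomial.aeval_monomial]
  have hlast : a (Fin.last n) = 0 := by
    by_contra hne
    apply hξ
    have hne' : (a (Fin.last n) : ℝ) ≠ 0 := by exact_mod_cast hne
    have : ξ = - (∑ j : Fin n, (a j.castSucc : ℝ) * θ ^ (j : ℕ)) / (a (Fin.last n) : ℝ) := by
      field_simp; linarith
    rw [this, ← hpe]
    have hm : θ ∈ IntermediateField.adjoin ℚ ({θ} : Set ℝ) :=
      IntermediateField.mem_adjoin_simple_self ℚ θ
    refine div_mem (neg_mem ?_) ?_
    · rw [hpe]
      refine sum_mem fun j _ => mul_mem ?_ (pow_mem hm _)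
      exact SubfieldClass.ratCast_mem _ _
    · exact SubfieldClass.ratCast_mem _ _
  rw [hlast] at h
  have hp0 : p = 0 := by
    by_contra hne
    have h1 := minpoly.degree_le_of_ne_zero ℚ θ hne (by rw [hpe]; simpa using h)
    have hθint : IsIntegral ℚ θ := hθ.isIntegral
    rw [Polynomial.degree_eq_natDegree (minpoly.ne_zero hθint), hdeg] at h1
    have h2 : p.degree < n := by
      refine (Polynomial.degree_sum_le _ _).trans_lt ?_
      rw [Finset.sup_lt_iff (WithBot.bot_lt_coe _)]
      intro j _
      refine (Polynomial.degree_monomial_le _ _).trans_lt ?_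
      exact_mod_cast j.2
    exact absurd h1 (not_le.mpr h2)
  funext j
  refine Fin.lastCases hlast (fun i => ?_) j
  have := congrArg (fun q => Polynomial.coeff q (i : ℕ)) hp0
  simp only [hp, Polynomial.finsetSum_coeff, Polynomial.coeff_monomial, Polynomial.coeff_zero] at this
  simpa [Fin.val_inj] using this

open Polynomial in
/-- The functional `p ↦ ∑ k < n, (p mod f)_k y_k`. -/
noncomputable def auxPhi (f : ℚ[X]) (n : ℕ) (y : ℕ → ℚ) (p : ℚ[X]) : ℚ :=
  ∑ k ∈ Finset.range n, (p %ₘ f).coeff k * y k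

open Polynomial in
lemma auxPhi_add (f : ℚ[X]) (n : ℕ) (y : ℕ → ℚ) (p q : ℚ[X]) :
    auxPhi f n y (p + q) = auxPhi f n y p + auxPhi f n y q := by
  simp [auxPhi, Polynomial.add_modByMonic, add_mul, Finset.sum_add_distrib]

open Polynomial in
lemma auxPhi_smul (f : ℚ[X]) (n : ℕ) (y : ℕ → ℚ) (c : ℚ) (p : ℚ[X]) :
    auxPhi f n y (C c * p) = c * auxPhi f n y p := by
  rw [← Polynomial.smul_eq_C_mul]
  simp [auxPhi, Polynomial.smul_modByMonic, Finset.mul_sum, mul_assoc]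

open Polynomial in
lemma auxPhi_sum {ι : Type*} (s : Finset ι) (f : ℚ[X]) (n : ℕ) (y : ℕ → ℚ) (g : ι → ℚ[X]) :
    auxPhi f n y (∑ i ∈ s, g i) = ∑ i ∈ s, auxPhi f n y (g i) := by
  classical
  induction s using Finset.induction_on with
  | empty => simp [auxPhi]
  | insert a s ha ih => rw [Finset.sum_insert ha, Finset.sum_insert ha, auxPhi_add, ih]

open Polynomial in
lemma auxPhi_congr (f : ℚ[X]) (hf : f.Monic) (n : ℕ) (y : ℕ → ℚ) (p q : ℚ[X])
    (h : f ∣ p - q) : auxPhi f n y p = auxPhi f n y q := by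
  have : p %ₘ f = q %ₘ f := by
    rw [← sub_eq_zero, ← Polynomial.sub_modByMonic]
    exact (Polynomial.modByMonic_eq_zero_iff_dvd hf).2 h
  simp [auxPhi, this]

open Polynomial in
/-- Nondegeneracy of the form `(p, q) ↦ φ(pq)` -/
lemma auxPhi_nondeg (f : ℚ[X]) (hf : f.Monic) (hirr : Irreducible f) (n : ℕ)
    (hdeg : f.natDegree = n) (y : ℕ → ℚ) (p : ℚ[X]) (hp0 : p ≠ 0) (hp : p.degree < n)
    (h : ∀ j < n, auxPhi f n y (p * X ^ j) = 0) : ∀ k < n, y k = 0 := by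
  have hfdeg : f.degree = n := by rw [Polynomial.degree_eq_natDegree hf.ne_zero, hdeg]
  have hcop : IsCoprime f p := by
    rw [hirr.coprime_iff_not_dvd]
    intro hd
    have := Polynomial.degree_le_of_dvd hd hp0
    rw [hfdeg] at this
    exact absurd this (not_le.mpr hp)
  obtain ⟨u, v, huv⟩ := hcop
  intro k hk
  have h1 : auxPhi f n y (X ^ k) = y k := by
    have : (X ^ k : ℚ[X]) %ₘ f = X ^ k := by
      rw [Polynomial.modByMonic_eq_self_iff hf, hfdeg, Polynomial.degree_X_pow]
      exact_mod_cast hk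
    rw [auxPhi, this]
    simp [Polynomial.coeff_X_pow, hk]
  rw [← h1]
  set w := (v * X ^ k) %ₘ f with hw
  have h2 : auxPhi f n y (X ^ k) = auxPhi f n y (p * w) := by
    apply auxPhi_congr f hf
    obtain ⟨d, e⟩ : ∃ d, v * X ^ k = w + f * d :=
      ⟨_, (Polynomial.modByMonic_add_div (v * X ^ k) f).symm⟩
    refine ⟨u * X ^ k + p * d, ?_⟩
    calc X ^ k - p * w = (u * f + v * p) * X ^ k - p * w := by rw [huv, one_mul]
      _ = u * f * X ^ k + p * (v * X ^ k) - p * w := by ring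
      _ = _ := by rw [e]; ring
  rw [h2]
  have h3 : w = ∑ j ∈ Finset.range n, C (w.coeff j) * X ^ j := by
    apply Polynomial.as_sum_range_C_mul_X_pow'
    rw [← hdeg]
    apply Polynomial.natDegree_modByMonic_lt _ hf
    exact fun h => hirr.not_isUnit (h ▸ isUnit_one)
  rw [h3, Finset.mul_sum, auxPhi_sum]
  refine Finset.sum_eq_zero fun j hj => ?_
  have : p * (C (w.coeff j) * X ^ j) = C (w.coeff j) * (p * X ^ j) := by ring
  rw [this, auxPhi_smul, h j (Finset.mem_range.1 hj), mul_zero]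

open Polynomial in
lemma aux_denoms (f : ℚ[X]) (n : ℕ) : ∃ D : ℕ, 0 < D ∧ ∃ z : ℕ → ℕ → ℤ,
    ∀ m < 2 * n, ∀ k < n, (z m k : ℚ) = D * ((X ^ m : ℚ[X]) %ₘ f).coeff k := by
  set c : ℕ × ℕ → ℚ := fun q => ((X ^ q.1 : ℚ[X]) %ₘ f).coeff q.2 with hc
  refine ⟨∏ q ∈ Finset.range (2 * n) ×ˢ Finset.range n, (c q).den,
    Finset.prod_pos fun q _ => (c q).den_pos, ?_⟩
  set D := ∏ q ∈ Finset.range (2 * n) ×ˢ Finset.range n, (c q).den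
  refine ⟨fun m k => (D / (c (m, k)).den : ℕ) * (c (m, k)).num, fun m hm k hk => ?_⟩
  have hd : (c (m, k)).den ∣ D := Finset.dvd_prod_of_mem (fun q => (c q).den)
    (by simp [hm, hk])
  obtain ⟨e, he⟩ := hd
  have hpos := (c (m, k)).den_pos
  change (((D / (c (m, k)).den : ℕ) * (c (m, k)).num : ℤ) : ℚ) = _ * c (m, k)
  rw [he, Nat.mul_div_cancel_left _ hpos]
  have := Rat.num_div_den (c (m, k))
  push_cast
  nth_rewrite 3 [← this]
  field_simp

lemma aux_norm (n : ℕ) (hn : 2 ≤ n) (θ : ℝ) (hθ : IsAlgebraic ℚ θ)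
    (hdeg : (minpoly ℚ θ).natDegree = n) (ξ : ℝ) :
    ∃ c : ℝ, 0 < c ∧ ∀ x : Fin (n + 1) → ℤ, x 0 ≠ 0 → Lxi (xivec n θ ξ) x ≤ 1 →
      c ≤ |(x 0 : ℝ)| * Lxi (xivec n θ ξ) x ^ (n - 1) := by
  have hθint : IsIntegral ℚ θ := hθ.isIntegral
  set f := minpoly ℚ θ with hf
  have hmon : f.Monic := minpoly.monic hθint
  have hirr : Irreducible f := minpoly.irreducible hθint
  obtain ⟨D, hD, z, hz⟩ := aux_denoms f n
  set A : ℝ := ∑ m ∈ Finset.range (2 * n), ∑ k ∈ Finset.range n, |(z m k : ℝ)| with hA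
  have hA0 : 0 ≤ A := Finset.sum_nonneg fun _ _ => Finset.sum_nonneg fun _ _ => abs_nonneg _
  set T : ℝ := ∑ m ∈ Finset.range (2 * n), |θ ^ m| with hT
  have hTm : ∀ m < 2 * n, |θ ^ m| ≤ T := fun m hm =>
    Finset.single_le_sum (f := fun m => |θ ^ m|) (fun _ _ => abs_nonneg _) (Finset.mem_range.2 hm)
  have hT0 : 0 ≤ T := Finset.sum_nonneg fun _ _ => abs_nonneg _
  set B : ℝ := (1 + T) * A + D * T + 1 with hB
  have hB0 : 0 < B := by positivity
  refine ⟨1 / ((n.factorial : ℝ) * B ^ n), by positivity, fun x hx0 hL => ?_⟩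
  set v := xivec n θ ξ with hv
  have hv0 : v 0 = 1 := aux_xivec_zero n hn θ ξ
  set L := Lxi v x with hLdef
  have hLnn : 0 ≤ L := (abs_nonneg _).trans (aux_le_Lxi v hv0 x 0)
  set y : ℕ → ℤ := fun k => if h : k < n + 1 then x ⟨k, h⟩ else 0 with hy
  have hy0 : y 0 = x 0 := by simp [hy]
  have hyk : ∀ k < n, |(y k : ℝ) - x 0 * θ ^ k| ≤ L := by
    intro k hk
    have := aux_le_Lxi v hv0 x ⟨k, by omega⟩
    have h2 : v ⟨k, by omega⟩ = θ ^ k := by simp [hv, xivec, hk]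
    rw [h2] at this
    simpa [hy, show k ≤ n by omega, mul_comm] using this
  set E : ℕ → ℤ := fun m => ∑ k ∈ Finset.range n, z m k * y k with hE
  have hEphi : ∀ m < 2 * n, (E m : ℚ) =
      D * auxPhi f n (fun k => (y k : ℚ)) (Polynomial.X ^ m) := by
    intro m hm
    simp only [hE, auxPhi, Finset.mul_sum]
    push_cast
    refine Finset.sum_congr rfl fun k hk => ?_
    rw [hz m hm k (Finset.mem_range.1 hk)]; ring
  have hzθ : ∀ m < 2 * n, ∑ k ∈ Finset.range n, (z m k : ℝ) * θ ^ k = D * θ ^ m := by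
    intro m hm
    have h1 : Polynomial.aeval θ ((Polynomial.X ^ m : Polynomial ℚ) %ₘ f) = θ ^ m := by
      rw [Polynomial.aeval_modByMonic_eq_self_of_root (minpoly.aeval ℚ θ)]; simp
    rw [← h1, Polynomial.aeval_eq_sum_range' (n := n), Finset.mul_sum]
    · refine Finset.sum_congr rfl fun k hk => ?_
      have := hz m hm k (Finset.mem_range.1 hk)
      have h2 : (z m k : ℝ) = D * ((((Polynomial.X ^ m : Polynomial ℚ) %ₘ f).coeff k : ℚ) : ℝ) := by
        exact_mod_cast congrArg (Rat.cast : ℚ → ℝ) this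
      rw [h2, Algebra.smul_def, mul_assoc]; simp
    · rw [← hdeg]
      exact Polynomial.natDegree_modByMonic_lt _ hmon (fun h => hirr.not_isUnit (h ▸ isUnit_one))
  have hEest : ∀ m < 2 * n, |(E m : ℝ) - D * x 0 * θ ^ m| ≤ A * L := by
    intro m hm
    have h1 : (E m : ℝ) - D * x 0 * θ ^ m =
        ∑ k ∈ Finset.range n, (z m k : ℝ) * ((y k : ℝ) - x 0 * θ ^ k) := by
      have h2 : (D : ℝ) * x 0 * θ ^ m = x 0 * (D * θ ^ m) := by ring
      rw [h2, ← hzθ m hm, Finset.mul_sum, hE]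
      push_cast
      rw [← Finset.sum_sub_distrib]
      exact Finset.sum_congr rfl fun k _ => by ring
    rw [h1]
    refine (Finset.abs_sum_le_sum_abs _ _).trans ?_
    calc _ ≤ ∑ k ∈ Finset.range n, |(z m k : ℝ)| * L := by
          refine Finset.sum_le_sum fun k hk => ?_
          rw [abs_mul]
          exact mul_le_mul_of_nonneg_left (hyk k (Finset.mem_range.1 hk)) (abs_nonneg _)
      _ = (∑ k ∈ Finset.range n, |(z m k : ℝ)|) * L := by rw [Finset.sum_mul]
      _ ≤ A * L := by
          refine mul_le_mul_of_nonneg_right ?_ hLnn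
          exact Finset.single_le_sum (f := fun m => ∑ k ∈ Finset.range n, |(z m k : ℝ)|)
            (fun _ _ => Finset.sum_nonneg fun _ _ => abs_nonneg _) (Finset.mem_range.2 hm)
  -- the Hankel matrix
  set H : Matrix (Fin n) (Fin n) ℤ := Matrix.of fun i j => E (i + j) with hH
  have hHdet : H.det ≠ 0 := by
    intro h0
    obtain ⟨a, ha, hav⟩ := Matrix.exists_vecMul_eq_zero_iff.2 h0
    set p : Polynomial ℚ := ∑ i : Fin n, Polynomial.C (a i : ℚ) * Polynomial.X ^ (i : ℕ) with hp
    have hpc : ∀ i : Fin n, p.coeff i = a i := by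
      intro i
      simp [hp, Polynomial.finsetSum_coeff, Polynomial.coeff_X_pow, Fin.val_inj]
    have hp0 : p ≠ 0 := by
      intro h
      apply ha
      funext i
      have := hpc i
      rw [h] at this
      simpa using this.symm
    have hpd : p.degree < n := by
      refine (Polynomial.degree_sum_le _ _).trans_lt ?_
      rw [Finset.sup_lt_iff (WithBot.bot_lt_coe _)]
      intro j _
      refine (Polynomial.degree_C_mul_X_pow_le _ _).trans_lt ?_
      exact_mod_cast j.2
    have := auxPhi_nondeg f hmon hirr n hdeg (fun k => (y k : ℚ)) p hp0 hpd ?_ 0 (by omega)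
    · apply hx0
      rw [← hy0]
      exact_mod_cast this
    · intro j hj
      have hj' := congrFun hav ⟨j, hj⟩
      simp only [Matrix.vecMul, dotProduct, hH, Matrix.of_apply, Pi.zero_apply] at hj'
      have hD' : (D : ℚ) ≠ 0 := by exact_mod_cast hD.ne'
      apply mul_left_cancel₀ hD'
      rw [hp, Finset.sum_mul, auxPhi_sum, mul_zero, Finset.mul_sum]
      have h5 : (∑ i : Fin n, (a i : ℚ) * (E (i + j) : ℚ)) = 0 := by exact_mod_cast hj'
      rw [← h5]
      refine Finset.sum_congr rfl fun i _ => ?_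
      rw [mul_assoc, ← pow_add, auxPhi_smul, hEphi _ (by omega)]
      ring
  set M : Matrix (Fin n) (Fin n) ℝ := H.map (Int.cast) with hM
  have hMdet : M.det = (H.det : ℝ) := by
    rw [hM]; exact ((Int.castRingHom ℝ).map_det H).symm
  have hone : 1 ≤ |M.det| := by
    rw [hMdet]
    exact_mod_cast Int.one_le_abs hHdet
  have hn0 : 0 < n := by omega
  have : NeZero n := ⟨hn0.ne'⟩
  set i0 : Fin n := ⟨0, hn0⟩ with hi0
  set cc : Fin n → ℝ := fun i => if i = i0 then 0 else - θ ^ (i : ℕ) with hcc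
  set M' : Matrix (Fin n) (Fin n) ℝ := Matrix.of fun i j => M i j + cc i * M i0 j with hM'
  have hdetM' : M'.det = M.det :=
    Matrix.det_eq_of_forall_row_eq_smul_add_const cc i0 (by simp [hcc]) (fun i j => rfl)
  set b : Fin n → ℝ := fun i => B * (if i = i0 then |(x 0 : ℝ)| else L) with hb
  have hx1 : 1 ≤ |(x 0 : ℝ)| := by exact_mod_cast Int.one_le_abs hx0
  have hbound : ∀ i j, |M' i j| ≤ b i := by
    intro i j
    have hM_ij : ∀ i j : Fin n, M i j = (E (i + j) : ℝ) := fun i j => rfl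
    have e1 := hEest (i + j) (by omega)
    have e2 := hEest (i0 + j) (by simp only [hi0]; omega)
    have t1 := hTm (i + j) (by omega)
    have t2 := hTm i (by omega)
    simp only [hM', Matrix.of_apply, hM_ij, hb, hcc]
    split_ifs with hi
    · subst hi
      have h1 : |(E (i0 + j) : ℝ)| ≤ A * L + D * |(x 0 : ℝ)| * T := by
        have h2 : (E (i0 + j) : ℝ) =
          ((E (i0 + j) : ℝ) - D * x 0 * θ ^ ((i0 : ℕ) + j)) + D * x 0 * θ ^ ((i0 : ℕ) + j) := by ring
        rw [h2]
        refine (abs_add_le _ _).trans (add_le_add e2 ?_)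
        rw [abs_mul, abs_mul, Nat.abs_cast]
        exact mul_le_mul_of_nonneg_left t1 (by positivity)
      have h3 : A * L ≤ A * |(x 0 : ℝ)| := mul_le_mul_of_nonneg_left (hL.trans hx1) hA0
      have h4 : 0 ≤ T * A * |(x 0 : ℝ)| := by positivity
      simp only [zero_mul, add_zero]
      rw [hB]; nlinarith
    · have h2 : (E (i + j) : ℝ) + -θ ^ (i : ℕ) * (E (i0 + j) : ℝ) =
          ((E (i + j) : ℝ) - D * x 0 * θ ^ ((i : ℕ) + j)) -
          θ ^ (i : ℕ) * ((E (i0 + j) : ℝ) - D * x 0 * θ ^ ((i0 : ℕ) + j)) := by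
        simp only [hi0, zero_add, pow_add]; ring
      rw [h2]
      have h3 : |θ ^ (i : ℕ) * ((E (i0 + j) : ℝ) - D * x 0 * θ ^ ((i0 : ℕ) + j))| ≤ T * (A * L) := by
        rw [abs_mul]
        exact mul_le_mul t2 e2 (abs_nonneg _) hT0
      have h4 := (abs_sub _ _).trans (add_le_add e1 h3)
      refine h4.trans ?_
      have h5 : 0 ≤ (D * T + 1) * L := by positivity
      rw [hB]; nlinarith
  have hfin := aux_det_bound M' b hbound
  have hprod : ∏ i, b i = B ^ n * (|(x 0 : ℝ)| * L ^ (n - 1)) := by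
    rw [hb, Finset.prod_mul_distrib, Finset.prod_const, Finset.card_univ, Fintype.card_fin]
    congr 1
    rw [← Finset.mul_prod_erase _ _ (Finset.mem_univ i0)]
    simp only [if_true]
    congr 1
    rw [Finset.prod_congr rfl (g := fun _ => L)]
    · simp
    · intro i hi
      simp [Finset.ne_of_mem_erase hi]
  rw [hdetM', hprod] at hfin
  rw [div_le_iff₀ (by positivity)]
  calc (1 : ℝ) ≤ _ := hone
    _ ≤ _ := hfin
    _ = _ := by ring

lemma aux_det_add {N : ℕ} (u w : Fin N → Fin N → ℚ)
    (hw : ∀ i, w i ∈ Submodule.span ℚ (u '' (Finset.Iio i : Finset (Fin N)))) :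
    (Matrix.of fun i j => u i j + w i j).det = (Matrix.of u).det := by
  have h1 : ∀ i, ∃ c : Fin N → ℚ, ∑ m ∈ Finset.Iio i, c m • u m = w i := fun i =>
    (Submodule.mem_span_image_finset_iff_exists_fun' ℚ).1 (hw i)
  choose a ha using h1
  set T : Matrix (Fin N) (Fin N) ℚ :=
    Matrix.of fun i m => if m < i then a i m else if m = i then 1 else 0 with hT
  have hTdet : T.det = 1 := by
    rw [Matrix.det_of_isLowerTriangular T]
    · simp [hT]
    · intro i j hij
      have hij' : i < j := hij
      simp [hT, not_lt.2 hij'.le, hij'.ne']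
  have hmul : (Matrix.of fun i j => u i j + w i j) = T * Matrix.of u := by
    ext i j
    rw [Matrix.mul_apply]
    simp only [Matrix.of_apply, hT]
    have h2 : ∀ m, (if m < i then a i m else if m = i then 1 else 0) * u m j =
        (if m < i then a i m * u m j else 0) + (if m = i then u m j else 0) := by
      intro m
      rcases lt_trichotomy m i with h | h | h
      · simp [h, h.ne]
      · simp [h]
      · simp [not_lt.2 h.le, h.ne']
    rw [Finset.sum_congr rfl (fun m _ => h2 m), Finset.sum_add_distrib, ← ha i]
    rw [Finset.sum_apply]
    simp only [Pi.smul_apply, smul_eq_mul, Finset.sum_ite_eq', Finset.mem_univ, if_true]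
    rw [← Finset.sum_filter, add_comm]
    congr 1
    apply Finset.sum_congr _ (fun _ _ => rfl)
    ext m; simp
  rw [hmul, Matrix.det_mul, hTdet, one_mul]

lemma aux_det_ne {N : ℕ} (u : Fin N → Fin N → ℚ)
    (hu : ∀ i, u i ∉ Submodule.span ℚ (u '' (Finset.Iio i : Finset (Fin N)))) :
    (Matrix.of u).det ≠ 0 := by
  intro h0
  obtain ⟨a, ha, hav⟩ := Matrix.exists_vecMul_eq_zero_iff.2 h0
  have hne : (Finset.univ.filter fun i => a i ≠ 0).Nonempty := by
    by_contra hcon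
    apply ha
    funext i
    by_contra hi
    exact hcon ⟨i, by simpa using hi⟩
  set i := (Finset.univ.filter fun i => a i ≠ 0).max' hne with hi
  have hai : a i ≠ 0 := by
    have := Finset.max'_mem _ hne
    exact (Finset.mem_filter.1 this).2
  have hgt : ∀ m, i < m → a m = 0 := by
    intro m hm
    by_contra hm0
    have := Finset.le_max' (Finset.univ.filter fun i => a i ≠ 0) m (by simpa using hm0)
    exact absurd hm (not_lt.2 this)
  have hsum : ∑ m, a m • u m = 0 := by
    funext j
    have := congrFun hav j
    simpa [Matrix.vecMul, dotProduct, Finset.sum_apply] using this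
  apply hu i
  have h3 : ∑ m, a m • u m = (∑ m ∈ Finset.Iio i, a m • u m) + a i • u i := by
    have h4 : ∑ m, a m • u m = ∑ m ∈ Finset.Iic i, a m • u m := by
      symm
      apply Finset.sum_subset (Finset.subset_univ _)
      intro m _ hm
      rw [hgt m (by simpa using hm), zero_smul]
    rw [h4, ← Finset.Iio_insert, Finset.sum_insert (by simp), add_comm]
  have h5 : u i = (-(a i)⁻¹) • ∑ m ∈ Finset.Iio i, a m • u m := by
    rw [h3] at hsum
    have : ∑ m ∈ Finset.Iio i, a m • u m = - (a i • u i) := eq_neg_of_add_eq_zero_left hsum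
    rw [this, neg_smul, smul_neg, neg_neg, smul_smul, inv_mul_cancel₀ hai, one_smul]
  rw [h5]
  refine Submodule.smul_mem _ _ (Submodule.sum_mem _ fun m hm => Submodule.smul_mem _ _ ?_)
  exact Submodule.subset_span ⟨m, by simpa using hm, rfl⟩

lemma aux_greedy {n : ℕ} (x : ℕ → Fin (n + 1) → ℚ) (k : ℕ)
    (h : ∀ S : Submodule ℚ (Fin (n + 1) → ℚ), S ≠ ⊤ → ∃ i, k ≤ i ∧ x i ∉ S) :
    ∃ l : ℕ → ℕ, (∀ j ≤ n, k ≤ l j ∧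
        x (l j) ∉ Submodule.span ℚ ((x ∘ l) '' (Finset.range j : Finset ℕ))) ∧
      ∀ j < n, l j < l (j + 1) ∧
        x (l (j + 1) - 1) ∈ Submodule.span ℚ ((x ∘ l) '' (Finset.range (j + 1) : Finset ℕ)) := by
  set mm : Submodule ℚ (Fin (n + 1) → ℚ) → ℕ := fun S => sInf {i | k ≤ i ∧ x i ∉ S} with hmm
  have hmm1 : ∀ S, S ≠ ⊤ → k ≤ mm S ∧ x (mm S) ∉ S := fun S hS => Nat.sInf_mem (h S hS)
  have hmm2 : ∀ S i, k ≤ i → i < mm S → x i ∈ S := by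
    intro S i hki hi
    by_contra hx
    exact Nat.notMem_of_lt_sInf hi ⟨hki, hx⟩
  set S : ℕ → Submodule ℚ (Fin (n + 1) → ℚ) := fun j =>
    Nat.rec ⊥ (fun _ S => S ⊔ Submodule.span ℚ {x (mm S)}) j with hS
  have hS1 : ∀ j, S (j + 1) = S j ⊔ Submodule.span ℚ {x (mm (S j))} := fun j => rfl
  set l : ℕ → ℕ := fun j => mm (S j) with hl
  have hspan : ∀ j, S j = Submodule.span ℚ ((x ∘ l) '' (Finset.range j : Finset ℕ)) := by
    intro j
    induction j with
    | zero => simp [hS]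
    | succ j ih =>
      rw [hS1, Finset.range_add_one, Finset.coe_insert, Set.image_insert_eq, Submodule.span_insert,
        ← ih, sup_comm]
      rfl
  have htop : ∀ j ≤ n, S j ≠ ⊤ := by
    intro j hj ht
    have h1 : Module.finrank ℚ (S j) ≤ j := by
      rw [hspan, ← Finset.coe_image]
      refine (finrank_span_finset_le_card _).trans ?_
      exact Finset.card_image_le.trans (by simp)
    rw [ht, finrank_top, Module.finrank_fin_fun] at h1
    omega
  refine ⟨l, fun j hj => ?_, fun j hj => ?_⟩
  · rw [← hspan]; exact hmm1 _ (htop j hj)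
  · rw [← hspan]
    have hlt : l j < l (j + 1) := by
      by_contra hcon
      obtain ⟨h1, h2⟩ := hmm1 _ (htop (j + 1) hj)
      rcases (not_lt.1 hcon).lt_or_eq with h3 | h3
      · exact h2 ((le_sup_left : S j ≤ S (j + 1)) (hmm2 _ _ h1 h3))
      · apply h2
        change x (l (j + 1)) ∈ _
        rw [h3]
        exact (le_sup_right : _ ≤ S (j + 1)) (Submodule.mem_span_singleton_self _)
    refine ⟨hlt, hmm2 _ _ ?_ ?_⟩
    · have := (hmm1 _ (htop j hj.le)).1
      change k ≤ l j at this
      omega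
    · change l (j + 1) - 1 < l (j + 1)
      omega

/-- The determinant inequality. -/
lemma aux_det_ineq {n : ℕ} (v : Fin (n + 1) → ℝ) (hv : v 0 = 1) (x : ℕ → Fin (n + 1) → ℤ)
    (hx0 : ∀ i, x i 0 ≠ 0) (hL1 : ∀ i, Lxi v (x i) ≤ 1)
    (hmono : Monotone fun i => |(x i 0 : ℝ)|) (hanti : Antitone fun i => Lxi v (x i))
    (k : ℕ)
    (h : ∀ S : Submodule ℚ (Fin (n + 1) → ℚ), S ≠ ⊤ → ∃ i, k ≤ i ∧ (fun j => (x i j : ℚ)) ∉ S) :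
    ∃ l : ℕ → ℕ, (∀ j ≤ n, k ≤ l j) ∧ (∀ j < n, l j < l (j + 1)) ∧
      1 ≤ ((n + 1).factorial : ℝ) * (3 + ∑ j, |v j|) ^ (n + 1) * (|(x (l 0) 0 : ℝ)| *
        ∏ i ∈ Finset.range n, (|(x (l (i + 1)) 0 : ℝ)| * Lxi v (x (l (i + 1) - 1)) /
          |(x (l (i + 1) - 1) 0 : ℝ)|)) := by
  obtain ⟨l, hl1, hl2⟩ := aux_greedy (fun i j => (x i j : ℚ)) k h
  refine ⟨l, fun j hj => (hl1 j hj).1, fun j hj => (hl2 j hj).1, ?_⟩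
  set u : Fin (n + 1) → Fin (n + 1) → ℚ := fun i j => (x (l i) j : ℚ) with hu
  have himg : ∀ i : Fin (n + 1), ((fun i j => (x i j : ℚ)) ∘ l) '' (Finset.range i : Finset ℕ) =
      u '' (Finset.Iio i : Finset (Fin (n + 1))) := by
    intro i
    ext y
    constructor
    · rintro ⟨m, hm, rfl⟩
      have hm' : m < i := by simpa using hm
      exact ⟨⟨m, by omega⟩, Finset.mem_coe.2 (Finset.mem_Iio.2 hm'), rfl⟩
    · rintro ⟨m, hm, rfl⟩
      have hm2 : m < i := Finset.mem_Iio.1 (Finset.mem_coe.1 hm)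
      exact ⟨m, Finset.mem_coe.2 (Finset.mem_range.2 hm2), rfl⟩
  have hdet : (Matrix.of u).det ≠ 0 := by
    apply aux_det_ne
    intro i
    rw [← himg]
    exact (hl1 i (by omega)).2
  set w : Fin (n + 1) → Fin (n + 1) → ℚ := fun i =>
    if i = 0 then 0 else
      (-((x (l i) 0 : ℚ) / (x (l i - 1) 0 : ℚ))) • (fun j => (x (l i - 1) j : ℚ)) with hw
  have hdet2 := aux_det_add u w (by
    intro i
    rw [← himg]
    by_cases hi : i = 0
    · have : w i = 0 := by simp only [hw, if_pos hi]
      rw [this]; exact Submodule.zero_mem _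
    · simp only [hw, hi, if_false]
      apply Submodule.smul_mem
      have hi' : (i : ℕ) ≠ 0 := fun h => hi (Fin.ext h)
      have := (hl2 (i - 1) (by omega)).2
      rwa [show (i : ℕ) - 1 + 1 = i by omega] at this)
  set M : Matrix (Fin (n + 1)) (Fin (n + 1)) ℝ :=
    (Matrix.of fun i j => u i j + w i j).map (Rat.cast) with hM
  have hMdet : M.det = ((Matrix.of u).det : ℝ) := by
    rw [← hdet2, hM]
    exact ((Rat.castHom ℝ).map_det _).symm
  have hone : 1 ≤ |M.det| := by
    have h1 : (Matrix.of u).det = ((Matrix.of (fun (i j : Fin (n + 1)) => x (l i) j)).det : ℚ) := by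
      have := (Int.castRingHom ℚ).map_det (Matrix.of (fun (i j : Fin (n + 1)) => x (l i) j))
      rw [eq_intCast] at this
      rw [this]; rfl
    rw [hMdet, h1]
    rw [h1] at hdet
    exact_mod_cast Int.one_le_abs (by exact_mod_cast hdet)
  set B : ℝ := 3 + ∑ j, |v j| with hB
  have hvB : ∀ j, |v j| + 1 ≤ B := by
    intro j
    have := Finset.single_le_sum (f := fun j => |v j|) (fun _ _ => abs_nonneg _)
      (Finset.mem_univ j)
    linarith
  have hB2 : 2 ≤ B := by
    have : 0 ≤ ∑ j, |v j| := Finset.sum_nonneg fun _ _ => abs_nonneg _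
    linarith
  have hX1 : ∀ i, 1 ≤ |(x i 0 : ℝ)| := fun i => by exact_mod_cast Int.one_le_abs (hx0 i)
  have hL0 : ∀ i, 0 ≤ Lxi v (x i) := fun i => (abs_nonneg _).trans (aux_le_Lxi v hv (x i) 0)
  set b : Fin (n + 1) → ℝ := fun i => B * (if i = 0 then |(x (l 0) 0 : ℝ)| else
    |(x (l i) 0 : ℝ)| * Lxi v (x (l i - 1)) / |(x (l i - 1) 0 : ℝ)|) with hb
  have hbound : ∀ i j, |M i j| ≤ b i := by
    intro i j
    have hMij : M i j = (((u i j + w i j : ℚ)) : ℝ) := rfl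
    rw [hMij]
    by_cases hi : i = 0
    · subst hi
      simp only [hb, hw, hu, if_true, Pi.zero_apply, add_zero, Fin.val_zero, Rat.cast_intCast]
      have h1 := aux_le_Lxi v hv (x (l 0)) j
      have h2 := hL1 (l 0)
      have h3 := hX1 (l 0)
      have h4 : |(x (l 0) j : ℝ)| ≤ |(x (l 0) j : ℝ) - v j * x (l 0) 0| + |v j * x (l 0) 0| := by
        have := abs_add_le ((x (l 0) j : ℝ) - v j * x (l 0) 0) (v j * x (l 0) 0)
        simpa using this
      rw [abs_mul] at h4
      have h5 := mul_le_mul_of_nonneg_right (hvB j) (abs_nonneg (x (l 0) 0 : ℝ))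
      nlinarith
    · simp only [hb, hw, hu, hi, if_false, Pi.smul_apply, smul_eq_mul]
      push_cast
      have hi' : (i : ℕ) ≠ 0 := fun h => hi (Fin.ext h)
      have hlpos : 0 < l i := by
        have := (hl2 (i - 1) (by omega)).1
        rw [show (i : ℕ) - 1 + 1 = i by omega] at this
        omega
      set p := l i with hp
      set q := l i - 1 with hq
      have hqp : q ≤ p := by omega
      have h1 := aux_le_Lxi v hv (x p) j
      have h2 := aux_le_Lxi v hv (x q) j
      have h3 : Lxi v (x p) ≤ Lxi v (x q) := hanti hqp
      have h4 : |(x q 0 : ℝ)| ≤ |(x p 0 : ℝ)| := hmono hqp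
      have h5 : (x q 0 : ℝ) ≠ 0 := by exact_mod_cast hx0 q
      have h6 : 0 < |(x q 0 : ℝ)| := abs_pos.2 h5
      have e1 : (x p j : ℝ) + -((x p 0 : ℝ) / x q 0) * x q j =
          (x p j - v j * x p 0) - (x p 0 : ℝ) / x q 0 * (x q j - v j * x q 0) := by
        field_simp; ring
      rw [e1]
      refine (abs_sub _ _).trans ?_
      rw [abs_mul, abs_div]
      have h7 : 1 ≤ |(x p 0 : ℝ)| / |(x q 0 : ℝ)| := (one_le_div h6).2 h4
      have h8 : |(x p 0 : ℝ)| / |(x q 0 : ℝ)| * |(x q j : ℝ) - v j * x q 0| ≤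
        |(x p 0 : ℝ)| / |(x q 0 : ℝ)| * Lxi v (x q) := mul_le_mul_of_nonneg_left h2 (by positivity)
      have h9 : Lxi v (x q) ≤ |(x p 0 : ℝ)| / |(x q 0 : ℝ)| * Lxi v (x q) :=
        le_mul_of_one_le_left (hL0 q) h7
      have h10 : |(x p 0 : ℝ)| * Lxi v (x q) / |(x q 0 : ℝ)| =
        |(x p 0 : ℝ)| / |(x q 0 : ℝ)| * Lxi v (x q) := by ring
      rw [h10]
      have h11 : 0 ≤ |(x p 0 : ℝ)| / |(x q 0 : ℝ)| * Lxi v (x q) := (hL0 q).trans h9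
      have h12 := mul_le_mul_of_nonneg_right hB2 h11
      linarith
  have hfin := hone.trans (aux_det_bound M b hbound)
  refine hfin.trans (le_of_eq ?_)
  rw [mul_assoc]
  congr 1
  rw [hb, Finset.prod_mul_distrib, Finset.prod_const, Finset.card_univ, Fintype.card_fin]
  congr 1
  rw [Fin.prod_univ_succ, Finset.prod_range]
  simp [Fin.succ_ne_zero]

/-- Growth of the product. -/
lemma aux_growth (n : ℕ) (X L : ℕ → ℝ) (hX1 : ∀ i, 1 ≤ X i) (hmono : Monotone X)
    (t r C c : ℝ) (hC : 0 < C) (hc : 0 < c) (hc1 : c ≤ 1)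
    (hL0 : ∀ i, 0 ≤ L i)
    (hL : ∀ i, L i ≤ C * X (i + 1) ^ (-t)) (hXr : ∀ i, c * X (i + 1) ^ r ≤ X i)
    (e : ℕ → ℝ) (he0 : e 0 = 1) (hes : ∀ j, e (j + 1) = 1 - t + r * (e j - 1))
    (hepos : ∀ j < n, 0 ≤ e j) (hele : ∀ j, e j ≤ 1)
    (l : ℕ → ℕ) (hl : ∀ j < n, l j < l (j + 1)) :
    ∀ j ≤ n, X (l 0) * ∏ i ∈ Finset.range j, (X (l (i + 1)) * L (l (i + 1) - 1) /
      X (l (i + 1) - 1)) ≤ (C / c) ^ j * X (l j) ^ e j := by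
  intro j
  induction j with
  | zero => intro _; simp [he0]
  | succ j ih =>
    intro hj
    have ih := ih (by omega)
    have hjn : j < n := hj
    have hlj := hl j hjn
    rw [Finset.prod_range_succ, ← mul_assoc]
    set Z := X (l (j + 1) - 1) with hZ
    set W := X (l (j + 1)) with hW
    have hZ1 : 1 ≤ Z := hX1 _
    have hW1 : 1 ≤ W := hX1 _
    have hZ0 : 0 < Z := by linarith
    have hW0 : 0 < W := by linarith
    have hsucc : l (j + 1) - 1 + 1 = l (j + 1) := by omega
    have h1 : L (l (j + 1) - 1) ≤ C * W ^ (-t) := by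
      have := hL (l (j + 1) - 1); rwa [hsucc] at this
    have h2 : c * W ^ r ≤ Z := by
      have := hXr (l (j + 1) - 1); rwa [hsucc] at this
    have h3 : X (l j) ≤ Z := hmono (by omega)
    have h4 : X (l j) ^ e j ≤ Z ^ e j :=
      Real.rpow_le_rpow (by linarith [hX1 (l j)]) h3 (hepos j hjn)
    have hK : 0 < C / c := by positivity
    have h5 : Z ^ (e j - 1) ≤ c⁻¹ * W ^ (r * (e j - 1)) := by
      calc Z ^ (e j - 1) ≤ (c * W ^ r) ^ (e j - 1) :=
            Real.rpow_le_rpow_of_nonpos (by positivity) h2 (by linarith [hele j])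
        _ = c ^ (e j - 1) * W ^ (r * (e j - 1)) := by
            rw [Real.mul_rpow hc.le (by positivity), ← Real.rpow_mul hW0.le]
        _ ≤ c⁻¹ * W ^ (r * (e j - 1)) := by
            refine mul_le_mul_of_nonneg_right ?_ (by positivity)
            rw [← Real.rpow_neg_one]
            exact Real.rpow_le_rpow_of_exponent_ge hc hc1 (by linarith [hepos j hjn])
    have hfac : 0 ≤ W * L (l (j + 1) - 1) / Z :=
      div_nonneg (mul_nonneg hW0.le (hL0 _)) hZ0.le
    calc _ ≤ ((C / c) ^ j * X (l j) ^ e j) * (W * L (l (j + 1) - 1) / Z) :=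
          mul_le_mul_of_nonneg_right ih hfac
      _ ≤ ((C / c) ^ j * Z ^ e j) * (W * (C * W ^ (-t)) / Z) := by
          gcongr
      _ = (C / c) ^ j * C * (W ^ (1 - t)) * Z ^ (e j - 1) := by
          rw [Real.rpow_sub_one hZ0.ne', show (1 - t) = 1 + -t by ring, Real.rpow_add hW0,
            Real.rpow_one]
          ring
      _ ≤ (C / c) ^ j * C * (W ^ (1 - t)) * (c⁻¹ * W ^ (r * (e j - 1))) := by
          gcongr
      _ = _ := by
          rw [hes, Real.rpow_add hW0, pow_succ]; ring

/-- choice of the exponent -/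
lemma aux_choose_t (n : ℕ) (hn : 2 ≤ n) (lam : ℝ) (hlam : 0 < lam)
    (hlameq : ∑ k ∈ Finset.Icc 1 n, ((n : ℝ) - 1) ^ (k - 1) * lam ^ k = 1) (T : ℝ) (hT : lam < T) :
    ∃ t, 0 < t ∧ t ≤ T ∧ ∃ e : ℕ → ℝ, e 0 = 1 ∧
      (∀ j, e (j + 1) = 1 - t + (((n : ℝ) - 1) * t) * (e j - 1)) ∧
      (∀ j < n, 0 ≤ e j) ∧ (∀ j, e j ≤ 1) ∧ e n < 0 := by
  have hn1 : (0 : ℝ) < (n : ℝ) - 1 := by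
    have : (2 : ℝ) ≤ n := by exact_mod_cast hn
    linarith
  set g : ℕ → ℝ → ℝ := fun j s => s * ∑ k ∈ Finset.range j, (((n : ℝ) - 1) * s) ^ k with hg
  have hgl : g n lam = 1 := by
    rw [← hlameq, hg]
    simp only
    rw [Finset.mul_sum, ← Finset.Ico_succ_right_eq_Icc, Finset.sum_Ico_eq_sum_range]
    simp only [Nat.succ_eq_succ, Nat.succ_eq_add_one, Nat.add_sub_cancel]
    refine Finset.sum_congr rfl fun k _ => ?_
    rw [show 1 + k - 1 = k by omega, mul_pow, pow_add, pow_one]; ring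
  have hcont : Continuous (g (n - 1)) := by
    simp only [hg]; fun_prop
  have hlt : g (n - 1) lam < 1 := by
    rw [← hgl]
    simp only [hg]
    conv_rhs => rw [show n = (n - 1) + 1 by omega, Finset.sum_range_succ]
    have : 0 < (((n - 1 + 1 : ℕ) : ℝ) - 1) * lam := by
      rw [show n - 1 + 1 = n by omega]; positivity
    rw [show n - 1 + 1 = n by omega] at *
    have h2 := pow_pos this (n - 1)
    nlinarith
  have hev : ∀ᶠ s in nhds lam, g (n - 1) s < 1 :=
    hcont.continuousAt.eventually_lt continuousAt_const hlt
  have hev2 : ∀ᶠ s in nhdsWithin lam (Set.Ioi lam), g (n - 1) s < 1 ∧ s ∈ Set.Ioo lam T :=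
    (hev.filter_mono nhdsWithin_le_nhds).and (Ioo_mem_nhdsGT hT)
  obtain ⟨t, ht1, ht2, ht3⟩ := hev2.exists
  have ht0 : 0 < t := hlam.trans ht2
  have hr0 : 0 < ((n : ℝ) - 1) * t := by positivity
  refine ⟨t, ht0, ht3.le, fun j => 1 - g j t, by simp [hg], fun j => ?_, fun j hj => ?_,
    fun j => ?_, ?_⟩
  · simp only [hg]
    rw [Finset.sum_range_succ', pow_zero]
    have : ∑ k ∈ Finset.range j, (((n : ℝ) - 1) * t) ^ (k + 1) =
      (((n : ℝ) - 1) * t) * ∑ k ∈ Finset.range j, (((n : ℝ) - 1) * t) ^ k := by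
      rw [Finset.mul_sum]; exact Finset.sum_congr rfl fun k _ => by ring
    rw [this]; ring
  · have : g j t ≤ g (n - 1) t := by
      simp only [hg]
      refine mul_le_mul_of_nonneg_left ?_ ht0.le
      exact Finset.sum_le_sum_of_subset_of_nonneg (Finset.range_mono (by omega))
        (fun _ _ _ => by positivity)
    linarith
  · have : 0 ≤ g j t := by
      simp only [hg]
      exact mul_nonneg ht0.le (Finset.sum_nonneg fun _ _ => by positivity)
    linarith
  · have : g n lam < g n t := by
      simp only [hg]
      have hpos : 0 < ∑ k ∈ Finset.range n, (((n : ℝ) - 1) * t) ^ k :=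
        Finset.sum_pos (fun _ _ => by positivity) ⟨0, by simp; omega⟩
      have hle : ∑ k ∈ Finset.range n, (((n : ℝ) - 1) * lam) ^ k ≤
          ∑ k ∈ Finset.range n, (((n : ℝ) - 1) * t) ^ k := by
        refine Finset.sum_le_sum fun k _ => ?_
        have : lam ≤ t := le_of_lt ht2
        gcongr
      calc _ ≤ lam * ∑ k ∈ Finset.range n, (((n : ℝ) - 1) * t) ^ k :=
            mul_le_mul_of_nonneg_left hle hlam.le
        _ < _ := mul_lt_mul_of_pos_right ht2 hpos
    linarith

lemma aux_limsup {n : ℕ} (v : Fin (n + 1) → ℝ) (t : ℝ)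
    (h : Filter.limsup (fun X : ℝ => ENNReal.ofReal (X ^ t) * calL v Set.univ X) Filter.atTop < ⊤) :
    ∃ C : ℝ, 0 < C ∧ ∃ Y : ℝ, 1 ≤ Y ∧ ∀ X, Y ≤ X → ∃ x : Fin (n + 1) → ℤ, x ≠ 0 ∧
      |(x 0 : ℝ)| ≤ X ∧ Lxi v x ≤ C * X ^ (-t) := by
  obtain ⟨c, hc1, hc2⟩ := exists_between h
  have hev := Filter.eventually_lt_of_limsup_lt hc1
  obtain ⟨Y, hY⟩ := Filter.eventually_atTop.1 hev
  refine ⟨c.toReal + 1, by positivity, max Y 1, le_max_right _ _, fun X hX => ?_⟩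
  have hX1 : 1 ≤ X := (le_max_right _ _).trans hX
  have hX0 : 0 < X := by linarith
  have h1 := hY X ((le_max_left _ _).trans hX)
  have hXt : 0 < X ^ t := Real.rpow_pos_of_pos hX0 t
  have h2 : calL v Set.univ X < c / ENNReal.ofReal (X ^ t) := by
    rw [ENNReal.lt_div_iff_mul_lt (Or.inl (by simpa using hXt)) (Or.inl ENNReal.ofReal_ne_top),
      mul_comm]
    exact h1
  obtain ⟨_, ⟨x, -, hx0, hxX, rfl⟩, hlt⟩ := sInf_lt_iff.1 h2
  refine ⟨x, hx0, ?_, ?_⟩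
  · refine le_trans ?_ hxX
    rw [inorm, ← Real.sqrt_sq_eq_abs]
    apply Real.sqrt_le_sqrt
    exact Finset.single_le_sum (f := fun k => (x k : ℝ) ^ 2) (fun _ _ => sq_nonneg _)
      (Finset.mem_univ 0)
  · rw [ENNReal.lt_div_iff_mul_lt (Or.inl (by simpa using hXt)) (Or.inl ENNReal.ofReal_ne_top),
      mul_comm, ← ENNReal.ofReal_mul hXt.le] at hlt
    have h3 := (ENNReal.ofReal_le_iff_le_toReal hc2.ne).1 hlt.le
    rw [Real.rpow_neg hX0.le, ← div_eq_mul_inv, le_div_iff₀ hXt]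
    nlinarith

lemma aux_pos {n : ℕ} (hn : 2 ≤ n) (v : Fin (n + 1) → ℝ) (hv : v 0 = 1)
    (hind : ∀ a : Fin (n + 1) → ℚ, ∑ j, (a j : ℝ) * v j = 0 → a = 0)
    (y : Fin (n + 1) → ℤ) (hy : y ≠ 0) : 0 < Lxi v y := by
  have hle := aux_le_Lxi v hv y
  rcases ((abs_nonneg _).trans (hle 0)).lt_or_eq with h | h
  · exact h
  exfalso
  have hk : ∀ k, (y k : ℝ) = v k * y 0 := by
    intro k
    have := hle k
    rw [← h] at this
    exact sub_eq_zero.1 (abs_nonpos_iff.1 this)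
  have h10 : (⟨1, by omega⟩ : Fin (n + 1)) ≠ 0 := by
    intro h; simpa using congrArg Fin.val h
  have h0 : y 0 = 0 := by
    set o : Fin (n + 1) := ⟨1, by omega⟩
    have := hind (Pi.single o (y 0 : ℚ) - Pi.single 0 (y o : ℚ)) (by
      have : ∀ j, (((Pi.single o (y 0 : ℚ) - Pi.single 0 (y o : ℚ) : Fin (n + 1) → ℚ) j : ℚ) : ℝ)
          * v j = (if j = o then (y 0 : ℝ) * v o else 0) - (if j = 0 then (y o : ℝ) * v 0 else 0) := by
        intro j
        simp only [Pi.sub_apply, Pi.single_apply]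
        by_cases h1 : j = o
        · subst h1; simp [h10]
        · by_cases h2 : j = 0
          · subst h2; simp [h1]
          · simp [h1, h2]
      rw [Finset.sum_congr rfl fun j _ => this j, Finset.sum_sub_distrib]
      simp only [Finset.sum_ite_eq', Finset.mem_univ, if_true]
      rw [hk o, hv]; ring)
    have h2 := congrFun this o
    simpa [Pi.single_apply, h10] using h2
  apply hy
  funext k
  have := hk k
  rw [h0] at this
  simpa using this

lemma aux_seq {n : ℕ} (hn : 2 ≤ n) (v : Fin (n + 1) → ℝ) (hv : v 0 = 1)
    (hind : ∀ a : Fin (n + 1) → ℚ, ∑ j, (a j : ℝ) * v j = 0 → a = 0)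
    (t : ℝ) (ht : 0 < t) (C : ℝ) (hC : 0 < C) (Y : ℝ) (hY : 1 ≤ Y)
    (h : ∀ X, Y ≤ X → ∃ x : Fin (n + 1) → ℤ, x ≠ 0 ∧
      |(x 0 : ℝ)| ≤ X ∧ Lxi v x ≤ C * X ^ (-t)) :
    ∃ x : ℕ → Fin (n + 1) → ℤ, (∀ i, x i 0 ≠ 0) ∧ (∀ i, Lxi v (x i) ≤ 1) ∧
      (Monotone fun i => |(x i 0 : ℝ)|) ∧ (Antitone fun i => Lxi v (x i)) ∧
      (∀ B : ℝ, ∃ i, B < |(x i 0 : ℝ)|) ∧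
      ∃ C' : ℝ, 0 < C' ∧ ∀ i, Lxi v (x i) ≤ C' * |(x (i + 1) 0 : ℝ)| ^ (-t) := by
  have hpos := aux_pos hn v hv hind
  have hex : ∀ b : ℝ, 0 < b → ∃ y : Fin (n + 1) → ℤ, y ≠ 0 ∧ Lxi v y < b := by
    intro b hb
    have h1 : Tendsto (fun X : ℝ => C * X ^ (-t)) atTop (nhds (C * 0)) :=
      (tendsto_rpow_neg_atTop ht).const_mul C
    rw [mul_zero] at h1
    obtain ⟨X, hX1, hX2⟩ := ((h1.eventually_lt_const hb).and (eventually_ge_atTop Y)).exists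
    obtain ⟨x, hx0, -, hx⟩ := h X hX2
    exact ⟨x, hx0, hx.trans_lt hX1⟩
  have hmin : ∀ b : ℝ, 0 < b → ∃ y : Fin (n + 1) → ℤ, (y ≠ 0 ∧ Lxi v y < b) ∧
      ∀ z : Fin (n + 1) → ℤ, z ≠ 0 → Lxi v z < b → |(y 0 : ℝ)| ≤ |(z 0 : ℝ)| := by
    intro b hb
    set s : Set (Fin (n + 1) → ℤ) := {y | y ≠ 0 ∧ Lxi v y < b} with hs
    have hsne : s.Nonempty := hex b hb
    refine ⟨Function.argminOn (fun y => (y 0).natAbs) s hsne,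
      Function.argminOn_mem (fun y : Fin (n + 1) → ℤ => (y 0).natAbs) s hsne, fun z hz1 hz2 => ?_⟩
    have := Function.argminOn_le (fun y : Fin (n + 1) → ℤ => (y 0).natAbs) s
      (show z ∈ s from ⟨hz1, hz2⟩)
    have h2 : ∀ m : ℤ, |(m : ℝ)| = (m.natAbs : ℝ) := fun m => by
      rw [Nat.cast_natAbs]; simp
    rw [h2, h2]
    exact_mod_cast this
  choose! P hP1 hP2 using hmin
  set x : ℕ → Fin (n + 1) → ℤ := fun i => Nat.rec (P 1) (fun _ y => P (Lxi v y)) i with hx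
  have hx0 : x 0 = P 1 := rfl
  have hxs : ∀ i, x (i + 1) = P (Lxi v (x i)) := fun i => rfl
  have hne : ∀ i, x i ≠ 0 := by
    intro i
    induction i with
    | zero => exact (hP1 1 one_pos).1
    | succ i ih => exact (hP1 _ (hpos _ ih)).1
  have hlt : ∀ i, Lxi v (x (i + 1)) < Lxi v (x i) := fun i => (hP1 _ (hpos _ (hne i))).2
  have hsanti : StrictAnti fun i => Lxi v (x i) := strictAnti_nat_of_succ_lt hlt
  have hlt1 : ∀ i, Lxi v (x i) < 1 := by
    intro i
    exact (hsanti.antitone (Nat.zero_le i)).trans_lt (hP1 1 one_pos).2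
  have hxz : ∀ i, x i 0 ≠ 0 := by
    intro i h0
    apply hne i
    funext k
    have h1 := aux_le_Lxi v hv (x i) k
    rw [h0] at h1
    have h2 : |(x i k : ℝ)| < 1 := by simpa using h1.trans_lt (hlt1 i)
    exact Int.abs_lt_one_iff.1 (by exact_mod_cast h2)
  refine ⟨x, hxz, fun i => (hlt1 i).le, monotone_nat_of_le_succ fun i => ?_, hsanti.antitone,
    fun B => ?_, ?_⟩
  · cases i with
    | zero => exact hP2 1 one_pos _ (hne 1) (hlt1 1)
    | succ i => exact hP2 _ (hpos _ (hne i)) _ (hne (i + 2)) ((hlt (i + 1)).trans (hlt i))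
  · by_contra hcon
    push Not at hcon
    have hinj : Function.Injective x := by
      intro i j hij
      exact hsanti.injective (by simp only [hij])
    set D : ℝ := (∑ j, |v j|) * |B| + 1 with hD
    have hmem : ∀ i, x i ∈ Set.Icc (fun _ => -⌈D⌉ : Fin (n + 1) → ℤ) (fun _ => ⌈D⌉) := by
      intro i
      have hb : ∀ k, |(x i k : ℝ)| ≤ D := by
        intro k
        have h1 := (aux_le_Lxi v hv (x i) k).trans (hlt1 i).le
        have h4 : |(x i k : ℝ)| ≤ |(x i k : ℝ) - v k * x i 0| + |v k * x i 0| := by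
          have := abs_add_le ((x i k : ℝ) - v k * x i 0) (v k * x i 0)
          simpa using this
        have h5 : |v k * x i 0| ≤ (∑ j, |v j|) * |B| := by
          rw [abs_mul]
          refine mul_le_mul ?_ ((hcon i).trans (le_abs_self _)) (abs_nonneg _)
            (Finset.sum_nonneg fun _ _ => abs_nonneg _)
          exact Finset.single_le_sum (f := fun j => |v j|) (fun _ _ => abs_nonneg _)
            (Finset.mem_univ k)
        linarith
      have hb2 : ∀ k, |x i k| ≤ ⌈D⌉ := by
        intro k
        have := (hb k).trans (Int.le_ceil D)
        exact_mod_cast this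
      exact ⟨fun k => (abs_le.1 (hb2 k)).1, fun k => (abs_le.1 (hb2 k)).2⟩
    exact Set.infinite_of_injective_forall_mem hinj hmem (Set.finite_Icc _ _)
  · refine ⟨(2 * Y) ^ t + C * 2 ^ t, by positivity, fun i => ?_⟩
    set X := |(x (i + 1) 0 : ℝ)| with hX
    have hX1 : 1 ≤ X := by rw [hX]; exact_mod_cast Int.one_le_abs (hxz (i + 1))
    have hX0 : 0 < X := by linarith
    have hXt : 0 < X ^ (-t) := Real.rpow_pos_of_pos hX0 _
    rcases le_or_gt Y (X / 2) with hc | hc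
    · obtain ⟨y, hy0, hy1, hy2⟩ := h (X / 2) hc
      have h1 : Lxi v (x i) ≤ Lxi v y := by
        by_contra hcon
        have := hP2 _ (hpos _ (hne i)) y hy0 (not_le.1 hcon)
        rw [← hxs, ← hX] at this
        linarith
      have h2 : (X / 2) ^ (-t) = 2 ^ t * X ^ (-t) := by
        rw [Real.div_rpow hX0.le (by norm_num), Real.rpow_neg (by norm_num : (0 : ℝ) ≤ 2)]
        field_simp
      rw [h2] at hy2
      have h3 : 0 ≤ (2 * Y) ^ t * X ^ (-t) := by positivity
      calc _ ≤ _ := h1.trans hy2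
        _ ≤ _ := by rw [add_mul, mul_assoc C]; linarith
    · have h2 : 1 ≤ (2 * Y) ^ t * X ^ (-t) := by
        rw [Real.rpow_neg hX0.le, ← div_eq_mul_inv, one_le_div (by positivity)]
        exact Real.rpow_le_rpow hX0.le (by linarith) ht.le
      have h3 : 0 ≤ C * 2 ^ t * X ^ (-t) := by positivity
      have := hlt1 i
      rw [add_mul]; linarith

lemma aux_tail {n : ℕ} (v : Fin (n + 1) → ℝ) (hv : v 0 = 1)
    (hind : ∀ a : Fin (n + 1) → ℚ, ∑ j, (a j : ℝ) * v j = 0 → a = 0)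
    (x : ℕ → Fin (n + 1) → ℤ) (hL1 : ∀ i, Lxi v (x i) ≤ 1)
    (hmono : Monotone fun i => |(x i 0 : ℝ)|) (hunb : ∀ B : ℝ, ∃ i, B < |(x i 0 : ℝ)|)
    (k : ℕ) (S : Submodule ℚ (Fin (n + 1) → ℚ)) (hS : S ≠ ⊤) :
    ∃ i, k ≤ i ∧ (fun j => (x i j : ℚ)) ∉ S := by
  by_contra hcon
  push Not at hcon
  obtain ⟨f, hf0, hf⟩ := Submodule.exists_le_ker_of_lt_top S (lt_top_iff_ne_top.2 hS)
  set a : Fin (n + 1) → ℚ := fun j => f (Pi.single j 1) with ha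
  have hfa : ∀ y : Fin (n + 1) → ℚ, f y = ∑ j, a j * y j := by
    intro y
    rw [LinearMap.pi_apply_eq_sum_univ f y]
    refine Finset.sum_congr rfl fun j _ => ?_
    rw [smul_eq_mul, mul_comm, ha]
    congr 2
    funext m
    simp [Pi.single_apply, eq_comm]
  apply hf0
  have ha0 : a = 0 := by
    apply hind
    by_contra hne
    set s := ∑ j, (a j : ℝ) * v j with hs
    have hspos : 0 < |s| := abs_pos.2 hne
    obtain ⟨i, hi⟩ := hunb ((∑ j, |(a j : ℝ)|) / |s|)
    have hi2 : (∑ j, |(a j : ℝ)|) / |s| < |(x (max i k) 0 : ℝ)| :=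
      hi.trans_le (hmono (le_max_left i k))
    set m := max i k with hm
    have h1 : f (fun j => (x m j : ℚ)) = 0 := hf (hcon m (le_max_right i k))
    rw [hfa] at h1
    have h2 : ∑ j, (a j : ℝ) * (x m j : ℝ) = 0 := by exact_mod_cast congrArg (Rat.cast : ℚ → ℝ) h1
    have h3 : s * x m 0 = - ∑ j, (a j : ℝ) * ((x m j : ℝ) - v j * x m 0) := by
      have : ∑ j, (a j : ℝ) * ((x m j : ℝ) - v j * x m 0) =
          ∑ j, (a j : ℝ) * (x m j : ℝ) - s * x m 0 := by
        rw [hs, Finset.sum_mul, ← Finset.sum_sub_distrib]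
        exact Finset.sum_congr rfl fun j _ => by ring
      rw [this, h2]; ring
    have h4 : |s| * |(x m 0 : ℝ)| ≤ ∑ j, |(a j : ℝ)| := by
      rw [← abs_mul, h3, abs_neg]
      refine (Finset.abs_sum_le_sum_abs _ _).trans (Finset.sum_le_sum fun j _ => ?_)
      rw [abs_mul]
      exact mul_le_of_le_one_right (abs_nonneg _) ((aux_le_Lxi v hv (x m) j).trans (hL1 m))
    rw [div_lt_iff₀ hspos] at hi2
    linarith
  apply LinearMap.ext
  intro y
  rw [hfa, ha0]
  simp

/-- Theorem 6.1, inequality (6.1): for `θ` real algebraic of degree `n ≥ 2` and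
`ξ ∈ ℝ ∖ ℚ(θ)`, the point `ξ⃗ = (1, θ, …, θ^{n−1}, ξ)` satisfies `λ̂(ξ⃗) ≤ λ_n`, where
`λ_n` is the unique positive solution of `x + (n−1)x² + ⋯ + (n−1)^{n−1}xⁿ = 1`. -/
theorem uniform_exponent_bound (n : ℕ) (hn : 2 ≤ n) (θ : ℝ)
    (hθ : IsAlgebraic ℚ θ) (hdeg : (minpoly ℚ θ).natDegree = n)
    (ξ : ℝ) (hξ : ξ ∉ IntermediateField.adjoin ℚ ({θ} : Set ℝ))
    (lam : ℝ) (hlam : 0 < lam)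
    (hlameq : ∑ k ∈ Finset.Icc 1 n, ((n : ℝ) - 1) ^ (k - 1) * lam ^ k = 1) :
    lamHat (xivec n θ ξ) Set.univ ≤ ENNReal.ofReal lam := by
  unfold lamHat
  refine sSup_le ?_
  rintro _ ⟨T, hT0, rfl, hT⟩
  apply ENNReal.ofReal_le_ofReal
  by_contra hcon
  push Not at hcon
  obtain ⟨t, ht0, htT, e, he0, hes, hepos, hele, hen⟩ := aux_choose_t n hn lam hlam hlameq T hcon
  set v := xivec n θ ξ with hv
  have hv0 : v 0 = 1 := aux_xivec_zero n hn θ ξ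
  have hind : ∀ a : Fin (n + 1) → ℚ, ∑ j, (a j : ℝ) * v j = 0 → a = 0 :=
    aux_indep n θ hθ hdeg ξ hξ
  obtain ⟨C, hC, Y, hY, hCY⟩ := aux_limsup v T hT
  obtain ⟨x, hx0, hL1, hmono, hanti, hunb, C', hC', hL⟩ := aux_seq hn v hv0 hind t ht0 C hC Y hY
    (by
      intro X hX
      obtain ⟨x, h1, h2, h3⟩ := hCY X hX
      refine ⟨x, h1, h2, h3.trans ?_⟩
      exact mul_le_mul_of_nonneg_left
        (Real.rpow_le_rpow_of_exponent_le (hY.trans hX) (by linarith)) hC.le)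
  obtain ⟨c, hc, hnorm⟩ := aux_norm n hn θ hθ hdeg ξ
  have hX1 : ∀ i, 1 ≤ |(x i 0 : ℝ)| := fun i => by exact_mod_cast Int.one_le_abs (hx0 i)
  have hL0 : ∀ i, 0 ≤ Lxi v (x i) := fun i => (abs_nonneg _).trans (aux_le_Lxi v hv0 (x i) 0)
  set c' : ℝ := min 1 (c / C' ^ (n - 1)) with hc'
  have hc'0 : 0 < c' := lt_min one_pos (by positivity)
  have hXr : ∀ i, c' * |(x (i + 1) 0 : ℝ)| ^ (((n : ℝ) - 1) * t) ≤ |(x i 0 : ℝ)| := by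
    intro i
    have hZ0 : 0 < |(x (i + 1) 0 : ℝ)| := by linarith [hX1 (i + 1)]
    set Z := |(x (i + 1) 0 : ℝ)| with hZ
    have h1 := hnorm (x i) (hx0 i) (hL1 i)
    have h2 : Lxi v (x i) ^ (n - 1) ≤ C' ^ (n - 1) * (Z ^ (((n : ℝ) - 1) * t))⁻¹ := by
      calc _ ≤ (C' * Z ^ (-t)) ^ (n - 1) := pow_le_pow_left₀ (hL0 i) (hL i) _
        _ = _ := by
          rw [mul_pow, ← Real.rpow_natCast (Z ^ (-t)), ← Real.rpow_mul hZ0.le,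
            ← Real.rpow_neg hZ0.le, Nat.cast_sub (by omega : 1 ≤ n)]
          congr 2
          push_cast; ring
    have h3 : c ≤ |(x i 0 : ℝ)| * (C' ^ (n - 1) * (Z ^ (((n : ℝ) - 1) * t))⁻¹) :=
      h1.trans (mul_le_mul_of_nonneg_left h2 (abs_nonneg _))
    have hZp : 0 < Z ^ (((n : ℝ) - 1) * t) := Real.rpow_pos_of_pos hZ0 _
    calc c' * Z ^ (((n : ℝ) - 1) * t) ≤ c / C' ^ (n - 1) * Z ^ (((n : ℝ) - 1) * t) :=
          mul_le_mul_of_nonneg_right (min_le_right _ _) hZp.le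
      _ ≤ (|(x i 0 : ℝ)| * (C' ^ (n - 1) * (Z ^ (((n : ℝ) - 1) * t))⁻¹)) / C' ^ (n - 1) *
          Z ^ (((n : ℝ) - 1) * t) := by gcongr
      _ = _ := by field_simp
  -- choose the starting index
  set F : ℝ := ((n + 1).factorial : ℝ) * (3 + ∑ j, |v j|) ^ (n + 1) with hF
  have hFpos : 0 < F := by
    have : 0 ≤ ∑ j, |v j| := Finset.sum_nonneg fun _ _ => abs_nonneg _
    positivity
  have hlim : Tendsto (fun X : ℝ => F * (C' / c') ^ n * X ^ (-(-e n))) atTop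
      (nhds (F * (C' / c') ^ n * 0)) :=
    (tendsto_rpow_neg_atTop (by linarith : 0 < -e n)).const_mul _
  rw [mul_zero] at hlim
  obtain ⟨B, hB⟩ := eventually_atTop.1 (hlim.eventually_lt_const one_pos)
  obtain ⟨k, hk⟩ := hunb B
  obtain ⟨l, hl1, hl2, hl3⟩ := aux_det_ineq v hv0 x hx0 hL1 hmono hanti k
    (fun S hS => aux_tail v hv0 hind x hL1 hmono hunb k S hS)
  have hgrow := aux_growth n (fun i => |(x i 0 : ℝ)|) (fun i => Lxi v (x i)) hX1 hmono t
    (((n : ℝ) - 1) * t) C' c' hC' hc'0 (min_le_left _ _) hL0 hL hXr e he0 hes hepos hele l hl2 n le_rfl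
  have hBn : B ≤ |(x (l n) 0 : ℝ)| := hk.le.trans (hmono (hl1 n le_rfl))
  have h1 := hB _ hBn
  rw [neg_neg] at h1
  have h2 := hl3.trans (mul_le_mul_of_nonneg_left hgrow hFpos.le)
  rw [← mul_assoc] at h2
  linarith
end

section
/- Let n ≥ 2 be an integer, let θ be a real algebraic number of degree n, and let ξ ∈ ℝ ∖ ℚ(θ). Then the point ξ⃗ = (1, θ, θ², …, θ^{n−1}, ξ) ∈ ℝ^{n+1} satisfies limsup_{X→∞} X^{λ_n} 𝓛_{ξ⃗}(X) > 0, where λ_n is the unique positive real solution of x + (n−1)x² + ⋯ + (n−1)^{n−1}xⁿ = 1. -/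
open Filter

lemma det_bound {N : ℕ} (B : Matrix (Fin N) (Fin N) ℝ) (r : Fin N → ℝ)
    (h : ∀ i j, |B i j| ≤ r i) : |B.det| ≤ (N.factorial : ℝ) * ∏ i, r i := by
  rw [Matrix.det_apply]
  calc _ ≤ ∑ σ : Equiv.Perm (Fin N), |Equiv.Perm.sign σ • ∏ i, B (σ i) i| :=
        Finset.abs_sum_le_sum_abs _ _
    _ ≤ ∑ σ : Equiv.Perm (Fin N), ∏ i, r i := by
        refine Finset.sum_le_sum fun σ _ => ?_
        have h1 : |Equiv.Perm.sign σ • ∏ i, B (σ i) i| = ∏ i, |B (σ i) i| := by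
          rcases Int.units_eq_one_or (Equiv.Perm.sign σ) with h | h <;> simp [h, Finset.abs_prod]
        rw [h1, ← Equiv.prod_comp σ r]
        exact Finset.prod_le_prod (fun _ _ => abs_nonneg _) (fun i _ => h _ _)
    _ = _ := by simp [Fintype.card_perm]

/-- unipotent row operations over `ℚ` -/
lemma det_rowops {N : ℕ} (v w u : Fin N → Fin N → ℚ) (t : Fin N → ℚ)
    (hu : ∀ m, u m ∈ Submodule.span ℚ (v '' {j | j < m}))
    (hw : ∀ m, w m = v m - t m • u m) : (Matrix.of w).det = (Matrix.of v).det := by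
  have : ∀ m, ∃ s : Fin N → ℚ, (∀ j, ¬ j < m → s j = 0) ∧ u m = ∑ j, s j • v j := by
    intro m
    have h := hu m
    rw [Finsupp.mem_span_image_iff_linearCombination] at h
    obtain ⟨l, hl, hl2⟩ := h
    refine ⟨l, fun j hj => ?_, ?_⟩
    · by_contra h0
      exact hj (hl (by simpa using h0))
    · rw [← hl2, Finsupp.linearCombination_apply, Finsupp.sum_fintype]
      simp
  choose s hs hs2 using this
  let T : Matrix (Fin N) (Fin N) ℚ := 1 - Matrix.of (fun m j => t m * s m j)
  have hT : T.det = 1 := by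
    rw [Matrix.det_of_isLowerTriangular]
    · refine Finset.prod_eq_one fun i _ => ?_
      simp [T, hs i i (lt_irrefl _)]
    · intro i j hij
      have hij : i < j := by simpa using hij
      simp [T, hij.ne, hs i j (not_lt.2 hij.le)]
  have : Matrix.of w = T * Matrix.of v := by
    ext m l
    simp [hw, hs2, T, sub_mul, Matrix.mul_apply, Matrix.one_apply, Finset.mul_sum, mul_assoc]
  rw [this, Matrix.det_mul, hT, one_mul]

lemma greedy {n : ℕ} (v : ℕ → Fin (n + 1) → ℚ) (hv0 : v 0 ≠ 0)
    (hspan : ∀ W : Submodule ℚ (Fin (n + 1) → ℚ), W < ⊤ → ∃ i, v i ∉ W) :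
    ∃ k : ℕ → ℕ, (∀ m < n, k m < k (m + 1)) ∧
      (∀ m < n, v (k (m + 1) - 1) ∈ Submodule.span ℚ ((fun j => v (k j)) '' Set.Iic m)) ∧
      LinearIndependent ℚ (fun i : Fin (n + 1) => v (k i)) := by
  classical
  let W : ℕ → Submodule ℚ (Fin (n + 1) → ℚ) := fun K => Submodule.span ℚ (v '' Set.Iic K)
  have hvW : ∀ i K, i ≤ K → v i ∈ W K := fun i K h =>
    Submodule.subset_span ⟨i, h, rfl⟩
  have hnext : ∀ K, ∃ K', W K < ⊤ → K < K' ∧ v K' ∉ W K ∧ ∀ i < K', v i ∈ W K := by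
    intro K
    by_cases h : W K < ⊤
    · have hex := hspan _ h
      refine ⟨Nat.find hex, fun _ => ⟨?_, Nat.find_spec hex, fun i hi => ?_⟩⟩
      · by_contra hc
        exact Nat.find_spec hex (hvW _ _ (not_lt.1 hc))
      · simpa using Nat.find_min hex hi
    · exact ⟨0, fun h' => absurd h' h⟩
  choose nx hnx using hnext
  let k : ℕ → ℕ := fun m => nx^[m] 0
  have hk : ∀ m, k (m + 1) = nx (k m) := fun m => Function.iterate_succ_apply' _ _ _
  let U : ℕ → Submodule ℚ (Fin (n + 1) → ℚ) :=
    fun m => Submodule.span ℚ ((fun j => v (k j)) '' Set.Iic m)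
  have hrange : ∀ m, (fun j => v (k j)) '' Set.Iic m = Set.range (fun j : Fin (m + 1) => v (k j)) := by
    intro m
    ext y; constructor
    · rintro ⟨j, hj, rfl⟩
      exact ⟨⟨j, Nat.lt_succ_of_le hj⟩, rfl⟩
    · rintro ⟨j, rfl⟩
      exact ⟨j, Nat.le_of_lt_succ j.2, rfl⟩
  have hUfin : ∀ m, Module.finrank ℚ (U m) ≤ m + 1 := by
    intro m
    have := hrange m
    have h := finrank_range_le_card (R := ℚ) (fun j : Fin (m + 1) => v (k j))
    simp only [Fintype.card_fin, Set.finrank] at h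
    show Module.finrank ℚ (Submodule.span ℚ ((fun j => v (k j)) '' Set.Iic m)) ≤ m + 1
    rw [this]; exact h
  have htop : ∀ m < n, W (k m) ≤ U m → W (k m) < ⊤ := by
    intro m hm h
    rw [lt_top_iff_ne_top]
    intro h'
    rw [h', top_le_iff] at h
    have := hUfin m
    rw [h, finrank_top] at this
    simp at this
    omega
  have hWU : ∀ m ≤ n, W (k m) ≤ U m := by
    intro m
    induction m with
    | zero =>
      intro _
      refine Submodule.span_mono ?_
      rintro _ ⟨i, hi, rfl⟩
      have : i = 0 := by simpa [k] using hi
      subst this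
      exact ⟨0, by simp, rfl⟩
    | succ m ih =>
      intro hm
      have h1 := ih (by omega)
      obtain ⟨h2, h3, h4⟩ := hnx _ (htop m (by omega) h1)
      rw [← hk] at h2 h3 h4
      have hUU : U m ≤ U (m + 1) := Submodule.span_mono
        (Set.image_mono (Set.Iic_subset_Iic.2 (Nat.le_succ m)))
      refine Submodule.span_le.2 ?_
      rintro _ ⟨i, hi, rfl⟩
      rcases lt_or_eq_of_le (show i ≤ k (m + 1) from hi) with h | h
      · exact hUU (h1 (h4 i h))
      · subst h
        exact Submodule.subset_span ⟨m + 1, by simp, rfl⟩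
  have key : ∀ m < n, k m < k (m + 1) ∧ v (k (m + 1)) ∉ W (k m) ∧
      ∀ i < k (m + 1), v i ∈ W (k m) := by
    intro m hm
    rw [hk]
    exact hnx _ (htop m hm (hWU m hm.le))
  have hdim : ∀ m ≤ n, m + Module.finrank ℚ (W (k 0)) ≤ Module.finrank ℚ (W (k m)) := by
    intro m
    induction m with
    | zero => intro _; simp
    | succ m ih =>
      intro hm
      have h1 := ih (by omega)
      obtain ⟨h2, h3, h4⟩ := key m (by omega)
      have : W (k m) < W (k (m + 1)) := by
        refine lt_of_le_of_ne (Submodule.span_mono (Set.image_mono (Set.Iic_subset_Iic.2 h2.le))) ?_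
        intro h
        exact h3 (h ▸ hvW _ _ le_rfl)
      have := Submodule.finrank_lt_finrank_of_lt this
      omega
  have h0 : 0 < Module.finrank ℚ (W (k 0)) := by
    rw [pos_iff_ne_zero]
    intro h
    rw [Submodule.finrank_eq_zero] at h
    have h1 := hvW 0 (k 0) (Nat.zero_le _)
    rw [h] at h1
    exact hv0 (by simpa using h1)
  have hWtop : W (k n) = ⊤ := by
    apply Submodule.eq_top_of_finrank_eq
    have h1 := hdim n le_rfl
    have h2 := Submodule.finrank_le (W (k n))
    simp only [Module.finrank_fin_fun] at h2 ⊢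
    omega
  refine ⟨k, fun m hm => (key m hm).1, fun m hm => ?_, ?_⟩
  · obtain ⟨h2, h3, h4⟩ := key m hm
    exact hWU m hm.le (h4 _ (by omega))
  · apply linearIndependent_of_top_le_span_of_card_eq_finrank
    · rw [← hrange, ← hWtop]
      exact hWU n le_rfl
    · simp

lemma liouville_core {n : ℕ} [NeZero n] {K : Type*} [Field K] [Algebra ℚ K] (ι : K →+* ℝ) (g : K)
    (b : Module.Basis (Fin n) ℚ K) (hb : ∀ i, b i = g ^ (i : ℕ)) :
    ∃ c : ℝ, 0 < c ∧ ∀ (y : Fin n → ℤ) (l : ℝ), y 0 ≠ 0 → l ≤ 1 →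
      (∀ k, |(y k : ℝ) - ι g ^ (k : ℕ) * y 0| ≤ l) → c ≤ l ^ (n - 1) * |(y 0 : ℝ)| := by
  classical
  let a : ℕ → Fin n → ℚ := fun s k => b.repr (g ^ s) k
  have ha : ∀ s, g ^ s = ∑ k, a s k • g ^ (k : ℕ) := by
    intro s
    conv_lhs => rw [← b.sum_repr (g ^ s)]
    simp [a, hb]
  have haR : ∀ s, (ι g) ^ s = ∑ k, (a s k : ℝ) * ι g ^ (k : ℕ) := by
    intro s
    rw [← map_pow, ha s, map_sum]
    refine Finset.sum_congr rfl fun k _ => ?_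
    rw [Algebra.smul_def, map_mul, map_pow, eq_ratCast, map_ratCast]
  -- common denominator
  obtain ⟨D, hD, hDa⟩ : ∃ D : ℕ, 0 < D ∧ ∀ i j k : Fin n, ∃ z : ℤ, (D : ℚ) * a (i + j) k = z := by
    refine ⟨∏ p : Fin n × Fin n × Fin n, (a (p.1 + p.2.1) p.2.2).den,
      Finset.prod_pos fun p _ => Rat.den_pos _, fun i j k => ?_⟩
    obtain ⟨e, he⟩ := Finset.dvd_prod_of_mem
      (fun p : Fin n × Fin n × Fin n => (a (p.1 + p.2.1) p.2.2).den) (Finset.mem_univ (i, j, k))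
    refine ⟨e * (a (i + j) k).num, ?_⟩
    rw [he]
    push_cast
    rw [mul_comm _ (e : ℚ), mul_assoc, mul_comm _ (a _ _), Rat.mul_den_eq_num]
  choose z hz using hDa
  let M : ℝ := ∑ i : Fin n, ∑ j : Fin n, ∑ k : Fin n, |(a (i + j) k : ℝ)|
  have hM : ∀ i j : Fin n, ∑ k : Fin n, |(a (i + j) k : ℝ)| ≤ M := by
    intro i j
    refine le_trans ?_ (Finset.single_le_sum (f := fun i : Fin n => ∑ j : Fin n, ∑ k : Fin n, |(a (i + j) k : ℝ)|) (fun i _ => by positivity) (Finset.mem_univ i))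
    exact (Finset.single_le_sum (f := fun j : Fin n => ∑ k : Fin n, |(a (i + j) k : ℝ)|) (fun i _ => by positivity) (Finset.mem_univ j))
  have hM0 : 0 ≤ M := by positivity
  let T : ℝ := ∑ i : Fin n, |ι g| ^ (i : ℕ)
  have hT : ∀ i : Fin n, |ι g| ^ (i : ℕ) ≤ T := fun i =>
    Finset.single_le_sum (f := fun i : Fin n => |ι g| ^ (i : ℕ)) (fun i _ => by positivity) (Finset.mem_univ i)
  have hT0 : 0 ≤ T := by positivity
  let C : ℝ := 1 + T + M + T * M
  have hC : 0 < C := by positivity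
  refine ⟨1 / (n.factorial * (D * C) ^ n), by positivity, ?_⟩
  intro y l hy hl1 hl
  have hl0 : 0 ≤ l := (abs_nonneg _).trans (hl 0)
  have hq : (1 : ℝ) ≤ |(y 0 : ℝ)| := by exact_mod_cast Int.one_le_abs hy
  let φ : K →ₗ[ℚ] ℚ := b.constr ℚ (fun k => (y k : ℚ))
  have hφ : ∀ k : Fin n, φ (g ^ (k : ℕ)) = y k := by
    intro k; rw [← hb]; exact b.constr_basis ℚ _ k
  have hφs : ∀ s, φ (g ^ s) = ∑ k, a s k * y k := by
    intro s
    rw [ha s, map_sum]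
    simp [hφ]
  let A : Matrix (Fin n) (Fin n) ℚ := Matrix.of fun i j => φ (g ^ ((i : ℕ) + j))
  have hA : A.det ≠ 0 := by
    intro h0
    obtain ⟨w, hw, hw2⟩ := Matrix.exists_mulVec_eq_zero_iff.2 h0
    let u : K := ∑ j, w j • b j
    have hu : u ≠ 0 := by
      intro h
      apply hw
      funext j
      exact Fintype.linearIndependent_iff.1 b.linearIndependent w h j
    have h1 : φ ∘ₗ (LinearMap.mulRight ℚ u) = 0 := by
      apply b.ext
      intro i
      have := congrFun hw2 i
      simp only [Matrix.mulVec, dotProduct, A, Matrix.of_apply, Pi.zero_apply] at this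
      simp only [LinearMap.comp_apply, LinearMap.mulRight_apply, LinearMap.zero_apply, u, hb]
      rw [Finset.mul_sum, map_sum, ← this]
      refine Finset.sum_congr rfl fun j _ => ?_
      rw [mul_smul_comm, map_smul, pow_add, smul_eq_mul, mul_comm]
    have h2 := LinearMap.congr_fun h1 (u⁻¹)
    simp only [LinearMap.comp_apply, LinearMap.mulRight_apply, LinearMap.zero_apply, inv_mul_cancel₀ hu] at h2
    have h3 := hφ 0
    simp only [Fin.val_zero, pow_zero, h2] at h3
    exact hy (by exact_mod_cast h3.symm)
  -- integer matrix
  let Z : Matrix (Fin n) (Fin n) ℤ := Matrix.of fun i j => ∑ k, z i j k * y k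
  have hZ : Z.map (Int.castRingHom ℚ) = (D : ℚ) • A := by
    ext i j
    simp [Z, A, hφs, Finset.mul_sum, ← hz, mul_assoc]
  have hZdet : (Z.det : ℚ) = (D : ℚ) ^ n * A.det := by
    have := RingHom.map_det (Int.castRingHom ℚ) Z
    rw [RingHom.mapMatrix_apply, hZ, Matrix.det_smul] at this
    simpa using this
  have hZ0 : Z.det ≠ 0 := by
    intro h
    rw [h] at hZdet
    have : (D : ℚ) ^ n * A.det ≠ 0 := mul_ne_zero (by positivity) hA
    exact this (by simpa using hZdet.symm)
  let R : Matrix (Fin n) (Fin n) ℝ := A.map (Rat.castHom ℝ)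
  have hR : (A.det : ℝ) = R.det := by
    have := RingHom.map_det (Rat.castHom ℝ) A
    exact this
  have hRe : ∀ i j, |R i j - ι g ^ ((i : ℕ) + j) * y 0| ≤ M * l := by
    intro i j
    have : R i j - ι g ^ ((i : ℕ) + j) * y 0
        = ∑ k, (a (i + j) k : ℝ) * ((y k : ℝ) - ι g ^ (k : ℕ) * y 0) := by
      rw [haR (i + j)]
      simp [R, A, hφs, mul_sub, Finset.sum_mul, mul_assoc]
    rw [this]
    calc _ ≤ ∑ k, |(a (i + j) k : ℝ) * ((y k : ℝ) - ι g ^ (k : ℕ) * y 0)| :=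
          Finset.abs_sum_le_sum_abs _ _
      _ ≤ ∑ k, |(a (i + j) k : ℝ)| * l := by
          refine Finset.sum_le_sum fun k _ => ?_
          rw [abs_mul]; exact mul_le_mul_of_nonneg_left (hl k) (abs_nonneg _)
      _ ≤ _ := by rw [← Finset.sum_mul]; exact mul_le_mul_of_nonneg_right (hM i j) hl0
  let co : Fin n → ℝ := fun i => if i = 0 then 0 else - ι g ^ (i : ℕ)
  let S : Matrix (Fin n) (Fin n) ℝ := Matrix.of fun i j => R i j + co i * R 0 j
  have hS : S.det = R.det :=
    Matrix.det_eq_of_forall_row_eq_smul_add_const co 0 (by simp [co]) (fun i j => rfl)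
  let r : Fin n → ℝ := fun i => C * (if i = 0 then |(y 0 : ℝ)| else l)
  have hSr : ∀ i j, |S i j| ≤ r i := by
    intro i j
    by_cases hi : i = 0
    · subst hi
      simp only [S, co, r, Matrix.of_apply, if_true, zero_mul, add_zero]
      have h1 := hRe 0 j
      have h2 : |ι g ^ (((0 : Fin n) : ℕ) + (j : ℕ)) * (y 0 : ℝ)| ≤ T * |(y 0 : ℝ)| := by
        rw [abs_mul, abs_pow]
        simp only [Fin.val_zero, zero_add]
        exact mul_le_mul_of_nonneg_right (hT j) (abs_nonneg _)
      have h3 := abs_sub_abs_le_abs_sub (R 0 j) (ι g ^ (((0 : Fin n) : ℕ) + (j : ℕ)) * (y 0 : ℝ))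
      have h4 : M * l ≤ M * |(y 0 : ℝ)| := mul_le_mul_of_nonneg_left (hl1.trans hq) hM0
      have h5 : 0 ≤ T * M * |(y 0 : ℝ)| := by positivity
      simp only [C]
      nlinarith
    · simp only [S, co, r, Matrix.of_apply, if_neg hi]
      have h1 := hRe i j
      have h2 := hRe 0 j
      have : R i j + -ι g ^ (i : ℕ) * R 0 j = (R i j - ι g ^ ((i : ℕ) + j) * y 0)
          - ι g ^ (i : ℕ) * (R 0 j - ι g ^ (((0 : Fin n) : ℕ) + (j : ℕ)) * y 0) := by
        simp only [Fin.val_zero, zero_add, pow_add]; ring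
      rw [this]
      refine (abs_sub _ _).trans ?_
      rw [abs_mul, abs_pow]
      have h3 : |ι g| ^ (i : ℕ) * |R 0 j - ι g ^ (((0 : Fin n) : ℕ) + (j : ℕ)) * y 0| ≤ T * (M * l) :=
        mul_le_mul (hT i) h2 (abs_nonneg _) hT0
      have h5 : 0 ≤ T * l := by positivity
      simp only [C]
      nlinarith
  have hdb := det_bound S r hSr
  have hprod : ∏ i, r i = C ^ n * (|(y 0 : ℝ)| * l ^ (n - 1)) := by
    simp only [r, Finset.prod_mul_distrib, Finset.prod_const, Finset.card_univ, Fintype.card_fin]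
    congr 1
    rw [Finset.prod_ite]
    simp [Finset.filter_eq', Finset.filter_ne', Finset.card_erase_of_mem]
  rw [hS, ← hR, hprod] at hdb
  have h1 : (1 : ℝ) ≤ |(Z.det : ℝ)| := by exact_mod_cast Int.one_le_abs hZ0
  have h2 : (Z.det : ℝ) = (D : ℝ) ^ n * (A.det : ℝ) := by
    have := congrArg (Rat.cast : ℚ → ℝ) hZdet
    rw [Rat.cast_mul, Rat.cast_pow, Rat.cast_natCast, Rat.cast_intCast] at this
    exact this
  rw [h2, abs_mul, abs_of_pos (by positivity : (0 : ℝ) < (D : ℝ) ^ n)] at h1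
  rw [div_le_iff₀ (by positivity)]
  have h3 := mul_le_mul_of_nonneg_left hdb (by positivity : (0 : ℝ) ≤ (D : ℝ) ^ n)
  calc (1 : ℝ) ≤ _ := h1
    _ ≤ _ := h3
    _ = _ := by rw [mul_pow]; ring

lemma liouville (n : ℕ) (hn : 2 ≤ n) (θ ξ : ℝ)
    (hθ : IsAlgebraic ℚ θ) (hdeg : (minpoly ℚ θ).natDegree = n) :
    ∃ c : ℝ, 0 < c ∧ ∀ (x : Fin (n + 1) → ℤ) (l : ℝ), x 0 ≠ 0 → l ≤ 1 →
      (∀ k, |(x k : ℝ) - xivec n θ ξ k * x 0| ≤ l) → c ≤ l ^ (n - 1) * |(x 0 : ℝ)| := by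
  have : NeZero n := ⟨by omega⟩
  let pb := IntermediateField.adjoin.powerBasis (hθ.isIntegral)
  have hd : pb.dim = n := by rw [← hdeg]; exact IntermediateField.adjoin.powerBasis_dim _
  let b := pb.basis.reindex (finCongr hd)
  obtain ⟨c, hc, h⟩ := liouville_core (algebraMap (IntermediateField.adjoin ℚ {θ}) ℝ) pb.gen b
    (by intro i; simp [b])
  refine ⟨c, hc, fun x l hx hl hxl => ?_⟩
  refine h (fun k => x k.castSucc) l hx hl fun k => ?_
  have := hxl k.castSucc
  have hg : algebraMap (IntermediateField.adjoin ℚ {θ}) ℝ pb.gen = θ := by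
    simp [pb, IntermediateField.adjoin.powerBasis_gen]
  rw [hg]
  simpa [xivec] using this

lemma xivec_indep (n : ℕ) (hn : 2 ≤ n) (θ ξ : ℝ)
    (hdeg : (minpoly ℚ θ).natDegree = n)
    (hξ : ξ ∉ IntermediateField.adjoin ℚ ({θ} : Set ℝ)) (a : Fin (n + 1) → ℚ)
    (h : ∑ k, (a k : ℝ) * xivec n θ ξ k = 0) : a = 0 := by
  rw [Fin.sum_univ_castSucc] at h
  have hx1 : xivec n θ ξ (Fin.last n) = ξ := by simp [xivec]
  have hx2 : ∀ k : Fin n, xivec n θ ξ k.castSucc = θ ^ (k : ℕ) := by simp [xivec]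
  simp only [hx1, hx2] at h
  have hlast : a (Fin.last n) = 0 := by
    by_contra h0
    apply hξ
    have h0' : (a (Fin.last n) : ℝ) ≠ 0 := by exact_mod_cast h0
    have : ξ = -(∑ k : Fin n, (a k.castSucc : ℝ) * θ ^ (k : ℕ)) / (a (Fin.last n) : ℝ) := by
      rw [eq_div_iff h0']; linarith
    rw [this]
    have hθm : θ ∈ IntermediateField.adjoin ℚ ({θ} : Set ℝ) :=
      IntermediateField.mem_adjoin_simple_self ℚ θ
    have hqm : ∀ q : ℚ, (q : ℝ) ∈ IntermediateField.adjoin ℚ ({θ} : Set ℝ) := fun q =>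
      (IntermediateField.adjoin ℚ ({θ} : Set ℝ)).algebraMap_mem q
    exact div_mem (neg_mem (sum_mem fun k _ => mul_mem (hqm _) (pow_mem hθm _))) (hqm _)
  rw [hlast] at h
  simp only [Rat.cast_zero, zero_mul, add_zero] at h
  subst hdeg
  have hli := Fintype.linearIndependent_iff.1 (linearIndependent_pow (K := ℚ) θ)
    (fun k => a k.castSucc) (by simpa [Rat.smul_def] using h)
  funext k
  refine Fin.lastCases hlast (fun i => hli i) k

lemma exists_seq {n : ℕ} (hn : 2 ≤ n) (z : Fin (n + 1) → ℝ)
    (ℓ : (Fin (n + 1) → ℤ) → ℝ) (hℓ : ∀ x k, |(x k : ℝ) - z k * x 0| ≤ ℓ x)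
    (c' : ℝ) (hc' : 0 < c')
    (hliou : ∀ x, x 0 ≠ 0 → ℓ x ≤ 1 → c' ≤ ℓ x ^ (n - 1) * |(x 0 : ℝ)|)
    (lam : ℝ) (hlam : 0 < lam)
    (H : ∀ c : ℝ, 0 < c → ∃ X0 : ℝ, ∀ X ≥ X0, ∃ x : Fin (n + 1) → ℤ, x ≠ 0 ∧
      |(x 0 : ℝ)| ≤ X ∧ ℓ x < c * X ^ (-lam)) (c1 : ℝ) (hc1 : 0 < c1) :
    ∃ v : ℕ → Fin (n + 1) → ℤ, (∀ i, v i 0 ≠ 0) ∧ (∀ i, ℓ (v i) ≤ 1) ∧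
      (∀ i, ℓ (v (i + 1)) ≤ ℓ (v i)) ∧ (∀ i, |(v i 0 : ℝ)| ≤ |(v (i + 1) 0 : ℝ)|) ∧
      (∀ i, ℓ (v i) ≤ c1 * |(v (i + 1) 0 : ℝ)| ^ (-lam)) ∧
      (∀ ε > 0, ∃ i, ℓ (v i) < ε) := by
  classical
  have hℓ0 : ∀ x, 0 ≤ ℓ x := fun x => (abs_nonneg _).trans (hℓ x 0)
  have hx0 : ∀ x, x ≠ 0 → ℓ x < 1 → x 0 ≠ 0 := by
    intro x hx hl h0
    obtain ⟨k, hk⟩ := Function.ne_iff.1 hx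
    have h1 := hℓ x k
    rw [h0] at h1
    have h2 : (1 : ℝ) ≤ |(x k : ℝ)| := by exact_mod_cast Int.one_le_abs hk
    simp at h1
    linarith
  have hpos : ∀ x, x ≠ 0 → 0 < ℓ x := by
    intro x hx
    by_contra h
    have h0 : ℓ x = 0 := le_antisymm (not_lt.1 h) (hℓ0 x)
    have h1 := hliou x (hx0 x hx (by linarith)) (by linarith)
    rw [h0, zero_pow (by omega), zero_mul] at h1
    linarith
  have hsmall : ∀ ε > 0, ∃ x, x ≠ 0 ∧ ℓ x < ε := by
    intro ε hε
    obtain ⟨X0, hX0⟩ := H ε hε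
    obtain ⟨x, hx, -, h⟩ := hX0 (max X0 1) (le_max_left _ _)
    refine ⟨x, hx, h.trans_le ?_⟩
    have : (max X0 1) ^ (-lam) ≤ 1 :=
      Real.rpow_le_one_of_one_le_of_nonpos (le_max_right _ _) (by linarith)
    nlinarith
  obtain ⟨X0, hX0⟩ := H (c1 * (1 / 2) ^ lam) (by positivity)
  let X1 : ℝ := max X0 1
  have hX1 : 0 < X1 := lt_of_lt_of_le one_pos (le_max_right _ _)
  let δ : ℝ := min (1 / 2) (c' / (2 * X1))
  have hδ : 0 < δ := by positivity
  have hδ1 : δ ≤ 1 / 2 := min_le_left _ _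
  have hbig : ∀ x, x ≠ 0 → ℓ x < δ → 2 * X1 ≤ |(x 0 : ℝ)| := by
    intro x hx hl
    have h1 := hliou x (hx0 x hx (by linarith)) (by linarith)
    have h2 : ℓ x ^ (n - 1) ≤ ℓ x :=
      pow_le_of_le_one (hℓ0 x) (by linarith) (by omega)
    have h3 : c' ≤ c' / (2 * X1) * |(x 0 : ℝ)| :=
      h1.trans (mul_le_mul_of_nonneg_right (h2.trans (hl.le.trans (min_le_right _ _))) (abs_nonneg _))
    rw [div_mul_eq_mul_div, le_div_iff₀ (by positivity)] at h3
    exact le_of_mul_le_mul_left h3 hc'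
  have hnext : ∀ x : {x : Fin (n + 1) → ℤ // x ≠ 0 ∧ ℓ x < δ},
      ∃ y : {x : Fin (n + 1) → ℤ // x ≠ 0 ∧ ℓ x < δ}, ℓ y.1 < ℓ x.1 ∧
        ∀ w : Fin (n + 1) → ℤ, w ≠ 0 → ℓ w < ℓ x.1 → (y.1 0).natAbs ≤ (w 0).natAbs := by
    rintro ⟨x, hx, hxδ⟩
    have hex : ∃ q : ℕ, ∃ w : Fin (n + 1) → ℤ, w ≠ 0 ∧ ℓ w < ℓ x ∧ (w 0).natAbs = q := by
      obtain ⟨w, hw, hw2⟩ := hsmall _ (hpos x hx)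
      exact ⟨_, w, hw, hw2, rfl⟩
    obtain ⟨y, hy, hy2, hy3⟩ := Nat.find_spec hex
    refine ⟨⟨y, hy, hy2.trans hxδ⟩, hy2, fun w hw hw2 => ?_⟩
    simp only
    rw [hy3]
    exact Nat.find_min' hex ⟨w, hw, hw2, rfl⟩
  choose nx hnx1 hnx2 using hnext
  obtain ⟨s, hs, hs2⟩ := hsmall δ hδ
  let u : ℕ → {x : Fin (n + 1) → ℤ // x ≠ 0 ∧ ℓ x < δ} := fun i => nx^[i] ⟨s, hs, hs2⟩
  have hu : ∀ i, u (i + 1) = nx (u i) := fun i => Function.iterate_succ_apply' _ _ _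
  have hu1 : ∀ i, ℓ (u (i + 1)).1 < ℓ (u i).1 := fun i => by rw [hu]; exact hnx1 _
  have hu2 : ∀ i, ∀ w : Fin (n + 1) → ℤ, w ≠ 0 → ℓ w < ℓ (u i).1 →
      |((u (i + 1)).1 0 : ℝ)| ≤ |(w 0 : ℝ)| := by
    intro i w hw hw2
    have h := hnx2 (u i) w hw hw2
    rw [← hu] at h
    have : (((u (i + 1)).1 0).natAbs : ℝ) ≤ ((w 0).natAbs : ℝ) := by exact_mod_cast h
    simpa [Nat.cast_natAbs] using this
  have hanti : StrictAnti (fun i => ℓ (u i).1) := strictAnti_nat_of_succ_lt hu1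
  refine ⟨fun i => (u (i + 1)).1, fun i => hx0 _ (u (i + 1)).2.1 (by linarith [(u (i + 1)).2.2]),
    fun i => by linarith [(u (i + 1)).2.2], fun i => (hu1 _).le,
    fun i => hu2 i _ (u (i + 1 + 1)).2.1 ((hu1 _).trans (hu1 _)), fun i => ?_, fun ε hε => ?_⟩
  · have hb := hbig _ (u (i + 1 + 1)).2.1 (u (i + 1 + 1)).2.2
    set Q : ℝ := |((u (i + 1 + 1)).1 0 : ℝ)| with hQ
    have hQ0 : 0 < Q := by linarith
    obtain ⟨x, hx, hx1, hx2⟩ := hX0 (Q * (1 / 2)) (by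
      have : X0 ≤ X1 := le_max_left _ _
      linarith)
    have h1 : ℓ (u (i + 1)).1 ≤ ℓ x := by
      by_contra hc
      have := hu2 (i + 1) x hx (not_le.1 hc)
      linarith
    refine h1.trans (hx2.le.trans (le_of_eq ?_))
    rw [Real.mul_rpow hQ0.le (by norm_num), mul_assoc]
    congr 1
    rw [mul_comm, mul_assoc, ← Real.rpow_add (by norm_num)]
    simp
  · by_contra hcon
    push Not at hcon
    obtain ⟨y, hy, hy2⟩ := hsmall ε hε
    have h1 : ∀ i, |((u (i + 1 + 1)).1 0 : ℝ)| ≤ |(y 0 : ℝ)| := fun i =>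
      hu2 (i + 1) y hy (hy2.trans_le (hcon i))
    let B : Fin (n + 1) → ℤ := fun k => ⌈|z k| * |(y 0 : ℝ)| + 1⌉
    have h2 : ∀ i, (u (i + 1 + 1)).1 ∈ Set.Icc (-B) B := by
      intro i
      have : ∀ k, |((u (i + 1 + 1)).1 k : ℝ)| ≤ B k := by
        intro k
        have h3 := hℓ (u (i + 1 + 1)).1 k
        have h4 := (u (i + 1 + 1)).2.2
        have h5 := abs_sub_abs_le_abs_sub ((u (i + 1 + 1)).1 k : ℝ) (z k * (u (i + 1 + 1)).1 0)
        rw [abs_mul] at h5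
        have h6 := mul_le_mul_of_nonneg_left (h1 i) (abs_nonneg (z k))
        have h7 : |z k| * |(y 0 : ℝ)| + 1 ≤ B k := Int.le_ceil _
        linarith
      have h' : ∀ k, |(u (i + 1 + 1)).1 k| ≤ B k := fun k => by exact_mod_cast this k
      exact ⟨fun k => (abs_le.1 (h' k)).1, fun k => (abs_le.1 (h' k)).2⟩
    have hfin : (Set.Icc (-B) B).Finite := Set.finite_Icc _ _
    have hinj : Function.Injective (fun i => (u (i + 1 + 1)).1) := by
      intro i j hij
      have := hanti.injective (congrArg ℓ hij : ℓ (u (i + 1 + 1)).1 = ℓ (u (j + 1 + 1)).1)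
      omega
    exact Set.infinite_of_injective_forall_mem hinj h2 hfin

lemma main_contra {n : ℕ} (hn : 2 ≤ n) (z : Fin (n + 1) → ℝ) 
    (hind : ∀ a : Fin (n + 1) → ℚ, ∑ k, (a k : ℝ) * z k = 0 → a = 0)
    (ℓ : (Fin (n + 1) → ℤ) → ℝ) (hℓ : ∀ x k, |(x k : ℝ) - z k * x 0| ≤ ℓ x)
    (c' : ℝ) (hc' : 0 < c')
    (hliou : ∀ x, x 0 ≠ 0 → ℓ x ≤ 1 → c' ≤ ℓ x ^ (n - 1) * |(x 0 : ℝ)|)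
    (lam : ℝ) (hlam : 0 < lam)
    (hlameq : ∑ k ∈ Finset.Icc 1 n, ((n : ℝ) - 1) ^ (k - 1) * lam ^ k = 1)
    (H : ∀ c : ℝ, 0 < c → ∃ X0 : ℝ, ∀ X ≥ X0, ∃ x : Fin (n + 1) → ℤ, x ≠ 0 ∧
      |(x 0 : ℝ)| ≤ X ∧ ℓ x < c * X ^ (-lam)) : False := by
  have hℓ0 : ∀ x, 0 ≤ ℓ x := fun x => (abs_nonneg _).trans (hℓ x 0)
  -- constants
  let C : ℝ := ∑ k, |z k| + 1
  have hC : 0 < C := by positivity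
  let G : ℝ := (n + 1).factorial * (C * 2 ^ n)
  have hG : 0 < G := by positivity
  obtain ⟨c1, hc1, hc1a, hc1b, hc1c⟩ : ∃ c1 : ℝ, 0 < c1 ∧ c1 ≤ 1 ∧ c1 ≤ c' ∧ c1 < 1 / G :=
    ⟨min (min 1 c') (1 / (2 * G)), by positivity, (min_le_left _ _).trans (min_le_left _ _),
      (min_le_left _ _).trans (min_le_right _ _), (min_le_right _ _).trans_lt (by
        apply one_div_lt_one_div_of_lt hG; linarith)⟩
  obtain ⟨v, hv0, hv1, hanti, hmono, hle, hsmall⟩ :=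
    exists_seq hn z ℓ hℓ c' hc' hliou lam hlam H c1 hc1
  let q : ℕ → ℝ := fun i => |(v i 0 : ℝ)|
  have hq1 : ∀ i, 1 ≤ q i := fun i => by
    show (1 : ℝ) ≤ |(v i 0 : ℝ)|
    exact_mod_cast Int.one_le_abs (hv0 i)
  have hqm : Monotone q := monotone_nat_of_le_succ hmono
  let a : ℝ := ((n : ℝ) - 1) * lam
  have hn' : (2 : ℝ) ≤ n := by exact_mod_cast hn
  have ha0 : 0 ≤ a := mul_nonneg (by linarith) hlam.le
  -- lower bound for q
  have hqa : ∀ i, q (i + 1) ^ a ≤ q i := by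
    intro i
    have h1 := hliou (v i) (hv0 i) (hv1 i)
    have hp : 0 < q (i + 1) := one_pos.trans_le (hq1 _)
    have h2 : ℓ (v i) ^ (n - 1) ≤ (c1 * q (i + 1) ^ (-lam)) ^ (n - 1) :=
      pow_le_pow_left₀ (hℓ0 _) (hle i) _
    have h3 : (c1 * q (i + 1) ^ (-lam)) ^ (n - 1) = c1 ^ (n - 1) * (q (i + 1) ^ a)⁻¹ := by
      rw [mul_pow, ← Real.rpow_natCast (q (i + 1) ^ (-lam)), ← Real.rpow_mul hp.le,
        ← Real.rpow_neg hp.le]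
      congr 2
      rw [Nat.cast_sub (by omega)]
      simp only [a]; push_cast; ring
    have h4 : c1 ^ (n - 1) ≤ c' := (pow_le_of_le_one hc1.le hc1a (by omega)).trans hc1b
    have hpa : 0 < q (i + 1) ^ a := Real.rpow_pos_of_pos hp _
    have h5 : c' ≤ c' * (q (i + 1) ^ a)⁻¹ * q i := by
      refine h1.trans (mul_le_mul_of_nonneg_right ?_ (abs_nonneg _))
      rw [h3] at h2
      exact h2.trans (mul_le_mul_of_nonneg_right h4 (by positivity))
    have h6 : 1 ≤ (q (i + 1) ^ a)⁻¹ * q i := by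
      rw [mul_assoc] at h5
      nlinarith
    rw [inv_mul_eq_div, le_div_iff₀ hpa] at h6
    linarith
  -- spanning
  let vq : ℕ → Fin (n + 1) → ℚ := fun i k => (v i k : ℚ)
  have hspan : ∀ W : Submodule ℚ (Fin (n + 1) → ℚ), W < ⊤ → ∃ i, vq i ∉ W := by
    intro W hW
    by_contra hcon
    push Not at hcon
    obtain ⟨f, hf, hfW⟩ := Submodule.exists_le_ker_of_lt_top W hW
    let b : Fin (n + 1) → ℚ := fun k => f (fun j => if k = j then 1 else 0)
    have hfb : ∀ x, f x = ∑ k, x k * b k := fun x => LinearMap.pi_apply_eq_sum_univ f x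
    have hb0 : b ≠ 0 := by
      intro h
      apply hf
      refine LinearMap.ext fun x => ?_
      rw [hfb, h]
      simp
    let S : ℝ := ∑ k, (b k : ℝ) * z k
    have hS : S ≠ 0 := fun h => hb0 (hind b h)
    let E : ℝ := ∑ k, |(b k : ℝ)| + 1
    have hE : 0 < E := by positivity
    obtain ⟨i, hi⟩ := hsmall (|S| / E) (by positivity)
    have h0 : ∑ k, (v i k : ℝ) * (b k : ℝ) = 0 := by
      have h := hfW (hcon i)
      rw [LinearMap.mem_ker, hfb] at h
      have := congrArg (Rat.cast : ℚ → ℝ) h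
      push_cast [vq] at this
      exact this
    have h1 : S * v i 0 = - ∑ k, (b k : ℝ) * ((v i k : ℝ) - z k * v i 0) := by
      simp only [mul_sub, Finset.sum_sub_distrib, S, Finset.sum_mul]
      have : ∑ k, (b k : ℝ) * (v i k : ℝ) = 0 := by rw [← h0]; simp only [mul_comm]
      rw [this]; simp [mul_assoc]
    have h2 : |S| * q i ≤ (E - 1) * ℓ (v i) := by
      rw [← abs_mul, h1, abs_neg]
      refine (Finset.abs_sum_le_sum_abs _ _).trans ?_
      simp only [E, add_sub_cancel_right, Finset.sum_mul, abs_mul]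
      exact Finset.sum_le_sum fun k _ => mul_le_mul_of_nonneg_left (hℓ _ k) (abs_nonneg _)
    rw [lt_div_iff₀ hE] at hi
    have h3 : |S| ≤ |S| * q i := le_mul_of_one_le_right (abs_nonneg _) (hq1 i)
    have := hℓ0 (v i)
    nlinarith
  obtain ⟨k, hk1, hk2, hk3⟩ := greedy vq (fun h => hv0 0 (by
    have := congrFun h 0
    simpa [vq] using this)) hspan
  -- the determinant
  let t : ℕ → ℝ := fun m => q (k (m + 1)) / q (k (m + 1) - 1) * ℓ (v (k (m + 1) - 1))
  have hdet : 1 ≤ ((n + 1).factorial : ℝ) * ((C * q (k 0)) * ∏ m ∈ Finset.range n, (2 * t m)) := by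
    let u : Fin (n + 1) → Fin (n + 1) → ℚ := Fin.cases 0 (fun m => vq (k (m + 1) - 1))
    let tt : Fin (n + 1) → ℚ :=
      Fin.cases 0 (fun m => (v (k (m + 1)) 0 : ℚ) / (v (k (m + 1) - 1) 0 : ℚ))
    let w : Fin (n + 1) → Fin (n + 1) → ℚ := fun m => vq (k m) - tt m • u m
    have hu : ∀ m : Fin (n + 1), u m ∈
        Submodule.span ℚ ((fun i : Fin (n + 1) => vq (k i)) '' {j | j < m}) := by
      intro m
      refine Fin.cases (by simp [u]) (fun m => ?_) m
      refine Submodule.span_mono ?_ (hk2 m m.2)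
      rintro _ ⟨j, hj, rfl⟩
      have hj : j ≤ m := hj
      refine ⟨⟨j, by omega⟩, ?_, rfl⟩
      exact Fin.lt_def.2 (Nat.lt_succ_of_le hj)
    have hdw := det_rowops (fun i : Fin (n + 1) => vq (k i)) w u tt hu (fun m => rfl)
    let Z : Matrix (Fin (n + 1)) (Fin (n + 1)) ℤ := Matrix.of fun i j => v (k i) j
    have hZ : (Z.det : ℚ) = (Matrix.of (fun i : Fin (n + 1) => vq (k i))).det :=
      RingHom.map_det (Int.castRingHom ℚ) Z
    have hZ0 : Z.det ≠ 0 := by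
      intro h
      have h1 : IsUnit (Matrix.of (fun i : Fin (n + 1) => vq (k i))) :=
        Matrix.linearIndependent_rows_iff_isUnit.1 hk3
      rw [Matrix.isUnit_iff_isUnit_det, ← hZ, h] at h1
      simp at h1
    have hZ1 : (1 : ℝ) ≤ |(Z.det : ℝ)| := by exact_mod_cast Int.one_le_abs hZ0
    let R : Matrix (Fin (n + 1)) (Fin (n + 1)) ℝ := Matrix.of fun i j => (w i j : ℝ)
    have hR : (Z.det : ℝ) = R.det := by
      have h1 : ((Matrix.of w).det : ℝ) = R.det := RingHom.map_det (Rat.castHom ℝ) (Matrix.of w)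
      rw [← h1, hdw, ← hZ, Rat.cast_intCast]
    let r : Fin (n + 1) → ℝ := Fin.cases (C * q (k 0)) (fun m => 2 * t m)
    have hr : ∀ i j, |R i j| ≤ r i := by
      intro i j
      refine Fin.cases ?_ (fun m => ?_) i
      · have h1 : R 0 j = v (k 0) j := by simp [R, w, vq, tt]
        have h2 : r 0 = C * q (k 0) := rfl
        rw [h1, h2]
        have h3 := hℓ (v (k 0)) j
        have h4 := abs_sub_abs_le_abs_sub (v (k 0) j : ℝ) (z j * v (k 0) 0)
        rw [abs_mul] at h4
        have h5 : |z j| ≤ C - 1 := by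
          simp only [C, add_sub_cancel_right]
          exact Finset.single_le_sum (f := fun k => |z k|) (fun _ _ => abs_nonneg _)
            (Finset.mem_univ j)
        have h6 : |z j| * |(v (k 0) 0 : ℝ)| ≤ (C - 1) * q (k 0) :=
          mul_le_mul_of_nonneg_right h5 (abs_nonneg _)
        have h7 := hv1 (k 0)
        have h8 := hq1 (k 0)
        linarith
      · have hkm := hk1 m m.2
        obtain ⟨p, hp⟩ : ∃ p, k (m + 1) = p + 1 := ⟨k (m + 1) - 1, by omega⟩
        have h1 : R m.succ j = v (p + 1) j - (v (p + 1) 0 : ℝ) / (v p 0) * v p j := by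
          simp [R, w, vq, tt, u, hp]
        have h2 : r m.succ = 2 * (q (p + 1) / q p * ℓ (v p)) := by
          simp only [r, Fin.cases_succ, t, hp, Nat.add_sub_cancel]
        have hvp : (v p 0 : ℝ) ≠ 0 := by exact_mod_cast hv0 p
        have h3 : R m.succ j = ((v (p + 1) j : ℝ) - z j * v (p + 1) 0)
            - (v (p + 1) 0 : ℝ) / (v p 0) * ((v p j : ℝ) - z j * v p 0) := by
          rw [h1]; field_simp; ring
        rw [h2, h3]
        refine (abs_sub _ _).trans ?_
        rw [abs_mul, abs_div]
        have hqp : 0 < q p := one_pos.trans_le (hq1 p)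
        have h4 : q (p + 1) / q p * |(v p j : ℝ) - z j * v p 0| ≤ q (p + 1) / q p * ℓ (v p) :=
          mul_le_mul_of_nonneg_left (hℓ _ _) (by have := hq1 (p + 1); positivity)
        have h5 : 1 ≤ q (p + 1) / q p := by rw [le_div_iff₀ hqp, one_mul]; exact hmono p
        have h6 := (hℓ (v (p + 1)) j).trans (hanti p)
        have h7 : ℓ (v p) ≤ q (p + 1) / q p * ℓ (v p) := le_mul_of_one_le_left (hℓ0 _) h5
        change _ + q (p + 1) / q p * _ ≤ _
        linarith
    have hb := det_bound R r hr
    rw [Fin.prod_univ_succ, ← hR] at hb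
    refine hZ1.trans (hb.trans (le_of_eq ?_))
    rw [Finset.prod_range]
    rfl
  -- exponents
  let e : ℕ → ℝ := fun m => 1 - lam * ∑ i ∈ Finset.range m, a ^ i
  have hen : e n = 0 := by
    have : lam * ∑ i ∈ Finset.range n, a ^ i = 1 := by
      have hI : Finset.Icc 1 n = Finset.Ico 1 (n + 1) := by
        ext i; simp
      rw [← hlameq, hI, Finset.sum_Ico_eq_sum_range, Finset.mul_sum, Nat.add_sub_cancel]
      refine Finset.sum_congr rfl fun i _ => ?_
      rw [Nat.add_sub_cancel_left]
      simp only [a, mul_pow]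
      ring
    simp [e, this]
  have he0 : ∀ m ≤ n, 0 ≤ e m := by
    intro m hm
    rw [← hen]
    have : ∑ i ∈ Finset.range m, a ^ i ≤ ∑ i ∈ Finset.range n, a ^ i :=
      Finset.sum_le_sum_of_subset_of_nonneg (Finset.range_mono hm) fun _ _ _ => by positivity
    have := mul_le_mul_of_nonneg_left this hlam.le
    simp only [e]; linarith
  have he1 : ∀ m, e m ≤ 1 := by
    intro m
    have : 0 ≤ lam * ∑ i ∈ Finset.range m, a ^ i := by positivity
    simp only [e]; linarith
  have hes : ∀ m, e (m + 1) = a * (e m - 1) + (1 - lam) := by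
    intro m
    simp only [e, Finset.sum_range_succ', pow_succ', ← Finset.mul_sum, pow_zero]
    ring
  have he00 : e 0 = 1 := by simp [e]
  clear_value e
  have hF : ∀ m ≤ n, q (k 0) * ∏ i ∈ Finset.range m, t i ≤ c1 ^ m * q (k m) ^ e m := by
    intro m
    induction m with
    | zero => intro _; simp [he00]
    | succ m ih =>
      intro hm
      have h1 := ih (by omega)
      have hkm := hk1 m (by omega)
      obtain ⟨p, hp⟩ : ∃ p, k (m + 1) = p + 1 := ⟨k (m + 1) - 1, by omega⟩
      have ht : t m = q (p + 1) / q p * ℓ (v p) := by simp only [t, hp, Nat.add_sub_cancel]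
      have hq0 : 0 < q p := one_pos.trans_le (hq1 p)
      have hq0' : 0 < q (p + 1) := one_pos.trans_le (hq1 _)
      have h2 : q (k m) ^ e m ≤ q p ^ e m :=
        Real.rpow_le_rpow (by linarith [hq1 (k m)]) (hqm (by omega)) (he0 m (by omega))
      have ht0 : 0 ≤ t m := by rw [ht]; have := hℓ0 (v p); positivity
      have h3 : t m ≤ c1 * (q (p + 1) ^ (1 - lam) * (q p)⁻¹) := by
        rw [ht]
        calc _ ≤ q (p + 1) / q p * (c1 * q (p + 1) ^ (-lam)) :=
              mul_le_mul_of_nonneg_left (hle p) (by positivity)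
          _ = _ := by
              rw [sub_eq_add_neg, Real.rpow_add hq0', Real.rpow_one]; ring
      have h4 : q p ^ (e m - 1) ≤ q (p + 1) ^ (a * (e m - 1)) := by
        rw [Real.rpow_mul hq0'.le]
        exact Real.rpow_le_rpow_of_nonpos (by positivity) (hqa p) (by linarith [he1 m])
      rw [Finset.prod_range_succ, ← mul_assoc, hp, hes]
      calc _ ≤ (c1 ^ m * q p ^ e m) * (c1 * (q (p + 1) ^ (1 - lam) * (q p)⁻¹)) :=
            mul_le_mul (h1.trans (mul_le_mul_of_nonneg_left h2 (by positivity))) h3 ht0 (by positivity)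
        _ = c1 ^ (m + 1) * (q p ^ (e m - 1) * q (p + 1) ^ (1 - lam)) := by
            rw [Real.rpow_sub hq0, Real.rpow_one, pow_succ]; ring
        _ ≤ c1 ^ (m + 1) * (q (p + 1) ^ (a * (e m - 1)) * q (p + 1) ^ (1 - lam)) := by gcongr
        _ = _ := by rw [Real.rpow_add hq0']
  have hfin := hF n le_rfl
  rw [hen, Real.rpow_zero, mul_one] at hfin
  have hcn : c1 ^ n ≤ c1 := pow_le_of_le_one hc1.le hc1a (by omega)
  rw [Finset.prod_mul_distrib, Finset.prod_const, Finset.card_range] at hdet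
  have h1 : 1 ≤ G * (q (k 0) * ∏ i ∈ Finset.range n, t i) := by
    refine hdet.trans (le_of_eq ?_)
    simp only [G]; ring
  have h2 := mul_le_mul_of_nonneg_left (hfin.trans hcn) hG.le
  rw [lt_div_iff₀ hG] at hc1c
  linarith

/-- Theorem 6.1, assertion (6.2): for `θ` real algebraic of degree `n ≥ 2` and
`ξ ∈ ℝ ∖ ℚ(θ)`, the point `ξ⃗ = (1, θ, …, θ^{n−1}, ξ)` satisfies
`limsup_{X→∞} X^{λ_n} 𝓛_{ξ⃗}(X) > 0`, where `λ_n` is the unique positive solution of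
`x + (n−1)x² + ⋯ + (n−1)^{n−1}xⁿ = 1`. -/
theorem limsup_positive (n : ℕ) (hn : 2 ≤ n) (θ : ℝ)
    (hθ : IsAlgebraic ℚ θ) (hdeg : (minpoly ℚ θ).natDegree = n)
    (ξ : ℝ) (hξ : ξ ∉ IntermediateField.adjoin ℚ ({θ} : Set ℝ))
    (lam : ℝ) (hlam : 0 < lam)
    (hlameq : ∑ k ∈ Finset.Icc 1 n, ((n : ℝ) - 1) ^ (k - 1) * lam ^ k = 1) :
    0 < Filter.limsup (fun X : ℝ => ENNReal.ofReal (X ^ lam) * calL (xivec n θ ξ) Set.univ X)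
      Filter.atTop := by
  rw [pos_iff_ne_zero]
  intro h0
  have hz0 : xivec n θ ξ 0 = 1 := by
    have : 0 < n := by omega
    simp [xivec, this]
  have hℓ : ∀ (x : Fin (n + 1) → ℤ) k, |(x k : ℝ) - xivec n θ ξ k * x 0| ≤ Lxi (xivec n θ ξ) x := by
    intro x k
    have := Finset.le_sup' (fun k => |xivec n θ ξ 0 * (x k : ℝ) - xivec n θ ξ k * (x 0 : ℝ)|)
      (Finset.mem_univ k)
    simp only [hz0, one_mul] at this
    simpa only [Lxi, hz0, one_mul] using this
  obtain ⟨c', hc', hl⟩ := liouville n hn θ ξ hθ hdeg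
  refine main_contra hn (xivec n θ ξ) (xivec_indep n hn θ ξ hdeg hξ) (Lxi (xivec n θ ξ)) hℓ c' hc'
    (fun x hx hx1 => hl x _ hx hx1 (hℓ x)) lam hlam hlameq ?_
  intro c hc
  have hev := Filter.eventually_lt_of_limsup_lt (b := ENNReal.ofReal c) (by
    rw [h0]; exact ENNReal.ofReal_pos.2 hc)
  obtain ⟨X0, hX0⟩ := Filter.eventually_atTop.1 hev
  refine ⟨max X0 1, fun X hX => ?_⟩
  have hXp : 0 < X := one_pos.trans_le ((le_max_right _ _).trans hX)
  have h1 := hX0 X ((le_max_left _ _).trans hX)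
  have hXl : 0 < X ^ lam := Real.rpow_pos_of_pos hXp _
  have h2 : calL (xivec n θ ξ) Set.univ X < ENNReal.ofReal (c * X ^ (-lam)) := by
    by_contra hcon
    have h3 := mul_le_mul_right (not_lt.1 hcon) (ENNReal.ofReal (X ^ lam))
    rw [← ENNReal.ofReal_mul hXl.le] at h3
    have h4 : X ^ lam * (c * X ^ (-lam)) = c := by
      rw [Real.rpow_neg hXp.le]; field_simp
    rw [h4] at h3
    exact absurd h1 (not_lt.2 h3)
  obtain ⟨_, ⟨x, -, hx, hxX, rfl⟩, hlt⟩ := sInf_lt_iff.1 h2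
  refine ⟨x, hx, le_trans ?_ hxX, (ENNReal.ofReal_lt_ofReal_iff (by positivity)).1 hlt⟩
  unfold inorm
  apply Real.abs_le_sqrt
  exact Finset.single_le_sum (f := fun k => ((x k : ℝ)) ^ 2) (fun _ _ => sq_nonneg _)
    (Finset.mem_univ 0)
end

section
/- For every integer n ≥ 1 there exists a constant c > 0 depending only on n such that for all vector subspaces A and B of ℝ^{n+1} that are defined over ℚ (i.e., spanned by vectors with rational coordinates), one has H(A+B) · H(A∩B) ≤ c · H(A) · H(B). -/
/-- A subspace of `ℝ^{n+1}` is defined over `ℚ` if it is spanned by vectors with rational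
coordinates. -/
def DefinedOverQ {n : ℕ} (W : Submodule ℝ (Fin (n + 1) → ℝ)) : Prop :=
  ∃ T : Set (Fin (n + 1) → ℚ),
    W = Submodule.span ℝ ((fun q : Fin (n + 1) → ℚ => fun j => ((q j : ℝ))) '' T)

/-- `b` is a `ℤ`-basis of the lattice `W ∩ ℤ^{n+1}`: each `b i` is an integer point of `W`,
the family is `ℤ`-linearly independent, and every integer point of `W` is a `ℤ`-linear
combination of the `b i`. -/
def IsLatticeBasis {n k : ℕ} (W : Submodule ℝ (Fin (n + 1) → ℝ))
    (b : Fin k → Fin (n + 1) → ℤ) : Prop :=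
  (∀ i, (fun j => ((b i j : ℝ))) ∈ W) ∧
  LinearIndependent ℤ b ∧
  ∀ v : Fin (n + 1) → ℤ, ((fun j => ((v j : ℝ))) ∈ W) → ∃ c : Fin k → ℤ, v = ∑ i, c i • b i

/-- The covolume `√(det G)` of the lattice generated by `b`, where `G` is the Gram matrix of
the (real images of the) vectors `b i`; for `k = 0` this equals `1`, in accordance with the
convention `H({0}) = 1`. -/
noncomputable def heightOf {n k : ℕ} (b : Fin k → Fin (n + 1) → ℤ) : ℝ :=
  Real.sqrt (Matrix.det (Matrix.of fun i i' : Fin k => ∑ j, ((b i j : ℝ)) * ((b i' j : ℝ))))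

section Aux
open Matrix

lemma aux_one_le_det {m : Type*} [Fintype m] [DecidableEq m] {D : Matrix m m ℝ}
    (hD : D.PosSemidef) : 1 ≤ (1 + D).det := by
  have hH : (1 + D).IsHermitian := (Matrix.PosSemidef.one.add hD).1
  rw [hH.det_eq_prod_eigenvalues]
  have key : ∀ i, 1 ≤ hH.eigenvalues i := by
    intro i
    rw [hH.eigenvalues_eq i]
    have h1 := hD.dotProduct_mulVec_nonneg (hH.eigenvectorBasis i).ofLp
    have h2 : star (hH.eigenvectorBasis i).ofLp ⬝ᵥ (hH.eigenvectorBasis i).ofLp = 1 := by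
      have h3 := hH.eigenvectorBasis.orthonormal.1 i
      have h4 : inner ℝ (hH.eigenvectorBasis i) (hH.eigenvectorBasis i) = (1 : ℝ) := by
        rw [real_inner_self_eq_norm_sq, h3]; norm_num
      rw [EuclideanSpace.inner_eq_star_dotProduct] at h4
      rwa [dotProduct_comm] at h4
    rw [Matrix.add_mulVec, Matrix.one_mulVec, dotProduct_add, h2]
    simpa using h1
  have : (1 : ℝ) = ∏ i : m, (1 : ℝ) := by simp
  rw [this]
  exact Finset.prod_le_prod (fun _ _ => zero_le_one) (fun i _ => key i)

lemma aux_det_le {m : Type*} [Fintype m] [DecidableEq m] {A B : Matrix m m ℝ}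
    (hA : A.PosDef) (hB : B.PosSemidef) : A.det ≤ (A + B).det := by
  obtain ⟨C, rfl⟩ : ∃ C : Matrix m m ℝ, B = Cᴴ * C := by
    open scoped MatrixOrder in
    exact CStarAlgebra.nonneg_iff_eq_star_mul_self.1 hB.nonneg
  have hu : IsUnit A.det := (Matrix.isUnit_iff_isUnit_det _).1 hA.isUnit
  rw [Matrix.det_add_mul _ _ hu]
  have h := aux_one_le_det (hA.inv.posSemidef.mul_mul_conjTranspose_same C)
  nlinarith [hA.det_pos]

lemma aux_fischer {x y : Type*} [Fintype x] [DecidableEq x] [Fintype y] [DecidableEq y]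
    {M : Matrix (x ⊕ y) (x ⊕ y) ℝ} (hM : M.PosDef) :
    M.det ≤ (M.submatrix Sum.inl Sum.inl).det * (M.submatrix Sum.inr Sum.inr).det := by
  have hP : (M.submatrix Sum.inl Sum.inl : Matrix x x ℝ).PosDef := hM.submatrix Sum.inl_injective
  set P : Matrix x x ℝ := M.submatrix Sum.inl Sum.inl
  set B : Matrix x y ℝ := M.submatrix Sum.inl Sum.inr
  set D : Matrix y y ℝ := M.submatrix Sum.inr Sum.inr
  have hMe : M = fromBlocks P B Bᴴ D := by
    ext i j
    have := congrFun (congrFun hM.1 i) j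
    rcases i with i | i <;> rcases j with j | j <;> simp_all [P, B, D]
  let : Invertible P := hP.isUnit.invertible
  have hS : (D - Bᴴ * P⁻¹ * B).PosSemidef := by
    rw [← Matrix.PosDef.fromBlocks₁₁ B D hP, ← hMe]; exact hM.posSemidef
  have hdet : M.det = P.det * (D - Bᴴ * P⁻¹ * B).det := by
    conv_lhs => rw [hMe]
    rw [det_fromBlocks₁₁, invOf_eq_nonsing_inv]
  have hS' : (D - Bᴴ * P⁻¹ * B).PosDef := by
    rw [hS.posDef_iff_det_ne_zero]
    intro h
    have := hM.det_pos
    rw [hdet, h] at this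
    simp at this
  rw [hdet]
  refine mul_le_mul_of_nonneg_left ?_ hP.det_pos.le
  have := aux_det_le hS' (hP.inv.posSemidef.conjTranspose_mul_mul_same B)
  simpa using this

lemma aux_kot {w x y : Type} [Fintype w] [DecidableEq w] [Fintype x] [DecidableEq x]
    [Fintype y] [DecidableEq y]
    {M : Matrix (w ⊕ (x ⊕ y)) (w ⊕ (x ⊕ y)) ℝ} (hM : M.PosDef) :
    M.det * (M.submatrix Sum.inl Sum.inl).det ≤
      (M.submatrix (Sum.map id Sum.inl) (Sum.map id Sum.inl) : Matrix (w ⊕ x) (w ⊕ x) ℝ).det *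
      (M.submatrix (Sum.map id Sum.inr) (Sum.map id Sum.inr) : Matrix (w ⊕ y) (w ⊕ y) ℝ).det := by
  have hP : (M.submatrix Sum.inl Sum.inl : Matrix w w ℝ).PosDef := hM.submatrix Sum.inl_injective
  set P : Matrix w w ℝ := M.submatrix Sum.inl Sum.inl
  set B : Matrix w (x ⊕ y) ℝ := M.submatrix Sum.inl Sum.inr
  set D : Matrix (x ⊕ y) (x ⊕ y) ℝ := M.submatrix Sum.inr Sum.inr
  have hMe : M = fromBlocks P B Bᴴ D := by
    ext i j
    have := congrFun (congrFun hM.1 i) j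
    rcases i with i | i <;> rcases j with j | j <;> simp_all [P, B, D]
  let : Invertible P := hP.isUnit.invertible
  have hS : (D - Bᴴ * P⁻¹ * B).PosSemidef := by
    rw [← Matrix.PosDef.fromBlocks₁₁ B D hP, ← hMe]; exact hM.posSemidef
  have hdet : M.det = P.det * (D - Bᴴ * P⁻¹ * B).det := by
    conv_lhs => rw [hMe]
    rw [det_fromBlocks₁₁, invOf_eq_nonsing_inv]
  have hS' : (D - Bᴴ * P⁻¹ * B).PosDef := by
    rw [hS.posDef_iff_det_ne_zero]
    intro h
    have := hM.det_pos
    rw [hdet, h] at this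
    simp at this
  have hsub : ∀ {z : Type} [Fintype z] [DecidableEq z] (f : z → x ⊕ y),
      (M.submatrix (Sum.map id f) (Sum.map id f) : Matrix (w ⊕ z) (w ⊕ z) ℝ).det =
      P.det * ((D - Bᴴ * P⁻¹ * B).submatrix f f).det := by
    intro z _ _ f
    have : (M.submatrix (Sum.map id f) (Sum.map id f) : Matrix (w ⊕ z) (w ⊕ z) ℝ) =
      fromBlocks P (B.submatrix id f) (Bᴴ.submatrix f id) (D.submatrix f f) := by
      conv_lhs => rw [hMe]
      ext i j
      rcases i with i | i <;> rcases j with j | j <;> rfl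
    rw [this, det_fromBlocks₁₁, invOf_eq_nonsing_inv]
    rfl
  rw [hdet, hsub, hsub]
  have := mul_le_mul_of_nonneg_left (aux_fischer hS') (mul_pos hP.det_pos hP.det_pos).le
  linarith

lemma aux_extend {M : Type*} [AddCommGroup M] [Module.Finite ℤ M]
    (N L : Submodule ℤ M) (hNL : N ≤ L)
    (hsat : ∀ (r : ℤ) (v : M), r ≠ 0 → r • v ∈ N → v ∈ N)
    {k : ℕ} (b : Fin k → M) (hb : LinearIndependent ℤ b) (hbN : Submodule.span ℤ (Set.range b) = N) :
    ∃ (m : ℕ) (X : Fin m → M), (∀ i, X i ∈ L) ∧ LinearIndependent ℤ (Sum.elim b X) ∧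
      Submodule.span ℤ (Set.range (Sum.elim b X)) = L := by
  have htf : Module.IsTorsionFree ℤ (↥L ⧸ N.submoduleOf L) := by
    rw [Module.isTorsionFree_iff_smul_eq_zero]
    intro r q hq
    by_contra! hc
    obtain ⟨hr, hq0⟩ := hc
    induction q using Submodule.Quotient.induction_on with
    | _ v =>
      rw [← Submodule.Quotient.mk_smul, Submodule.Quotient.mk_eq_zero] at hq
      rw [Ne, Submodule.Quotient.mk_eq_zero] at hq0
      exact hq0 (hsat r v hr hq)
  let bQ := Module.finBasis ℤ (↥L ⧸ N.submoduleOf L)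
  let bN : Module.Basis (Fin k) ℤ (N.submoduleOf L) :=
    ((Module.Basis.span hb).map (LinearEquiv.ofEq _ _ hbN)).map
      (Submodule.submoduleOfEquivOfLe hNL).symm
  let bb := (bN.sumQuot bQ)
  have hbb : (fun i => ((bb i : L) : M)) = Sum.elim b (fun i => ((bb (Sum.inr i) : L) : M)) := by
    funext i
    rcases i with i | i
    · simp [bb, bN, Submodule.submoduleOfEquivOfLe, Module.Basis.span_apply]
    · rfl
  refine ⟨_, fun i => ((bb (Sum.inr i) : L) : M), fun i => (bb (Sum.inr i)).2, ?_, ?_⟩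
  · rw [← hbb]
    exact bb.linearIndependent.map' L.subtype (Submodule.ker_subtype L)
  · rw [← hbb]
    have := congrArg (Submodule.map L.subtype) bb.span_eq
    rw [Submodule.map_span, ← Set.range_comp, Submodule.map_top, Submodule.range_subtype] at this
    exact this

/-- Real Gram matrix of an integer family. -/
noncomputable def auxGram {n : ℕ} {ι : Type} (b : ι → Fin (n + 1) → ℤ) : Matrix ι ι ℝ :=
  Matrix.of fun i i' => ∑ j, ((b i j : ℝ)) * ((b i' j : ℝ))

lemma auxGram_eq {n : ℕ} {ι : Type} (b : ι → Fin (n + 1) → ℤ) :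
    auxGram b = ((Matrix.of b).map (Int.cast : ℤ → ℝ)) * ((Matrix.of b).map (Int.cast : ℤ → ℝ))ᴴ := by
  ext i j
  simp [auxGram, Matrix.mul_apply]

lemma auxGram_posSemidef {n : ℕ} {ι : Type} [Fintype ι] (b : ι → Fin (n + 1) → ℤ) :
    (auxGram b).PosSemidef := by
  rw [auxGram_eq]; exact Matrix.posSemidef_self_mul_conjTranspose _

lemma auxGram_posDef {n : ℕ} {ι : Type} [Fintype ι] [DecidableEq ι] (b : ι → Fin (n + 1) → ℤ)
    (hb : LinearIndependent ℤ b) : (auxGram b).PosDef := by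
  rw [(auxGram_posSemidef b).posDef_iff_det_ne_zero]
  have h1 : auxGram b = (Matrix.of b * (Matrix.of b)ᵀ).map (Int.castRingHom ℝ) := by
    ext i j
    simp [auxGram, Matrix.mul_apply]
  have h2 : (auxGram b).det = (Int.castRingHom ℝ) (Matrix.of b * (Matrix.of b)ᵀ).det := by
    rw [h1, RingHom.map_det]; rfl
  rw [h2]
  intro h0
  have h0' : (Matrix.of b * (Matrix.of b)ᵀ).det = 0 := by simpa using h0
  obtain ⟨v, hv, hv0⟩ := Matrix.exists_vecMul_eq_zero_iff.2 h0'
  apply hv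
  have h3 : (v ᵥ* Matrix.of b) ⬝ᵥ (v ᵥ* Matrix.of b) = 0 := by
    have := congrArg (fun t => t ⬝ᵥ v) hv0
    simp only [zero_dotProduct] at this
    rw [← Matrix.vecMul_vecMul, ← Matrix.dotProduct_mulVec, Matrix.mulVec_transpose] at this
    exact this
  rw [dotProduct_self_eq_zero] at h3
  have h4 : ∑ i, v i • b i = 0 := by
    rw [← h3]
    ext j
    simp [Matrix.vecMul, dotProduct]
  funext i
  exact Fintype.linearIndependent_iff.1 hb v h4 i

lemma auxGram_le {n : ℕ} {ι κ : Type} [Fintype ι] [DecidableEq ι] [Fintype κ] [DecidableEq κ]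
    (e : ι ≃ κ) (u : ι → Fin (n + 1) → ℤ) (v : κ → Fin (n + 1) → ℤ)
    (hu : LinearIndependent ℤ u) (h : ∀ i, ∃ c : κ → ℤ, u i = ∑ j, c j • v j) :
    (auxGram v).det ≤ (auxGram u).det := by
  choose c hc using h
  let C : Matrix κ κ ℤ := Matrix.of fun i j => c (e.symm i) j
  have h1 : (auxGram u).submatrix e.symm e.symm =
      C.map (Int.castRingHom ℝ) * auxGram v * (C.map (Int.castRingHom ℝ))ᵀ := by
    rw [auxGram_eq, auxGram_eq]
    have : (Matrix.of (u ∘ e.symm)).map (Int.cast : ℤ → ℝ) =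
        C.map (Int.castRingHom ℝ) * (Matrix.of v).map (Int.cast : ℤ → ℝ) := by
      ext i j
      simp [C, hc, Matrix.mul_apply]
    have h5 : (auxGram u).submatrix e.symm e.symm = auxGram (u ∘ e.symm) := rfl
    rw [← auxGram_eq, h5, auxGram_eq, this, Matrix.conjTranspose_mul, 
      Matrix.conjTranspose_eq_transpose_of_trivial (C.map (Int.castRingHom ℝ))]
    simp only [Matrix.mul_assoc]
  have h2 : (auxGram u).det = ((C.det : ℤ) : ℝ) ^ 2 * (auxGram v).det := by
    rw [← Matrix.det_submatrix_equiv_self e.symm, h1, Matrix.det_mul, Matrix.det_mul,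
      Matrix.det_transpose]
    have : (C.map (Int.castRingHom ℝ)).det = ((C.det : ℤ) : ℝ) :=
      ((Int.castRingHom ℝ).map_det C).symm
    rw [this]; ring
  have hpos := (auxGram_posDef u hu).det_pos
  have hv := (auxGram_posSemidef v).det_nonneg
  have hC : C.det ≠ 0 := by
    intro h
    rw [h2, h] at hpos
    simp at hpos
  have : (1 : ℝ) ≤ ((C.det : ℤ) : ℝ) ^ 2 := by
    have : 1 ≤ C.det ^ 2 := by have := sq_pos_of_ne_zero hC; omega
    exact_mod_cast this
  rw [h2]
  nlinarith

/-- Lattice of integer points of a real subspace. -/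
def auxLat {n : ℕ} (W : Submodule ℝ (Fin (n + 1) → ℝ)) : Submodule ℤ (Fin (n + 1) → ℤ) where
  carrier := {v | (fun j => ((v j : ℝ))) ∈ W}
  zero_mem' := by
    have := W.zero_mem
    simpa [Pi.zero_def] using this
  add_mem' := by
    intro a b ha hb
    have := W.add_mem ha hb
    simpa [Pi.add_def] using this
  smul_mem' := by
    intro r a ha
    have := W.smul_mem (r : ℝ) ha
    simpa [Pi.smul_def] using this

lemma mem_auxLat {n : ℕ} (W : Submodule ℝ (Fin (n + 1) → ℝ)) (v : Fin (n + 1) → ℤ) :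
    v ∈ auxLat W ↔ (fun j => ((v j : ℝ))) ∈ W := Iff.rfl

lemma auxLat_sat {n : ℕ} (W : Submodule ℝ (Fin (n + 1) → ℝ)) (r : ℤ) (v : Fin (n + 1) → ℤ)
    (hr : r ≠ 0) (h : r • v ∈ auxLat W) : v ∈ auxLat W := by
  rw [mem_auxLat] at *
  have h1 := W.smul_mem ((r : ℝ)⁻¹) h
  have hr' : (r : ℝ) ≠ 0 := by exact_mod_cast hr
  have h2 : (r : ℝ)⁻¹ • (fun j => (((r • v) j : ℤ) : ℝ)) = fun j => ((v j : ℝ)) := by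
    funext j
    simp [hr']
  rwa [h2] at h1

lemma auxBasis_span {n k : ℕ} {W : Submodule ℝ (Fin (n + 1) → ℝ)}
    {b : Fin k → Fin (n + 1) → ℤ} (h : IsLatticeBasis W b) :
    Submodule.span ℤ (Set.range b) = auxLat W := by
  apply le_antisymm
  · rw [Submodule.span_le]
    rintro _ ⟨i, rfl⟩
    exact h.1 i
  · intro v hv
    obtain ⟨c, rfl⟩ := h.2.2 v hv
    exact Submodule.sum_mem _ fun i _ => Submodule.smul_mem _ _ (Submodule.subset_span ⟨i, rfl⟩)

lemma heightOf_eq {n k : ℕ} (b : Fin k → Fin (n + 1) → ℤ) :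
    heightOf b = Real.sqrt (auxGram b).det := rfl

lemma aux_card {M : Type*} [AddCommGroup M] {ι κ : Type} [Fintype ι] [Fintype κ]
    (u : ι → M) (v : κ → M) (hu : LinearIndependent ℤ u) (hv : LinearIndependent ℤ v)
    (h : Submodule.span ℤ (Set.range u) = Submodule.span ℤ (Set.range v)) :
    Fintype.card ι = Fintype.card κ := by
  rw [← finrank_span_eq_card hu, ← finrank_span_eq_card hv, h]

lemma aux_comb {M : Type*} [AddCommGroup M] {κ : Type} [Fintype κ] {v : κ → M} {x : M}
    (h : x ∈ Submodule.span ℤ (Set.range v)) : ∃ c : κ → ℤ, x = ∑ j, c j • v j := by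
  obtain ⟨c, hc⟩ := (Submodule.mem_span_range_iff_exists_fun ℤ).1 h
  exact ⟨c, hc.symm⟩

lemma aux_indep3 {M : Type*} [AddCommGroup M] {w x y : Type} [Fintype w] [Fintype x] [Fintype y]
    (b : w → M) (X : x → M) (Y : y → M) (A B : Submodule ℤ M)
    (hbX : LinearIndependent ℤ (Sum.elim b X)) (hbY : LinearIndependent ℤ (Sum.elim b Y))
    (hA : Submodule.span ℤ (Set.range (Sum.elim b X)) = A)
    (hB : Submodule.span ℤ (Set.range (Sum.elim b Y)) = B)
    (hI : Submodule.span ℤ (Set.range b) = A ⊓ B) :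
    LinearIndependent ℤ (Sum.elim b (Sum.elim X Y)) := by
  rw [Fintype.linearIndependent_iff] at *
  intro g hg
  simp only [Fintype.sum_sum_type, Sum.elim_inl, Sum.elim_inr] at hg hbX hbY
  have hbA : ∀ i, b i ∈ A := fun i => hA ▸ Submodule.subset_span ⟨Sum.inl i, rfl⟩
  have hXA : ∀ i, X i ∈ A := fun i => hA ▸ Submodule.subset_span ⟨Sum.inr i, rfl⟩
  have hYB : ∀ i, Y i ∈ B := fun i => hB ▸ Submodule.subset_span ⟨Sum.inr i, rfl⟩
  have hYI : ∑ i, g (Sum.inr (Sum.inr i)) • Y i ∈ Submodule.span ℤ (Set.range b) := by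
    rw [hI]
    refine ⟨?_, Submodule.sum_mem _ fun i _ => Submodule.smul_mem _ _ (hYB i)⟩
    have : ∑ i, g (Sum.inr (Sum.inr i)) • Y i =
      -(∑ i, g (Sum.inl i) • b i + ∑ i, g (Sum.inr (Sum.inl i)) • X i) := by
      rw [eq_neg_iff_add_eq_zero, ← hg]; abel
    rw [this]
    exact A.neg_mem (A.add_mem (Submodule.sum_mem _ fun i _ => Submodule.smul_mem _ _ (hbA i))
      (Submodule.sum_mem _ fun i _ => Submodule.smul_mem _ _ (hXA i)))
  obtain ⟨c, hc⟩ := aux_comb hYI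
  have h1 := hbY (Sum.elim (fun i => - c i) (fun i => g (Sum.inr (Sum.inr i)))) (by
    simp [hc])
  have hY0 : ∀ i, g (Sum.inr (Sum.inr i)) = 0 := fun i => h1 (Sum.inr i)
  have h2 := hbX (Sum.elim (fun i => g (Sum.inl i)) (fun i => g (Sum.inr (Sum.inl i)))) (by
    simpa [hY0] using hg)
  rintro (i | i | i)
  · exact h2 (Sum.inl i)
  · exact h2 (Sum.inr i)
  · exact hY0 i

end Aux

/-- Schmidt's inequality: there is a constant `c > 0` depending only on `n` such that
`H(A + B) · H(A ∩ B) ≤ c · H(A) · H(B)` for all subspaces `A, B` of `ℝ^{n+1}` defined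
over `ℚ`, the heights being computed from `ℤ`-bases of the corresponding lattices. -/
theorem schmidt_height_inequality (n : ℕ) (hn : 1 ≤ n) :
    ∃ c : ℝ, 0 < c ∧
      ∀ (A B : Submodule ℝ (Fin (n + 1) → ℝ)),
        DefinedOverQ A → DefinedOverQ B →
        ∀ (kA kB kS kI : ℕ)
          (bA : Fin kA → Fin (n + 1) → ℤ) (bB : Fin kB → Fin (n + 1) → ℤ)
          (bS : Fin kS → Fin (n + 1) → ℤ) (bI : Fin kI → Fin (n + 1) → ℤ),
          kA = Module.finrank ℝ ↥A → kB = Module.finrank ℝ ↥B →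
          kS = Module.finrank ℝ ↥(A ⊔ B) → kI = Module.finrank ℝ ↥(A ⊓ B) →
          IsLatticeBasis A bA → IsLatticeBasis B bB →
          IsLatticeBasis (A ⊔ B) bS → IsLatticeBasis (A ⊓ B) bI →
          heightOf bS * heightOf bI ≤ c * heightOf bA * heightOf bB := by
  refine ⟨1, one_pos, ?_⟩
  intro A B _ _ kA kB kS kI bA bB bS bI hkA hkB hkS hkI hA hB hS hI
  have hIinf : auxLat (A ⊓ B) = auxLat A ⊓ auxLat B := rfl
  obtain ⟨p, X, hX, hXi, hXs⟩ := aux_extend (auxLat (A ⊓ B)) (auxLat A)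
    (hIinf ▸ inf_le_left) (auxLat_sat _) bI hI.2.1 (auxBasis_span hI)
  obtain ⟨q, Y, hY, hYi, hYs⟩ := aux_extend (auxLat (A ⊓ B)) (auxLat B)
    (hIinf ▸ inf_le_right) (auxLat_sat _) bI hI.2.1 (auxBasis_span hI)
  have hcA := aux_card _ _ hA.2.1 hXi ((auxBasis_span hA).trans hXs.symm)
  have hcB := aux_card _ _ hB.2.1 hYi ((auxBasis_span hB).trans hYs.symm)
  have h3 := aux_indep3 bI X Y _ _ hXi hYi hXs hYs (auxBasis_span hI)
  have hdim := Submodule.finrank_sup_add_finrank_inf_eq A B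
  rw [← hkA, ← hkB, ← hkS, ← hkI] at hdim
  have hcS : Fintype.card (Fin kI ⊕ (Fin p ⊕ Fin q)) = Fintype.card (Fin kS) := by
    simp only [Fintype.card_sum, Fintype.card_fin] at *
    omega
  have gA := auxGram_le (Fintype.equivOfCardEq hcA) bA (Sum.elim bI X) hA.2.1
    (fun i => aux_comb (by rw [hXs]; exact hA.1 i))
  have gB := auxGram_le (Fintype.equivOfCardEq hcB) bB (Sum.elim bI Y) hB.2.1
    (fun i => aux_comb (by rw [hYs]; exact hB.1 i))
  have gS := auxGram_le (Fintype.equivOfCardEq hcS) (Sum.elim bI (Sum.elim X Y)) bS h3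
    (fun i => aux_comb (by
      rw [auxBasis_span hS]
      have hAle : auxLat A ≤ auxLat (A ⊔ B) := fun v hv => (le_sup_left : A ≤ A ⊔ B) hv
      have hBle : auxLat B ≤ auxLat (A ⊔ B) := fun v hv => (le_sup_right : B ≤ A ⊔ B) hv
      rcases i with i | i | i
      · exact hAle (hI.1 i).1
      · exact hAle (hX i)
      · exact hBle (hY i)))
  have hk := aux_kot (auxGram_posDef _ h3)
  have e1 : (auxGram (Sum.elim bI (Sum.elim X Y))).submatrix Sum.inl Sum.inl = auxGram bI := rfl
  have e2 : (auxGram (Sum.elim bI (Sum.elim X Y))).submatrix (Sum.map id Sum.inl)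
      (Sum.map id Sum.inl) = auxGram (Sum.elim bI X) := by
    ext i j
    rcases i with i | i <;> rcases j with j | j <;> rfl
  have e3 : (auxGram (Sum.elim bI (Sum.elim X Y))).submatrix (Sum.map id Sum.inr)
      (Sum.map id Sum.inr) = auxGram (Sum.elim bI Y) := by
    ext i j
    rcases i with i | i <;> rcases j with j | j <;> rfl
  rw [e1, e2, e3] at hk
  have nI := (auxGram_posSemidef bI).det_nonneg
  have nS := (auxGram_posSemidef bS).det_nonneg
  have nA := (auxGram_posSemidef bA).det_nonneg
  have nY := (auxGram_posSemidef (Sum.elim bI Y)).det_nonneg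
  simp only [heightOf_eq, one_mul]
  rw [← Real.sqrt_mul nS, ← Real.sqrt_mul nA]
  apply Real.sqrt_le_sqrt
  calc _ ≤ _ := mul_le_mul_of_nonneg_right gS nI
    _ ≤ _ := hk
    _ ≤ _ := mul_le_mul gA gB nY nA
end

section
/- Let n ≥ 2 be an integer and let θ be a real algebraic number of degree n. Then there exists a constant c₂ > 0 depending only on θ such that for every ξ ∈ ℝ ∖ ℚ(θ), the point ξ⃗ = (1, θ, θ², …, θ^{n−1}, ξ) ∈ ℝ^{n+1} satisfies 𝓛_{ξ⃗}(X) ≥ c₂ X^{−1/(n−1)} for every real X ≥ 1. -/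
open Filter

theorem aux_den {ι : Type*} [Finite ι] (c : ι → ℚ) : ∃ D : ℤ, 0 < D ∧ ∀ i, ∃ z : ℤ, (D : ℚ) * c i = z := by
  obtain ⟨D, hD⟩ := IsLocalization.exist_integer_multiples_of_finite (nonZeroDivisors ℤ) c
  have h0 : (D : ℤ) ≠ 0 := nonZeroDivisors.coe_ne_zero D
  refine ⟨|(D : ℤ)|, abs_pos.mpr h0, fun i => ?_⟩
  obtain ⟨z, hz⟩ := hD i
  have hz' : ((D : ℤ) : ℚ) * c i = z := by
    simpa [Algebra.smul_def, eq_comm] using hz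
  rcases abs_choice (D : ℤ) with h | h
  · exact ⟨z, by rw [h, hz']⟩
  · exact ⟨-z, by rw [h]; push_cast; rw [neg_mul, hz']⟩

theorem aux_det_bound_s16 {m : ℕ} (B : Matrix (Fin (m + 1)) (Fin (m + 1)) ℝ) (f : Fin (m + 1) → ℝ)
    (h : ∀ i j, |B i j| ≤ f i) : |B.det| ≤ (m + 1).factorial * ∏ i, f i := by
  rw [Matrix.det_apply]
  refine (Finset.abs_sum_le_sum_abs _ _).trans ?_
  have : ∀ p ∈ (Finset.univ : Finset (Equiv.Perm (Fin (m + 1)))),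
      |Equiv.Perm.sign p • ∏ i, B (p i) i| ≤ ∏ i, f i := by
    intro p _
    have h1 : |Equiv.Perm.sign p • ∏ i, B (p i) i| = ∏ i, |B (p i) i| := by
      rw [← Finset.abs_prod]
      rcases Int.units_eq_one_or (Equiv.Perm.sign p) with h | h <;> simp [h]
    rw [h1, ← Equiv.prod_comp p f]
    exact Finset.prod_le_prod (fun i _ => abs_nonneg _) (fun i _ => h _ _)
  refine (Finset.sum_le_card_nsmul _ _ _ this).trans ?_
  simp [Fintype.card_perm]

theorem aux_nondeg {K : Type*} [Field K] [Algebra ℚ K] {m : ℕ} (b : Module.Basis (Fin (m + 1)) ℚ K)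
    (φ : K →ₗ[ℚ] ℚ) (hφ : φ ≠ 0) :
    (Matrix.of fun i j => φ (b i * b j)).det ≠ 0 := by
  intro hdet
  obtain ⟨v, hv, hv0⟩ := Matrix.exists_mulVec_eq_zero_iff.mpr hdet
  set β : K := ∑ j, v j • b j with hβ
  have hβ0 : β ≠ 0 := by
    intro h
    apply hv
    funext j
    exact Fintype.linearIndependent_iff.mp b.linearIndependent v h j
  have h1 : ∀ i, φ (b i * β) = 0 := by
    intro i
    have := congrFun hv0 i
    simp only [Matrix.mulVec, dotProduct, Matrix.of_apply, Pi.zero_apply] at this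
    rw [hβ, Finset.mul_sum, map_sum, ← this]
    refine Finset.sum_congr rfl fun j _ => ?_
    rw [mul_smul_comm, map_smul, smul_eq_mul, mul_comm]
  have h2 : φ ∘ₗ LinearMap.mulRight ℚ β = 0 := b.ext fun i => by simpa using h1 i
  apply hφ
  ext γ
  have := LinearMap.congr_fun h2 (γ * β⁻¹)
  simpa [hβ0] using this

theorem aux_main {K : Type*} [Field K] [Algebra ℚ K] {m : ℕ} (b : Module.Basis (Fin (m + 1)) ℚ K)
    (hb : b 0 = 1) (σ : K →ₐ[ℚ] ℝ) :
    ∃ C : ℝ, 0 < C ∧ ∀ x : Fin (m + 1) → ℤ, x ≠ 0 → ∀ X L : ℝ, (∀ i, |(x i : ℝ)| ≤ X) →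
      (∀ i, |(x i : ℝ) - σ (b i) * x 0| ≤ L) → 1 ≤ C * X * L ^ m := by
  obtain ⟨D, hD, hDz⟩ := aux_den
    (fun t : Fin (m + 1) × Fin (m + 1) × Fin (m + 1) => b.repr (b t.1 * b t.2.1) t.2.2)
  have hDR : (0 : ℝ) < D := by exact_mod_cast hD
  obtain ⟨S, hS⟩ : ∃ S : ℝ, S = ∑ i, ∑ j, ∑ l, |((b.repr (b i * b j) l : ℚ) : ℝ)| := ⟨_, rfl⟩
  obtain ⟨T, hT⟩ : ∃ T : ℝ, T = ∑ i, |σ (b i)| := ⟨_, rfl⟩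
  have hS0 : 0 ≤ S := by rw [hS]; positivity
  have hT0 : 0 ≤ T := by rw [hT]; positivity
  have hF : (0 : ℝ) < ((m + 1).factorial : ℝ) := by exact_mod_cast Nat.factorial_pos _
  refine ⟨(D : ℝ) ^ (m + 1) * (m + 1).factorial * (S + T + 1) ^ m,
    mul_pos (mul_pos (pow_pos hDR _) hF) (pow_pos (by linarith) _), ?_⟩
  intro x hx X L hX hL
  have hL0 : 0 ≤ L := (abs_nonneg _).trans (hL 0)
  have hX0 : 0 ≤ X := (abs_nonneg _).trans (hX 0)
  set φ : K →ₗ[ℚ] ℚ := b.constr ℚ (fun i => (x i : ℚ)) with hφdef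
  have hφb : ∀ i, φ (b i) = x i := fun i => by simp [hφdef]
  have hφ : φ ≠ 0 := by
    intro h
    apply hx
    funext i
    have := hφb i
    rw [h] at this
    simpa [eq_comm] using this
  have hnd := aux_nondeg b φ hφ
  have hexp : ∀ y : K, φ y = ∑ l, b.repr y l * x l := by
    intro y
    conv_lhs => rw [← b.sum_repr y]
    rw [map_sum]
    refine Finset.sum_congr rfl fun l _ => ?_
    rw [map_smul, hφb, smul_eq_mul]
  have hexpσ : ∀ y : K, σ y = ∑ l, (b.repr y l : ℝ) * σ (b l) := by
    intro y
    conv_lhs => rw [← b.sum_repr y]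
    rw [map_sum]
    refine Finset.sum_congr rfl fun l _ => ?_
    rw [map_smul, Rat.smul_def]
  set A : Matrix (Fin (m + 1)) (Fin (m + 1)) ℚ := Matrix.of fun i j => φ (b i * b j) with hA
  have hAint : ∀ i j, ∃ z : ℤ, (D : ℚ) * A i j = z := by
    intro i j
    choose z hz using hDz
    refine ⟨∑ l, z (i, j, l) * x l, ?_⟩
    simp only [hA, Matrix.of_apply, hexp, Finset.mul_sum]
    push_cast
    refine Finset.sum_congr rfl fun l _ => ?_
    rw [← mul_assoc, hz (i, j, l)]
  choose Z hZ using hAint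
  have hZdet : (((Matrix.of Z).det : ℤ) : ℚ) = (D : ℚ) ^ (m + 1) * A.det := by
    have h1 : ((D : ℚ) • A) = (Matrix.of Z).map (Int.castRingHom ℚ) := by
      ext i j
      simp [hZ]
    have h2 := Matrix.det_smul A (D : ℚ)
    rw [h1, ← RingHom.mapMatrix_apply, ← RingHom.map_det] at h2
    simpa using h2
  have hZ0 : (Matrix.of Z).det ≠ 0 := by
    intro h
    rw [h] at hZdet
    have : (D : ℚ) ≠ 0 := by exact_mod_cast hD.ne'
    have := mul_ne_zero (pow_ne_zero (m + 1) this) hnd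
    exact this (by rw [← hZdet]; simp)
  have hge : (1 : ℝ) ≤ (D : ℝ) ^ (m + 1) * |((A.det : ℚ) : ℝ)| := by
    have h1 : (1 : ℤ) ≤ |(Matrix.of Z).det| := Int.one_le_abs hZ0
    have h2 : (1 : ℝ) ≤ |(((Matrix.of Z).det : ℤ) : ℝ)| := by exact_mod_cast h1
    have h3 : (((Matrix.of Z).det : ℤ) : ℝ) = (D : ℝ) ^ (m + 1) * ((A.det : ℚ) : ℝ) := by
      have := congrArg (fun q : ℚ => (q : ℝ)) hZdet
      simp only [Rat.cast_mul, Rat.cast_pow, Rat.cast_intCast] at this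
      exact this
    rw [h3, abs_mul, abs_of_pos (pow_pos hDR _)] at h2
    exact h2
  -- the real matrix after row operations
  let c : Fin (m + 1) → ℝ := fun i => if i = 0 then 0 else σ (b i)
  let AR : Matrix (Fin (m + 1)) (Fin (m + 1)) ℝ := A.map (Rat.castHom ℝ)
  let B : Matrix (Fin (m + 1)) (Fin (m + 1)) ℝ := Matrix.of fun i j => AR i j - c i * AR 0 j
  have hARdet : ((A.det : ℚ) : ℝ) = AR.det := by
    exact RingHom.map_det (Rat.castHom ℝ) A
  have hBdet : AR.det = B.det := by
    refine Matrix.det_eq_of_forall_row_eq_smul_add_const c 0 (by simp [c]) ?_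
    intro i j
    simp [B, c]
  have hA0 : ∀ j, AR 0 j = x j := by
    intro j
    simp [AR, hA, hb, hφb]
  have hdiff : ∀ i j, |AR i j - σ (b i * b j) * x 0| ≤ S * L := by
    intro i j
    have h1 : AR i j - σ (b i * b j) * x 0
        = ∑ l, (b.repr (b i * b j) l : ℝ) * ((x l : ℝ) - σ (b l) * x 0) := by
      rw [hexpσ]
      simp only [AR, hA, Matrix.map_apply, Matrix.of_apply, hexp]
      simp only [map_sum, map_mul, Finset.sum_mul, ← Finset.sum_sub_distrib]
      refine Finset.sum_congr rfl fun l _ => ?_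
      simp
      ring
    rw [h1]
    refine (Finset.abs_sum_le_sum_abs _ _).trans ?_
    have h2 : ∑ l, |((b.repr (b i * b j) l : ℚ) : ℝ)| ≤ S := by
      rw [hS]
      refine le_trans ?_ (Finset.single_le_sum (f := fun i => ∑ j, ∑ l, |((b.repr (b i * b j) l : ℚ) : ℝ)|) (fun i _ => by positivity) (Finset.mem_univ i))
      exact (Finset.single_le_sum (f := fun j => ∑ l, |((b.repr (b i * b j) l : ℚ) : ℝ)|) (fun i _ => by positivity) (Finset.mem_univ j))
    refine le_trans ?_ (mul_le_mul_of_nonneg_right h2 hL0)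
    rw [Finset.sum_mul]
    refine Finset.sum_le_sum fun l _ => ?_
    rw [abs_mul]
    exact mul_le_mul_of_nonneg_left (hL l) (abs_nonneg _)
  let f : Fin (m + 1) → ℝ := Fin.cons X (fun _ => (S + T + 1) * L)
  have hBf : ∀ i j, |B i j| ≤ f i := by
    intro i j
    refine Fin.cases ?_ (fun i => ?_) i
    · simpa [B, c, f, hA0] using hX j
    · have h1 : B i.succ j = (AR i.succ j - σ (b i.succ * b j) * x 0)
          - σ (b i.succ) * ((x j : ℝ) - σ (b j) * x 0) := by
        simp only [B, c, Matrix.of_apply, hA0, map_mul, Fin.succ_ne_zero, if_false]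
        ring
      have h2 : |σ (b i.succ)| ≤ T := by
        rw [hT]
        exact Finset.single_le_sum (f := fun i => |σ (b i)|) (fun i _ => abs_nonneg _) (Finset.mem_univ _)
      have h3 : |σ (b i.succ) * ((x j : ℝ) - σ (b j) * x 0)| ≤ T * L := by
        rw [abs_mul]
        exact mul_le_mul h2 (hL j) (abs_nonneg _) hT0
      rw [h1]
      refine (abs_sub _ _).trans ?_
      have := hdiff i.succ j
      simp only [f, Fin.cons_succ]
      nlinarith
  have hfin := aux_det_bound_s16 B f hBf
  have hprod : ∏ i, f i = X * ((S + T + 1) * L) ^ m := by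
    rw [Fin.prod_univ_succ]
    simp [f]
  rw [hARdet, hBdet] at hge
  refine hge.trans ((mul_le_mul_of_nonneg_left hfin (by positivity)).trans (le_of_eq ?_))
  rw [hprod, mul_pow]
  ring

/-- Liouville-type lower bound (6.4): for `θ` real algebraic of degree `n ≥ 2`, there is a
constant `c₂ > 0` depending only on `θ` such that for every `ξ ∈ ℝ ∖ ℚ(θ)` the point
`ξ⃗ = (1, θ, …, θ^{n−1}, ξ)` satisfies `𝓛_{ξ⃗}(X) ≥ c₂ X^{−1/(n−1)}` for all `X ≥ 1`. -/
theorem liouville_lower_bound (n : ℕ) (hn : 2 ≤ n) (θ : ℝ)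
    (hθ : IsAlgebraic ℚ θ) (hdeg : (minpoly ℚ θ).natDegree = n) :
    ∃ c₂ : ℝ, 0 < c₂ ∧
      ∀ ξ : ℝ, ξ ∉ IntermediateField.adjoin ℚ ({θ} : Set ℝ) →
        ∀ X : ℝ, 1 ≤ X →
          ENNReal.ofReal (c₂ * X ^ (-(1 / ((n : ℝ) - 1)))) ≤ calL (xivec n θ ξ) Set.univ X := by
  obtain ⟨m, rfl⟩ : ∃ m, n = m + 1 := ⟨n - 1, by omega⟩
  have hm : 0 < m := by omega
  have hmR : (0 : ℝ) < m := by exact_mod_cast hm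
  have hint : IsIntegral ℚ θ := hθ.isIntegral
  let pb := IntermediateField.adjoin.powerBasis hint
  have hdim : pb.dim = m + 1 := by
    simpa [pb, IntermediateField.adjoin.powerBasis_dim] using hdeg
  let b := pb.basis.reindex (finCongr hdim)
  let σ : IntermediateField.adjoin ℚ ({θ} : Set ℝ) →ₐ[ℚ] ℝ :=
    (IntermediateField.adjoin ℚ ({θ} : Set ℝ)).val
  have hbpow : ∀ i, b i = pb.gen ^ (i : ℕ) := by
    intro i
    simp [b]
  have hσb : ∀ i, σ (b i) = θ ^ (i : ℕ) := by
    intro i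
    rw [hbpow, map_pow]
    have : σ pb.gen = θ := by
      simp only [pb, σ, IntermediateField.adjoin.powerBasis_gen]
      exact IntermediateField.AdjoinSimple.coe_gen ℚ θ
    rw [this]
  obtain ⟨C, hC, hmain⟩ := aux_main b (by rw [hbpow]; simp) σ
  have hCp : 0 < C ^ (-(1 / (m : ℝ))) := Real.rpow_pos_of_pos hC _
  refine ⟨min 1 (C ^ (-(1 / (m : ℝ)))), lt_min one_pos hCp, ?_⟩
  intro ξ _ X hX
  have hX0 : 0 < X := by linarith
  refine le_sInf ?_
  rintro l ⟨x, -, hx, hxX, rfl⟩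
  refine ENNReal.ofReal_le_ofReal ?_
  have hexpo : -(1 / (((m + 1 : ℕ) : ℝ) - 1)) = -(1 / (m : ℝ)) := by
    push_cast; ring_nf
  rw [hexpo]
  have hXp : 0 < X ^ (-(1 / (m : ℝ))) := Real.rpow_pos_of_pos hX0 _
  have hLk : ∀ k, |xivec (m + 1) θ ξ 0 * (x k : ℝ) - xivec (m + 1) θ ξ k * (x 0 : ℝ)|
      ≤ Lxi (xivec (m + 1) θ ξ) x := fun k =>
    Finset.le_sup' (fun k => |xivec (m + 1) θ ξ 0 * (x k : ℝ) - xivec (m + 1) θ ξ k * (x 0 : ℝ)|)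
      (Finset.mem_univ k)
  have hxi0 : xivec (m + 1) θ ξ 0 = 1 := by simp [xivec]
  set L := Lxi (xivec (m + 1) θ ξ) x
  by_cases hy : (fun i : Fin (m + 1) => x i.castSucc) = 0
  · have hx0 : x 0 = 0 := congrFun hy 0
    have hlast : x (Fin.last (m + 1)) ≠ 0 := by
      intro h
      apply hx
      funext i
      refine Fin.lastCases h (fun i => ?_) i
      exact congrFun hy i
    have h1 := hLk (Fin.last (m + 1))
    rw [hxi0, hx0] at h1
    have h2 : (1 : ℝ) ≤ |(x (Fin.last (m + 1)) : ℝ)| := by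
      exact_mod_cast Int.one_le_abs hlast
    have h3 : 1 ≤ L := by
      refine h2.trans ?_
      simpa using h1
    have h4 : X ^ (-(1 / (m : ℝ))) ≤ 1 :=
      Real.rpow_le_one_of_one_le_of_nonpos hX (by simp)
    refine le_trans ?_ h3
    exact mul_le_one₀ (min_le_left _ _) hXp.le h4
  · have h1 := hmain _ hy X L (fun i => ?_) (fun i => ?_)
    · have hL0 : 0 ≤ L := (abs_nonneg _).trans (hLk 0)
      refine (mul_le_mul_of_nonneg_right (min_le_right _ _) hXp.le).trans ?_
      rw [← Real.mul_rpow hC.le hX0.le, Real.rpow_neg (by positivity)]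
      have h2 : 1 / (C * X) ≤ L ^ m := by
        rw [div_le_iff₀ (by positivity)]
        linarith
      have h3 := Real.rpow_le_rpow (by positivity) h2 (z := 1 / (m : ℝ)) (by positivity)
      rw [one_div (m : ℝ), Real.pow_rpow_inv_natCast hL0 hm.ne', one_div (C * X),
        Real.inv_rpow (by positivity)] at h3
      rw [one_div (m : ℝ)]
      exact h3
    · refine le_trans ?_ hxX
      unfold inorm
      refine Real.abs_le_sqrt ?_
      exact Finset.single_le_sum (f := fun k => (x k : ℝ) ^ 2) (fun _ _ => sq_nonneg _)
        (Finset.mem_univ i.castSucc)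
    · have h2 := hLk i.castSucc
      rw [hxi0] at h2
      have h3 : xivec (m + 1) θ ξ i.castSucc = σ (b i) := by
        rw [hσb]
        exact if_pos i.isLt
      rw [h3, one_mul] at h2
      exact h2
end
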